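/- arXiv:0910.0208 — 2 statements merged into one kernel-verified Lean document; each statement's English description precedes it below -/
import Mathlib

section
/- Let [I] = [i_1,…,i_m] be a generating quantum minor of O_q(G(m,n)) and consider the composite map ρ_2∘θ∘T∘φ_1 from O_q(G(m,n)) into O_q(G(m,n))[M_2^{−1}]. Then ρ_2∘θ∘T∘φ_1([i_1,…,i_m]) = [i_1+1,…,i_m+1] if i_m ≠ n, and ρ_2∘θ∘T∘φ_1([i_1,…,i_{m-1},n]) = q^{−2}[1, i_1+1,…,i_{m-1}+1]. -/
open scoped BigOperators

namespace QG

variable (K : Type*) [Field K]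

/-- The defining relations of the quantum matrix algebra `O_q(M_{m,n})`. -/
inductive QMatRel (q : K) (m n : ℕ) :
    FreeAlgebra K (Fin m × Fin n) → FreeAlgebra K (Fin m × Fin n) → Prop
  | row : ∀ (i : Fin m) (j l : Fin n), j < l →
      QMatRel q m n (FreeAlgebra.ι K (i, j) * FreeAlgebra.ι K (i, l))
        (q • (FreeAlgebra.ι K (i, l) * FreeAlgebra.ι K (i, j)))
  | col : ∀ (i k : Fin m) (j : Fin n), i < k →
      QMatRel q m n (FreeAlgebra.ι K (i, j) * FreeAlgebra.ι K (k, j))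
        (q • (FreeAlgebra.ι K (k, j) * FreeAlgebra.ι K (i, j)))
  | comm : ∀ (i k : Fin m) (j l : Fin n), k < i → j < l →
      QMatRel q m n (FreeAlgebra.ι K (i, j) * FreeAlgebra.ι K (k, l))
        (FreeAlgebra.ι K (k, l) * FreeAlgebra.ι K (i, j))
  | qrel : ∀ (i k : Fin m) (j l : Fin n), i < k → j < l →
      QMatRel q m n
        (FreeAlgebra.ι K (i, j) * FreeAlgebra.ι K (k, l) -
          FreeAlgebra.ι K (k, l) * FreeAlgebra.ι K (i, j))
        ((q - q⁻¹) • (FreeAlgebra.ι K (i, l) * FreeAlgebra.ι K (k, j)))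

/-- The quantum matrix algebra `O_q(M_{m,n})`. -/
abbrev QMat (q : K) (m n : ℕ) := RingQuot (QMatRel K q m n)

/-- The generator `X_{ij}` of `O_q(M_{m,n})`. -/
noncomputable def X (q : K) {m n : ℕ} (i : Fin m) (j : Fin n) : QMat K q m n :=
  RingQuot.mkAlgHom K (QMatRel K q m n) (FreeAlgebra.ι K (i, j))

/-- The number of inversions (Coxeter length) of a permutation of `Fin t`. -/
def invCount {t : ℕ} (σ : Equiv.Perm (Fin t)) : ℕ :=
  ((Finset.univ : Finset (Fin t × Fin t)).filter fun p => p.1 < p.2 ∧ σ p.2 < σ p.1).card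

/-- The quantum minor `Σ_σ (-q)^{ℓ(σ)} x_{σ(1)1} ⋯ x_{σ(t)t}` of a `t × t`
matrix of elements of a `K`-algebra. -/
noncomputable def qMinor {A : Type*} [Ring A] [Algebra K A] (q : K) (t : ℕ)
    (x : Fin t → Fin t → A) : A :=
  ∑ σ : Equiv.Perm (Fin t), ((-q) ^ invCount σ) • (List.ofFn fun k => x (σ k) k).prod

/-- The maximal (`m × m`) quantum minor `[J]` of `O_q(M_{m,n})`, with column index set `J`
(columns taken in increasing order, rows `1,…,m`).  (Defined to be `0` if `J` does not
have exactly `m` elements.) -/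
noncomputable def grMinor (q : K) (m : ℕ) {n : ℕ} (J : Finset (Fin n)) : QMat K q m n :=
  if h : J.card = m then
    qMinor K q m (fun i k => X K q i (J.orderEmbOfFin h k)) else 0

/-- The set of maximal quantum minors of `O_q(M_{m,n})`. -/
def grGenSet (q : K) (m n : ℕ) : Set (QMat K q m n) :=
  {a | ∃ J : Finset (Fin n), a = grMinor K q m J}

/-- The quantum grassmannian `O_q(G(m,n))`: the subalgebra of `O_q(M_{m,n})`
generated by the maximal quantum minors. -/
noncomputable def qGrass (q : K) (m n : ℕ) : Subalgebra K (QMat K q m n) :=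
  Algebra.adjoin K (grGenSet K q m n)

/-- The maximal quantum minor `[J]` viewed as an element of the quantum grassmannian. -/
noncomputable def grE (q : K) (m : ℕ) {n : ℕ} (J : Finset (Fin n)) : ↥(qGrass K q m n) :=
  ⟨grMinor K q m J, Algebra.subset_adjoin ⟨J, rfl⟩⟩

/-- Reduction of a natural number modulo `n`, landing in `Fin n` (this encodes the
paper's convention that a column index is read modulo `n`; indices here are 0-based). -/
def fmod (n : ℕ) (hn : 0 < n) (k : ℕ) : Fin n := ⟨k % n, Nat.mod_lt k hn⟩

/-- The index set `{α, α+1, …, α+m-1}` (read modulo `n`) of a consecutive quantum minor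
(0-based indices). -/
def consecSet {n : ℕ} (hn : 0 < n) (m : ℕ) (α : ℕ) : Finset (Fin n) :=
  (Finset.range m).image fun k => fmod n hn (α + k)

end QG
namespace QG

variable (K : Type*) [Field K]

/-- Localisation of a `K`-algebra `A` at the powers of a normal element `u`:
an algebra `B` together with an injective map `A → B` inverting `u`, such that every
element of `B` has the form `a·u^{-k}`. -/
structure NormalLoc (A : Type*) [Ring A] [Algebra K A]
    (B : Type*) [Ring B] [Algebra K B] (u : A) where
  emb : A →ₐ[K] B
  inj : Function.Injective emb
  isUnit : IsUnit (emb u)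
  surj : ∀ b : B, ∃ (a : A) (k : ℕ), b = emb a * ↑(isUnit.unit⁻¹ ^ k)

/-- The index set (0-based) of the quantum minor defining the dehomogenisation
generator `x_{ij}` at the consecutive minor starting at `α`:
`M_α ∪ {~(α+m+j)} ∖ {~(α+(m-1-i))}`. -/
def JxSet {n : ℕ} (hn : 0 < n) (m : ℕ) (α : ℕ) (i : Fin m) (j : Fin (n - m)) :
    Finset (Fin n) :=
  insert (fmod n hn (α + m + j)) ((consecSet hn m α).erase (fmod n hn (α + (m - 1 - i))))

/-- The generator `x_{ij} = [M_α ∪ {~(α+m+j)} ∖ {~(α+(m-1-i))}]·M_α^{-1}` of the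
dehomogenisation of the quantum grassmannian at the consecutive minor `M_α`. -/
noncomputable def xElt (q : K) (m n : ℕ) (hn : 0 < n) (α : ℕ)
    {B : Type*} [Ring B] [Algebra K B]
    (L : NormalLoc K (↥(qGrass K q m n)) B (grE K q m (consecSet hn m α)))
    (i : Fin m) (j : Fin (n - m)) : B :=
  L.emb (grE K q m (JxSet hn m α i j)) * ↑(L.isUnit.unit⁻¹)

/-- `B` is a skew-Laurent extension `R[y^{±1};σ]` of the subalgebra `R`, where `σ` is
conjugation by the unit `y`:  `R` is stable under conjugation by `y` and `B` is free as a
left `R`-module with basis the (integer) powers of `y`. -/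
def IsSkewLaurent {B : Type*} [Ring B] [Algebra K B] (R : Subalgebra K B) (y : Bˣ) : Prop :=
  (∀ r ∈ R, (y : B) * r * ((y⁻¹ : Bˣ) : B) ∈ R) ∧
    ∀ b : B, ∃! f : ℤ →₀ ↥R, b = f.sum fun k r => (r : B) * ((y ^ k : Bˣ) : B)

/-- The quantum minor of a matrix of elements with row index set `R` and column index
set `C` (rows and columns taken in increasing order); `0` if the cardinalities differ. -/
noncomputable def finsetMinor {B : Type*} [Ring B] [Algebra K B] (q : K) {m c : ℕ}
    (x : Fin m → Fin c → B) (R : Finset (Fin m)) (C : Finset (Fin c)) : B :=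
  if h : C.card = R.card then
    qMinor K q R.card (fun a b => x (R.orderEmbOfFin rfl a) (C.orderEmbOfFin h b))
  else 0

/-- The row set `(α+m) − (M_α ∖ I_r)` (0-based) of the image of the maximal minor `[I]`
under the dehomogenisation at `M_α`. -/
def rowSetOf {n : ℕ} (hn : 0 < n) (m : ℕ) (α : ℕ) (I : Finset (Fin n)) : Finset (Fin m) :=
  (Finset.univ.filter fun k : Fin m => fmod n hn (α + k) ∉ I).image Fin.rev

/-- The column set `I_c − (α+m−1)` (0-based) of the image of the maximal minor `[I]`
under the dehomogenisation at `M_α`. -/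
def colSetOf {n : ℕ} (hn : 0 < n) (m : ℕ) (α : ℕ) (I : Finset (Fin n)) :
    Finset (Fin (n - m)) :=
  Finset.univ.filter fun d : Fin (n - m) => fmod n hn (α + m + d) ∈ I

/-- The last index (0-based, corresponding to the paper's index `n`). -/
def lastIdx (n : ℕ) (hn : 0 < n) : Fin n := ⟨n - 1, by omega⟩

/-- The 2-cocycle `c((s_1,…,s_n),(t_1,…,t_n)) = ∏_{j ≠ n} p^{s_n t_j}` on `ℤ^n`. -/
noncomputable def cmap {n : ℕ} (hn : 0 < n) (p : K) :
    (Fin n → ℤ) → (Fin n → ℤ) → K := fun s t =>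
  ∏ j ∈ Finset.univ.filter (fun j : Fin n => j ≠ lastIdx n hn),
    p ^ (s (lastIdx n hn) * t j)

/-- The content `ε(j+m) − ε(m+1−i)` of the dehomogenisation generator `x_{ij}`
(0-based: `ε(m+j) − ε(m-1-i)`). -/
def xContent (m n : ℕ) (i : Fin m) (j : Fin (n - m)) : Fin n → ℤ := fun l =>
  (if (l : ℕ) = m + j then 1 else 0) - (if (l : ℕ) = m - 1 - i then 1 else 0)

/-- The content `ε(1) + ⋯ + ε(m)` of `y` (equivalently, of a consecutive minor `M_1`). -/
def yContent (m n : ℕ) : Fin n → ℤ := fun l => if (l : ℕ) < m then 1 else 0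

/-- The content `Σ_{i ∈ I} ε(i)` of a maximal quantum minor `[I]`. -/
def contentOf {n : ℕ} (I : Finset (Fin n)) : Fin n → ℤ := fun l => if l ∈ I then 1 else 0

/-- A realization of the twist `T(A)` of a `ℤ^n`-graded `K`-algebra `A` by a
2-cocycle `c`: a `K`-algebra `T` together with a `K`-linear isomorphism `τ : A ≃ T`
(the twist map `a ↦ a'`) satisfying `a'b' = c(s,t)·(ab)'` on homogeneous elements. -/
structure CocycleTwist {n : ℕ} (A : Type*) [Ring A] [Algebra K A]
    (𝒜 : (Fin n → ℤ) → Submodule K A) (c : (Fin n → ℤ) → (Fin n → ℤ) → K)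
    (T : Type*) [Ring T] [Algebra K T] where
  τ : A ≃ₗ[K] T
  mul_tw : ∀ (s t : Fin n → ℤ) (a b : A), a ∈ 𝒜 s → b ∈ 𝒜 t →
    τ a * τ b = c s t • τ (a * b)

/-- The image of an index set under the cycle `(1 2 … n)` (0-based). -/
def shiftSet {n : ℕ} (hn : 0 < n) (I : Finset (Fin n)) : Finset (Fin n) :=
  I.image fun a : Fin n => fmod n hn (a.val + 1)

end QG
namespace QG

section Alg

set_option linter.unusedSectionVars false

/-- Abstract quantum matrix relations. -/
structure IsQM {K A : Type*} [Field K] [Ring A] [Algebra K A] {ι κ : Type*} [LinearOrder ι]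
    [LinearOrder κ] (q : K) (x : ι → κ → A) : Prop where
  row : ∀ i j l, j < l → x i j * x i l = q • (x i l * x i j)
  col : ∀ i k j, i < k → x i j * x k j = q • (x k j * x i j)
  comm : ∀ i k j l, k < i → j < l → x i j * x k l = x k l * x i j
  qrel : ∀ i k j l, i < k → j < l →
    x i j * x k l - x k l * x i j = (q - q⁻¹) • (x i l * x k j)

theorem IsQM.transpose {K A : Type*} [Field K] [Ring A] [Algebra K A] {ι κ : Type*}
    [LinearOrder ι] [LinearOrder κ] {q : K} {x : ι → κ → A} (h : IsQM q x) :
    IsQM q (fun k i => x i k) where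
  row := fun i j l hh => h.col j l i hh
  col := fun i k j hh => h.row j i k hh
  comm := fun i k j l h1 h2 => (h.comm l j k i h2 h1).symm
  qrel := fun i k j l h1 h2 => by
    rw [h.qrel j l i k h2 h1, h.comm l j i k h2 h1]

/-- Quantum minor with row set `S` and list of columns, by first column expansion. -/
def Dm {K A : Type*} [Field K] [Ring A] [Algebra K A] {ι κ : Type*} [LinearOrder ι]
    (q : K) (x : ι → κ → A) : Finset ι → List κ → A
  | S, [] => if S = ∅ then 1 else 0
  | S, c :: L => ∑ i ∈ S, (-q) ^ (S.filter (· < i)).card • (x i c * Dm q x (S.erase i) L)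

variable {K A : Type*} [Field K] [Ring A] [Algebra K A] {ι κ : Type*} [LinearOrder ι]
    [LinearOrder κ] {q : K} {x : ι → κ → A}

theorem pair_sum {M : Type*} [AddCommMonoid M] (S : Finset ι) (f : ι → ι → M) :
    ∑ i ∈ S, ∑ j ∈ S.erase i, f i j =
      ∑ i ∈ S, ∑ j ∈ S.filter (i < ·), (f i j + f j i) := by
  have h1 : ∀ i ∈ S, ∑ j ∈ S.erase i, f i j =
      ∑ j ∈ S.filter (i < ·), f i j + ∑ j ∈ S.filter (· < i), f i j := by
    intro i hi
    rw [← Finset.sum_union]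
    · congr 1
      ext j
      simp only [Finset.mem_erase, Finset.mem_union, Finset.mem_filter]
      constructor
      · rintro ⟨h1, h2⟩
        rcases lt_or_gt_of_ne h1 with h | h
        · exact Or.inr ⟨h2, h⟩
        · exact Or.inl ⟨h2, h⟩
      · rintro (⟨h1, h2⟩ | ⟨h1, h2⟩)
        · exact ⟨h2.ne', h1⟩
        · exact ⟨h2.ne, h1⟩
    · rw [Finset.disjoint_left]
      intro j h1 h2
      simp only [Finset.mem_filter] at h1 h2
      exact lt_asymm h1.2 h2.2
  rw [Finset.sum_congr rfl h1, Finset.sum_add_distrib]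
  simp only [Finset.sum_add_distrib]
  congr 1
  rw [Finset.sum_comm' (t' := S) (s' := fun j => S.filter (j < ·))]
  intro i j
  simp only [Finset.mem_filter]
  tauto

theorem Dm_two (S : Finset ι) (c d : κ) (L : List κ) :
    Dm q x S (c :: d :: L) = ∑ i ∈ S, ∑ j ∈ S.filter (i < ·),
      (-q) ^ ((S.filter (· < i)).card + ((S.erase i).filter (· < j)).card) •
        ((x i c * x j d - q • (x j c * x i d)) * Dm q x ((S.erase i).erase j) L) := by
  simp only [Dm]
  have : ∀ i ∈ S, (-q) ^ (S.filter (· < i)).card • (x i c * ∑ j ∈ S.erase i,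
      (-q) ^ ((S.erase i).filter (· < j)).card • (x j d * Dm q x ((S.erase i).erase j) L)) =
      ∑ j ∈ S.erase i,
        (-q) ^ ((S.filter (· < i)).card + ((S.erase i).filter (· < j)).card) •
        (x i c * x j d * Dm q x ((S.erase i).erase j) L) := by
    intro i _
    rw [Finset.mul_sum, Finset.smul_sum]
    refine Finset.sum_congr rfl fun j _ => ?_
    rw [mul_smul_comm, smul_smul, pow_add, mul_assoc]
  rw [Finset.sum_congr rfl this, pair_sum]
  refine Finset.sum_congr rfl fun i hi => Finset.sum_congr rfl fun j hj => ?_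
  simp only [Finset.mem_filter] at hj
  have e1 : (S.filter (· < j)).card + ((S.erase j).filter (· < i)).card =
      (S.filter (· < i)).card + ((S.erase i).filter (· < j)).card + 1 := by
    have a1 : (S.erase j).filter (· < i) = S.filter (· < i) := by
      ext k; simp only [Finset.mem_filter, Finset.mem_erase]
      constructor
      · tauto
      · rintro ⟨h1, h2⟩
        exact ⟨⟨(h2.trans hj.2).ne, h1⟩, h2⟩
    have a2 : S.filter (· < j) = insert i ((S.erase i).filter (· < j)) := by
      ext k; simp only [Finset.mem_filter, Finset.mem_erase, Finset.mem_insert]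
      constructor
      · rintro ⟨h1, h2⟩
        by_cases h : k = i
        · exact Or.inl h
        · exact Or.inr ⟨⟨h, h1⟩, h2⟩
      · rintro (rfl | h)
        · exact ⟨hi, hj.2⟩
        · exact ⟨h.1.2, h.2⟩
    rw [a1, a2, Finset.card_insert_of_notMem (by simp)]
    omega
  rw [e1, Finset.erase_right_comm (a := j) (b := i), pow_succ, mul_smul, ← smul_add]
  congr 1
  rw [sub_mul, neg_smul, smul_mul_assoc, sub_eq_add_neg]

theorem Dm_swap (hx : IsQM q x) (hq : q ≠ 0) (S : Finset ι) {c d : κ} (h : c < d) (L : List κ) :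
    Dm q x S (d :: c :: L) = (-q) • Dm q x S (c :: d :: L) := by
  rw [Dm_two, Dm_two, Finset.smul_sum]
  refine Finset.sum_congr rfl fun i hi => ?_
  rw [Finset.smul_sum]
  refine Finset.sum_congr rfl fun j hj => ?_
  simp only [Finset.mem_filter] at hj
  have h1 := hx.qrel i j c d hj.2 h
  have h2 := hx.comm j i c d hj.2 h
  have h3 : x j d * x i c = x i c * x j d - (q - q⁻¹) • (x i d * x j c) := by
    rw [← h1]; abel
  have key : x i d * x j c - q • (x j d * x i c) =
      (-q) • (x i c * x j d - q • (x j c * x i d)) := by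
    rw [h3, h2, smul_sub, smul_smul, mul_sub, mul_inv_cancel₀ hq, smul_sub, smul_smul, sub_smul,
      one_smul]
    simp only [neg_smul, neg_mul]
    abel
  rw [key, smul_mul_assoc, smul_comm (-q)]

theorem Dm_same (hx : IsQM q x) (S : Finset ι) (c : κ) (L : List κ) :
    Dm q x S (c :: c :: L) = 0 := by
  rw [Dm_two]
  refine Finset.sum_eq_zero fun i hi => Finset.sum_eq_zero fun j hj => ?_
  simp only [Finset.mem_filter] at hj
  rw [hx.col i j c hj.2, sub_self, zero_mul, smul_zero]

theorem Dm_cons_congr {L L' : List κ} (a : K) (h : ∀ S, Dm q x S L = a • Dm q x S L') (c : κ)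
    (S : Finset ι) : Dm q x S (c :: L) = a • Dm q x S (c :: L') := by
  simp only [Dm, h, Finset.smul_sum, mul_smul_comm]
  exact Finset.sum_congr rfl fun i _ => smul_comm _ _ _

theorem Dm_dup (hx : IsQM q x) (hq : q ≠ 0) (c : κ) (L : List κ) (hc : c ∈ L) (S : Finset ι) :
    Dm q x S (c :: L) = 0 := by
  induction L generalizing S with
  | nil => simp at hc
  | cons l L ih =>
    rcases lt_trichotomy c l with h | h | h
    · have hc' : c ∈ L := by simpa [h.ne] using hc
      have h1 := Dm_swap hx hq S h L
      have h2 : Dm q x S (l :: c :: L) = 0 := by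
        have := Dm_cons_congr (q := q) (x := x) (L := c :: L) (L' := c :: L) 0
          (by intro S; rw [ih hc' S, smul_zero]) l S
        rw [this, zero_smul]
      rw [h2] at h1
      exact (smul_eq_zero.mp h1.symm).resolve_left (neg_ne_zero.mpr hq)
    · subst h; exact Dm_same hx S c L
    · have hc' : c ∈ L := by simpa [h.ne'] using hc
      have h2 : Dm q x S (l :: c :: L) = 0 := by
        have := Dm_cons_congr (q := q) (x := x) (L := c :: L) (L' := c :: L) 0
          (by intro S; rw [ih hc' S, smul_zero]) l S
        rw [this, zero_smul]
      rw [Dm_swap hx hq S h L, h2, smul_zero]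

theorem Dm_append (hx : IsQM q x) (hq : q ≠ 0) (k : κ) (L : List κ) (hL : L.Pairwise (· < ·))
    (hk : k ∉ L) (S : Finset ι) :
    Dm q x S (L ++ [k]) =
      (-q) ^ (L.filter (k < ·)).length • Dm q x S (L.orderedInsert (· ≤ ·) k) := by
  induction L generalizing S with
  | nil => simp
  | cons l L ih =>
    have hL' := List.pairwise_cons.mp hL
    have hk' : k ≠ l ∧ k ∉ L := by simpa using hk
    have e := Dm_cons_congr _ (fun S => ih hL'.2 hk'.2 S) l S
    rw [List.cons_append, e]
    rcases lt_or_gt_of_ne hk'.1 with h | h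
    · have : L.orderedInsert (· ≤ ·) k = k :: L := by
        cases L with
        | nil => rfl
        | cons a L =>
          have : k < a := h.trans (hL'.1 a (by simp))
          simp [List.orderedInsert, this.le]
      rw [this, Dm_swap hx hq S h, smul_smul]
      simp [List.orderedInsert, h.le, h, pow_succ]
    · simp [List.orderedInsert, h.not_ge, h.not_gt]

theorem Dm_append_dup (hx : IsQM q x) (hq : q ≠ 0) (k : κ) (L : List κ)
    (hL : L.Pairwise (· < ·)) (hk : k ∈ L) (S : Finset ι) : Dm q x S (L ++ [k]) = 0 := by
  induction L generalizing S with
  | nil => simp at hk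
  | cons l L ih =>
    by_cases h : k ∈ L
    · have := Dm_cons_congr (q := q) (x := x) (L := L ++ [k]) (L' := L ++ [k]) 0
          (by intro S; rw [ih (List.pairwise_cons.mp hL).2 h S, smul_zero]) l S
      rw [List.cons_append, this, zero_smul]
    · have : k = l := by simpa [h] using hk
      subst this
      exact Dm_dup hx hq k _ (by simp) S

theorem Dm_last [Fintype ι] (L : List κ) (S : Finset ι) :
    ∃ g : ι → A, ∀ k, Dm q x S (L ++ [k]) = ∑ i, g i * x i k := by
  induction L generalizing S with
  | nil =>
    refine ⟨fun i => if S = {i} then 1 else 0, fun k => ?_⟩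
    simp only [List.nil_append, Dm]
    by_cases hS : ∃ i, S = {i}
    · obtain ⟨i, rfl⟩ := hS
      rw [Finset.sum_eq_single (a := i) (s := Finset.univ)]
      · have : ({i} : Finset ι).filter (· < i) = ∅ := by
          simp [Finset.filter_singleton]
        simp [this]
      · intro j _ hj
        have : ({i} : Finset ι) ≠ {j} := by
          simpa using hj.symm
        simp [this]
      · simp
    · push Not at hS
      rw [Finset.sum_eq_zero, Finset.sum_eq_zero]
      · intro i _
        simp [hS i]
      · intro i hi
        have : S.erase i ≠ ∅ := by
          intro h
          rw [Finset.erase_eq_empty_iff] at h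
          rcases h with h | h
          · simp [h] at hi
          · exact hS i h
        simp [this]
  | cons l L ih =>
    choose g hg using ih
    refine ⟨fun j => ∑ i ∈ S, (-q) ^ (S.filter (· < i)).card • (x i l * g (S.erase i) j),
      fun k => ?_⟩
    simp only [List.cons_append, Dm, hg, Finset.mul_sum, Finset.smul_sum, Finset.sum_mul]
    rw [Finset.sum_comm]
    refine Finset.sum_congr rfl fun i _ => Finset.sum_congr rfl fun j _ => ?_
    rw [smul_mul_assoc, mul_assoc]

theorem sort_min {S : Finset ι} (h : S.Nonempty) :
    S.sort (· ≤ ·) = S.min' h :: (S.erase (S.min' h)).sort (· ≤ ·) := by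
  conv_lhs => rw [← Finset.insert_erase (S.min'_mem h)]
  rw [Finset.sort_insert]
  · intro b hb
    exact Finset.min'_le _ _ (Finset.mem_of_mem_erase hb)
  · simp

theorem filter_erase_min {S : Finset ι} (h : S.Nonempty) {i : ι} (hi : i ∈ S.erase (S.min' h)) :
    (S.filter (· < i)).card = ((S.erase (S.min' h)).filter (· < i)).card + 1 := by
  have hi' := Finset.mem_erase.mp hi
  have : S.min' h < i := lt_of_le_of_ne (Finset.min'_le _ _ hi'.2) hi'.1.symm
  rw [Finset.filter_erase, Finset.card_erase_add_one]
  simp [Finset.min'_mem, this]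

theorem filter_min {S : Finset ι} (h : S.Nonempty) :
    (S.filter (· < S.min' h)).card = 0 := by
  rw [Finset.card_eq_zero, Finset.filter_eq_empty_iff]
  intro j hj
  exact not_lt.mpr (Finset.min'_le _ _ hj)

theorem min_erase {S : Finset ι} (h : S.Nonempty) {i : ι} (hi : i ∈ S.erase (S.min' h)) :
    ∃ h' : (S.erase i).Nonempty, (S.erase i).min' h' = S.min' h := by
  have hm : S.min' h ∈ S.erase i :=
    Finset.mem_erase.mpr ⟨(Finset.mem_erase.mp hi).1.symm, S.min'_mem h⟩
  refine ⟨⟨_, hm⟩, le_antisymm (Finset.min'_le _ _ hm) ?_⟩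
  exact Finset.min'_le _ _ (Finset.mem_of_mem_erase (Finset.min'_mem _ _))

theorem Dm_expand {S : Finset ι} {C : Finset κ} (hS : S.Nonempty) (hC : C.Nonempty)
    (f : Finset ι → Finset κ → A)
    (hf : ∀ i ∈ S, Dm q x (S.erase i) ((C.erase (C.min' hC)).sort (· ≤ ·)) =
      f (S.erase i) (C.erase (C.min' hC))) :
    Dm q x S (C.sort (· ≤ ·)) = x (S.min' hS) (C.min' hC) *
      f (S.erase (S.min' hS)) (C.erase (C.min' hC)) +
      ∑ i ∈ S.erase (S.min' hS), (-q) ^ (((S.erase (S.min' hS)).filter (· < i)).card + 1) •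
        (x i (C.min' hC) * f (S.erase i) (C.erase (C.min' hC))) := by
  rw [sort_min hC, Dm, ← Finset.add_sum_erase _ _ (S.min'_mem hS), filter_min, pow_zero, one_smul,
    hf _ (S.min'_mem hS)]
  congr 1
  refine Finset.sum_congr rfl fun i hi => ?_
  rw [filter_erase_min hS hi, hf i (Finset.mem_of_mem_erase hi)]

theorem Dm_expand' {S : Finset ι} {C : Finset κ} (hC : C.Nonempty) :
    Dm q x S (C.sort (· ≤ ·)) = ∑ i ∈ S, (-q) ^ (S.filter (· < i)).card •
        (x i (C.min' hC) * Dm q x (S.erase i) ((C.erase (C.min' hC)).sort (· ≤ ·))) := by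
  rw [sort_min hC, Dm]

theorem Dm_transpose (hx : IsQM q x) (t : ℕ) (S : Finset ι) (C : Finset κ) (hS : S.card = t)
    (hC : C.card = t) :
    Dm q x S (C.sort (· ≤ ·)) = Dm q (fun k i => x i k) C (S.sort (· ≤ ·)) := by
  induction t using Nat.strong_induction_on generalizing S C with
  | _ t ih =>
    rcases Nat.eq_zero_or_pos t with rfl | ht
    · rw [Finset.card_eq_zero] at hS hC
      subst hS hC
      simp [Dm]
    · have nS : S.Nonempty := by rw [← Finset.card_pos]; omega
      have nC : C.Nonempty := by rw [← Finset.card_pos]; omega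
      have cS : ∀ i ∈ S, (S.erase i).card = t - 1 := fun i hi => by
        rw [Finset.card_erase_of_mem hi, hS]
      have cC : ∀ i ∈ C, (C.erase i).card = t - 1 := fun i hi => by
        rw [Finset.card_erase_of_mem hi, hC]
      rw [Dm_expand nS nC (fun S C => Dm q (fun k i => x i k) C (S.sort (· ≤ ·)))
        (fun i hi => ih (t - 1) (by omega) _ _ (cS i hi) (cC _ (C.min'_mem nC))),
        Dm_expand nC nS (fun C S => Dm q x S (C.sort (· ≤ ·)))
        (fun i hi => (ih (t - 1) (by omega) _ _ (cS _ (S.min'_mem nS)) (cC i hi)).symm)]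
      rw [ih (t - 1) (by omega) _ _ (cS _ (S.min'_mem nS)) (cC _ (C.min'_mem nC))]
      congr 1
      set s0 := S.min' nS with hs0
      set c0 := C.min' nC with hc0
      have l1 : ∀ i ∈ S.erase s0, (-q) ^ (((S.erase s0).filter (· < i)).card + 1) •
          (x i c0 * Dm q (fun k i => x i k) (C.erase c0) ((S.erase i).sort (· ≤ ·))) =
          ∑ k ∈ C.erase c0, (-q) ^ (((S.erase s0).filter (· < i)).card + 1 +
            ((C.erase c0).filter (· < k)).card) • (x i c0 * x s0 k *
              Dm q x ((S.erase s0).erase i) (((C.erase c0).erase k).sort (· ≤ ·))) := by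
        intro i hi
        obtain ⟨h', e'⟩ := min_erase nS hi
        rw [Dm_expand' h', e', Finset.mul_sum, Finset.smul_sum]
        refine Finset.sum_congr rfl fun k hk => ?_
        have := ih (t - 1 - 1) (by omega) ((S.erase s0).erase i) ((C.erase c0).erase k)
          (by rw [Finset.card_erase_of_mem hi, cS _ (S.min'_mem nS)])
          (by rw [Finset.card_erase_of_mem hk, cC _ (C.min'_mem nC)])
        rw [this, Finset.erase_right_comm (a := i), mul_smul_comm, smul_smul, ← pow_add, mul_assoc]
      have l2 : ∀ k ∈ C.erase c0, (-q) ^ (((C.erase c0).filter (· < k)).card + 1) •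
          (x s0 k * Dm q x (S.erase s0) ((C.erase k).sort (· ≤ ·))) =
          ∑ i ∈ S.erase s0, (-q) ^ (((C.erase c0).filter (· < k)).card + 1 +
            ((S.erase s0).filter (· < i)).card) • (x s0 k * x i c0 *
              Dm q x ((S.erase s0).erase i) (((C.erase c0).erase k).sort (· ≤ ·))) := by
        intro k hk
        obtain ⟨h', e'⟩ := min_erase nC hk
        rw [Dm_expand' h', e', Finset.mul_sum, Finset.smul_sum]
        refine Finset.sum_congr rfl fun i hi => ?_
        rw [Finset.erase_right_comm (a := k), mul_smul_comm, smul_smul, ← pow_add, mul_assoc]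
      rw [Finset.sum_congr rfl l1, Finset.sum_congr rfl l2, Finset.sum_comm]
      refine Finset.sum_congr rfl fun k hk => Finset.sum_congr rfl fun i hi => ?_
      have hi' := Finset.mem_erase.mp hi
      have hk' := Finset.mem_erase.mp hk
      rw [hx.comm i s0 c0 k (lt_of_le_of_ne (Finset.min'_le _ _ hi'.2) hi'.1.symm)
        (lt_of_le_of_ne (Finset.min'_le _ _ hk'.2) hk'.1.symm)]
      congr 2
      omega

theorem insert_sort {J : Finset κ} {k : κ} (hk : k ∉ J) :
    (J.sort (· ≤ ·)).orderedInsert (· ≤ ·) k = (insert k J).sort (· ≤ ·) := by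
  refine List.Perm.eq_of_pairwise' (r := (· ≤ ·)) ?_ ?_ ?_
  · exact List.Pairwise.orderedInsert k _ (Finset.pairwise_sort J _)
  · exact Finset.pairwise_sort _ _
  · refine (List.perm_orderedInsert _ _ _).trans ?_
    rw [List.perm_ext_iff_of_nodup]
    · intro a; simp
    · simp [hk]
    · simp

theorem filter_sort (J : Finset κ) (k : κ) :
    ((J.sort (· ≤ ·)).filter (k < ·)).length = (J.filter (k < ·)).card := by
  rw [← List.toFinset_card_of_nodup ((Finset.sort_nodup J _).filter _)]
  congr 1
  ext a; simp

/-- Quantum Plücker relation. -/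
theorem Dm_plucker [Fintype ι] (hx : IsQM q x) (hq : q ≠ 0) (J C : Finset κ)
    (hC : C.card = Fintype.card ι + 1) :
    ∑ k ∈ C \ J, (-q) ^ ((J.filter (k < ·)).card + (C.filter (· < k)).card) •
      (Dm q x Finset.univ ((insert k J).sort (· ≤ ·)) *
        Dm q x Finset.univ ((C.erase k).sort (· ≤ ·))) = 0 := by
  obtain ⟨g, hg⟩ := Dm_last (q := q) (x := x) (J.sort (· ≤ ·)) Finset.univ
  have h1 : ∀ k ∈ C, Dm q x Finset.univ ((C.erase k).sort (· ≤ ·)) =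
      Dm q (fun k i => x i k) (C.erase k) ((Finset.univ : Finset ι).sort (· ≤ ·)) := fun k hk =>
    Dm_transpose hx (Fintype.card ι) _ _ rfl (by rw [Finset.card_erase_of_mem hk, hC]; rfl)
  have hsort : (J.sort (· ≤ ·)).Pairwise (· < ·) := Finset.sortedLT_sort J |>.pairwise
  have h2 : ∑ k ∈ C, (-q) ^ (C.filter (· < k)).card •
      (Dm q x Finset.univ (J.sort (· ≤ ·) ++ [k]) *
        Dm q x Finset.univ ((C.erase k).sort (· ≤ ·))) = 0 := by
    have : ∀ k ∈ C, (-q) ^ (C.filter (· < k)).card •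
      (Dm q x Finset.univ (J.sort (· ≤ ·) ++ [k]) *
        Dm q x Finset.univ ((C.erase k).sort (· ≤ ·))) = ∑ i, g i *
          ((-q) ^ (C.filter (· < k)).card • (x i k *
      Dm q (fun k i => x i k) (C.erase k) ((Finset.univ : Finset ι).sort (· ≤ ·)))) := by
      intro k hk
      rw [hg, h1 k hk, Finset.sum_mul, Finset.smul_sum]
      refine Finset.sum_congr rfl fun i _ => ?_
      rw [mul_smul_comm, mul_assoc]
    rw [Finset.sum_congr rfl this, Finset.sum_comm]
    refine Finset.sum_eq_zero fun i _ => ?_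
    rw [← Finset.mul_sum]
    have := Dm_dup hx.transpose hq i ((Finset.univ : Finset ι).sort (· ≤ ·)) (by simp) C
    rw [Dm] at this
    rw [this, mul_zero]
  rw [← h2, ← Finset.sum_subset (Finset.sdiff_subset (s := C) (t := J))]
  · refine Finset.sum_congr rfl fun k hk => ?_
    have hk' := Finset.mem_sdiff.mp hk
    rw [Dm_append hx hq k _ hsort (by simpa using hk'.2), smul_mul_assoc, smul_smul, pow_add,
      mul_comm (_ ^ _) (_ ^ _), insert_sort hk'.2, filter_sort]
  · intro k hk hk'
    have : k ∈ J := by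
      by_contra h
      exact hk' (Finset.mem_sdiff.mpr ⟨hk, h⟩)
    rw [Dm_append_dup hx hq k _ hsort (by simpa using this), zero_mul, smul_zero]

/-- Minors as sums over injective functions. -/
theorem Dm_sum [Fintype ι] {t : ℕ} (S : Finset ι) (hS : S.card = t) (c : Fin t → κ) :
    Dm q x S (List.ofFn c) =
      ∑ f ∈ (Finset.univ : Finset (Fin t → ι)).filter
        (fun f => Function.Injective f ∧ ∀ k, f k ∈ S),
        (-q) ^ ((Finset.univ : Finset (Fin t × Fin t)).filter
          fun p => p.1 < p.2 ∧ f p.2 < f p.1).card • (List.ofFn fun k => x (f k) (c k)).prod := by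
  induction t generalizing S with
  | zero =>
    rw [Finset.card_eq_zero] at hS
    subst hS
    simp [Dm, Function.injective_of_subsingleton]
  | succ t ih =>
    rw [List.ofFn_succ, Dm]
    have h1 : ∀ i ∈ S, (-q) ^ (S.filter (· < i)).card •
        (x i (c 0) * Dm q x (S.erase i) (List.ofFn fun k : Fin t => c k.succ)) =
        ∑ f ∈ (Finset.univ : Finset (Fin t → ι)).filter
          (fun f => Function.Injective f ∧ ∀ k, f k ∈ S.erase i),
        (-q) ^ ((Finset.univ : Finset (Fin (t+1) × Fin (t+1))).filter
          fun p => p.1 < p.2 ∧ (Fin.cons i f : Fin (t+1) → ι) p.2 <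
            (Fin.cons i f : Fin (t+1) → ι) p.1).card •
          (List.ofFn fun k => x ((Fin.cons i f : Fin (t+1) → ι) k) (c k)).prod := by
      intro i hi
      have cc : (S.erase i).card = t := by rw [Finset.card_erase_of_mem hi, hS]; rfl
      rw [ih (S.erase i) cc, Finset.mul_sum, Finset.smul_sum]
      refine Finset.sum_congr rfl fun f hf => ?_
      simp only [Finset.mem_filter, Finset.mem_univ, true_and] at hf
      rw [mul_smul_comm, smul_smul, ← pow_add, List.ofFn_succ, List.prod_cons]
      simp only [Fin.cons_zero, Fin.cons_succ]
      congr 2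
      have him : Finset.univ.image f = S.erase i := by
        apply Finset.eq_of_subset_of_card_le
        · intro j hj
          obtain ⟨k, _, rfl⟩ := Finset.mem_image.mp hj
          exact hf.2 k
        · rw [Finset.card_image_of_injective _ hf.1, cc]; simp
      have e1 : (S.filter (· < i)).card =
          ((Finset.univ : Finset (Fin t)).filter fun k => f k < i).card := by
        have : S.filter (· < i) = ((Finset.univ : Finset (Fin t)).filter fun k => f k < i).image f := by
          have h0 := Finset.filter_image (s := Finset.univ) (f := f) (p := fun j => j < i)
          rw [← h0, him]
          ext j
          simp only [Finset.mem_filter, Finset.mem_erase]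
          constructor
          · rintro ⟨a, b⟩; exact ⟨⟨b.ne, a⟩, b⟩
          · rintro ⟨a, b⟩; exact ⟨a.2, b⟩
        rw [this, Finset.card_image_of_injective _ hf.1]
      rw [e1]
      simp only [Finset.card_filter, Fintype.sum_prod_type, Fin.sum_univ_succ]
      simp [Fin.cons_zero, Fin.cons_succ, Fin.succ_lt_succ_iff]
    rw [Finset.sum_congr rfl h1, Finset.sum_sigma']
    refine Finset.sum_bij' (fun p _ => (Fin.cons p.1 p.2 : Fin (t+1) → ι))
      (fun f _ => ⟨f 0, Fin.tail f⟩) ?_ ?_ ?_ ?_ ?_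
    · rintro ⟨i, f⟩ h
      simp only [Finset.mem_sigma, Finset.mem_filter, Finset.mem_univ, true_and,
        Finset.mem_erase] at h ⊢
      refine ⟨Fin.cons_injective_iff.mpr ⟨?_, h.2.1⟩, ?_⟩
      · rintro ⟨k, hk⟩
        exact (h.2.2 k).1 hk
      · intro k
        refine Fin.cases ?_ (fun k => ?_) k
        · simpa using h.1
        · simpa using (h.2.2 k).2
    · intro f h
      simp only [Finset.mem_sigma, Finset.mem_filter, Finset.mem_univ, true_and,
        Finset.mem_erase] at h ⊢
      refine ⟨h.2 0, h.1.comp (Fin.succ_injective _), fun k => ⟨?_, h.2 _⟩⟩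
      intro hk
      exact Fin.succ_ne_zero k (h.1 hk)
    · rintro ⟨i, f⟩ h
      simp
    · intro f h
      simp
    · rintro ⟨i, f⟩ h
      rfl

theorem qMinor_eq {t : ℕ} (x : Fin t → κ → A) (c : Fin t → κ) :
    qMinor K q t (fun a b => x a (c b)) = Dm q x Finset.univ (List.ofFn c) := by
  rw [Dm_sum Finset.univ (by simp) c, qMinor]
  refine Finset.sum_bij (fun σ _ => (σ : Fin t → Fin t)) ?_ ?_ ?_ ?_
  · intro σ _
    simp [σ.injective]
  · intro σ _ τ _ h
    exact DFunLike.coe_injective h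
  · intro f hf
    simp only [Finset.mem_filter, Finset.mem_univ, true_and] at hf
    exact ⟨Equiv.ofBijective f (Finite.injective_iff_bijective.mp hf.1), Finset.mem_univ _, rfl⟩
  · intro σ _
    rfl

end Alg

theorem X_isQM {K : Type*} [Field K] (q : K) (m n : ℕ) :
    IsQM q (fun (i : Fin m) (j : Fin n) => X K q i j) where
  row := fun i j l h => by
    have := RingQuot.mkAlgHom_rel K (QMatRel.row (K := K) (q := q) i j l h)
    simpa only [X, map_mul, map_smul] using this
  col := fun i k j h => by
    have := RingQuot.mkAlgHom_rel K (QMatRel.col (K := K) (q := q) i k j h)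
    simpa only [X, map_mul, map_smul] using this
  comm := fun i k j l h h' => by
    have := RingQuot.mkAlgHom_rel K (QMatRel.comm (K := K) (q := q) i k j l h h')
    simpa only [X, map_mul, map_smul] using this
  qrel := fun i k j l h h' => by
    have := RingQuot.mkAlgHom_rel K (QMatRel.qrel (K := K) (q := q) i k j l h h')
    simpa only [X, map_mul, map_smul, map_sub] using this

theorem grMinor_eq {K : Type*} [Field K] (q : K) (m : ℕ) {n : ℕ} (J : Finset (Fin n))
    (h : J.card = m) : grMinor K q m J =
      Dm q (fun (i : Fin m) (j : Fin n) => X K q i j) Finset.univ (J.sort (· ≤ ·)) := by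
  rw [grMinor, dif_pos h, qMinor_eq (q := q) (fun (i : Fin m) (j : Fin n) => X K q i j)
    (J.orderEmbOfFin h)]
  congr 1
  apply List.ext_getElem
  · simp [h]
  · intro k h1 h2
    simp [Finset.orderEmbOfFin_apply]

theorem gr_plucker {K : Type*} [Field K] (q : K) (hq : q ≠ 0) (m : ℕ) {n : ℕ}
    (J C : Finset (Fin n)) (hJ : J.card + 1 = m) (hC : C.card = m + 1) :
    ∑ k ∈ C \ J, (-q) ^ ((J.filter (k < ·)).card + (C.filter (· < k)).card) •
      (grE K q m (insert k J) * grE K q m (C.erase k)) = 0 := by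
  apply Subtype.ext
  have := Dm_plucker (X_isQM q m n) hq J C (by simpa using hC)
  rw [ZeroMemClass.coe_zero, ← this, AddSubmonoidClass.coe_finsetSum]
  refine Finset.sum_congr rfl fun k hk => ?_
  have hk' := Finset.mem_sdiff.mp hk
  rw [← grMinor_eq q m _ (by rw [Finset.card_insert_of_notMem hk'.2, hJ]),
    ← grMinor_eq q m _ (by rw [Finset.card_erase_of_mem hk'.1, hC]; rfl)]
  rfl

section Shift

variable {n : ℕ} (hn : 0 < n)

theorem s_inj : Function.Injective (fun a : Fin n => fmod n hn (a.val + 1)) := by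
  intro a b h
  have h' : (a.val + 1) % n = (b.val + 1) % n := congrArg Fin.val h
  apply Fin.ext
  rcases Nat.lt_or_ge (a.val + 1) n with h1 | h1 <;>
  rcases Nat.lt_or_ge (b.val + 1) n with h2 | h2
  · rw [Nat.mod_eq_of_lt h1, Nat.mod_eq_of_lt h2] at h'; omega
  · have : b.val + 1 = n := by omega
    rw [Nat.mod_eq_of_lt h1, this, Nat.mod_self] at h'; omega
  · have : a.val + 1 = n := by omega
    rw [Nat.mod_eq_of_lt h2, this, Nat.mod_self] at h'; omega
  · omega

theorem s_val {a : Fin n} (h : a ≠ lastIdx n hn) : (fmod n hn (a.val + 1)).val = a.val + 1 := by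
  have : a.val ≠ n - 1 := fun h' => h (Fin.ext h')
  exact Nat.mod_eq_of_lt (by omega)

theorem s_last : (fmod n hn ((lastIdx n hn).val + 1)).val = 0 := by
  show (n - 1 + 1) % n = 0
  rw [Nat.sub_add_cancel hn, Nat.mod_self]

theorem mem_consec0 {m : ℕ} (hmn : m < n) (a : Fin n) : a ∈ consecSet hn m 0 ↔ a.val < m := by
  simp only [consecSet, Finset.mem_image, Finset.mem_range, Nat.zero_add]
  constructor
  · rintro ⟨k, hk, rfl⟩
    show k % n < m
    rw [Nat.mod_eq_of_lt (by omega)]; exact hk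
  · intro h
    exact ⟨a.val, h, Fin.ext (Nat.mod_eq_of_lt a.2)⟩

theorem consec1 {m : ℕ} (hmn : m < n) : consecSet hn m 1 = shiftSet hn (consecSet hn m 0) := by
  rw [shiftSet, consecSet, consecSet, Finset.image_image]
  refine Finset.image_congr fun k hk => ?_
  have hk' : k < m := by simpa using hk
  apply Fin.ext
  show (1 + k) % n = ((0 + k) % n + 1) % n
  rw [Nat.mod_eq_of_lt (a := 0 + k) (by omega)]
  congr 1; omega

theorem Jx0 {m : ℕ} (hmn : m < n) (i : Fin m) (j : Fin (n - m)) :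
    JxSet hn m 0 i j = insert (⟨m + j, by omega⟩ : Fin n)
      ((consecSet hn m 0).erase ⟨m - 1 - i, by omega⟩) := by
  have h1 : fmod n hn (0 + m + j) = ⟨m + j, by omega⟩ := by
    apply Fin.ext
    show (0 + m + j.val) % n = m + j
    rw [Nat.mod_eq_of_lt (by omega)]; omega
  have h2 : fmod n hn (0 + (m - 1 - i)) = ⟨m - 1 - i, by omega⟩ := by
    apply Fin.ext
    show (0 + (m - 1 - i.val)) % n = m - 1 - i
    rw [Nat.mod_eq_of_lt (by omega)]; omega
  rw [JxSet, h1, h2]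

theorem shift_insert (a : Fin n) (S : Finset (Fin n)) :
    shiftSet hn (insert a S) = insert (fmod n hn (a.val + 1)) (shiftSet hn S) := by
  simp [shiftSet, Finset.image_insert]

theorem shift_erase (a : Fin n) (S : Finset (Fin n)) :
    shiftSet hn (S.erase a) = (shiftSet hn S).erase (fmod n hn (a.val + 1)) :=
  Finset.image_erase (s_inj hn) S a

theorem Jx1 {m : ℕ} (hmn : m < n) (i : Fin m) (j : Fin (n - m)) :
    JxSet hn m 1 i j = shiftSet hn (JxSet hn m 0 i j) := by
  rw [Jx0 hn hmn, shift_insert, shift_erase, JxSet, consec1 hn hmn]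
  have h1 : 1 + m + j.val = m + j + 1 := by omega
  have h2 : 1 + (m - 1 - i.val) = m - 1 - i + 1 := by omega
  rw [h1, h2]

theorem shift_card (S : Finset (Fin n)) : (shiftSet hn S).card = S.card :=
  Finset.card_image_of_injective _ (s_inj hn)

theorem shift_exp (J C : Finset (Fin n)) (hC : lastIdx n hn ∉ C) (k : Fin n) (hk : k ∈ C) :
    (if lastIdx n hn ∈ J then 1 else 0) +
      (((shiftSet hn J).filter (fmod n hn (k.val + 1) < ·)).card +
        ((shiftSet hn C).filter (· < fmod n hn (k.val + 1))).card) =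
      (J.filter (k < ·)).card + (C.filter (· < k)).card := by
  have hkl : k ≠ lastIdx n hn := fun h => hC (h ▸ hk)
  have h1 : ((shiftSet hn C).filter (· < fmod n hn (k.val + 1))).card =
      (C.filter (· < k)).card := by
    rw [shiftSet, Finset.filter_image, Finset.card_image_of_injective _ (s_inj hn)]
    congr 1
    refine Finset.filter_congr fun c hc => ?_
    have hcl : c ≠ lastIdx n hn := fun h => hC (h ▸ hc)
    rw [Fin.lt_def, s_val hn hkl, s_val hn hcl, Fin.lt_def]; omega
  have h2 : ((shiftSet hn J).filter (fmod n hn (k.val + 1) < ·)).card =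
      ((J.filter (k < ·)).erase (lastIdx n hn)).card := by
    rw [shiftSet, Finset.filter_image, Finset.card_image_of_injective _ (s_inj hn)]
    congr 1
    ext j
    simp only [Finset.mem_filter, Finset.mem_erase]
    by_cases hj : j = lastIdx n hn
    · subst hj
      rw [Fin.lt_def, s_val hn hkl, s_last]
      simp
    · rw [Fin.lt_def, s_val hn hkl, s_val hn hj, Fin.lt_def]
      simp [hj]
  rw [h1, h2, ← add_assoc]
  congr 1
  have hlt : k < lastIdx n hn := by
    have : k.val ≠ n - 1 := fun h' => hkl (Fin.ext h')
    rw [Fin.lt_def]; show k.val < n - 1; omega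
  split_ifs with h
  · rw [add_comm, Finset.card_erase_add_one]
    simp [h, hlt]
  · rw [Finset.erase_eq_of_notMem (by simp [h]), zero_add]

theorem gr_plucker_shift {K : Type*} [Field K] (q : K) (hq : q ≠ 0) (m : ℕ)
    (J C : Finset (Fin n)) (hJ : J.card + 1 = m) (hC : C.card = m + 1)
    (hl : lastIdx n hn ∉ C) :
    ∑ k ∈ C \ J, (-q) ^ ((J.filter (k < ·)).card + (C.filter (· < k)).card) •
      (grE K q m (shiftSet hn (insert k J)) * grE K q m (shiftSet hn (C.erase k))) = 0 := by
  have h := gr_plucker q hq m (shiftSet hn J) (shiftSet hn C) (by rw [shift_card, hJ])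
    (by rw [shift_card, hC])
  have h0 : shiftSet hn C \ shiftSet hn J = shiftSet hn (C \ J) :=
    (Finset.image_sdiff _ _ (s_inj hn)).symm
  rw [h0] at h
  unfold shiftSet at h
  rw [Finset.sum_image (fun a _ b _ hab => s_inj hn hab)] at h
  have h' := congrArg (fun z => (-q) ^ (if lastIdx n hn ∈ J then 1 else 0) • z) h
  simp only [smul_zero, Finset.smul_sum, smul_smul, ← pow_add] at h'
  rw [← h']
  refine Finset.sum_congr rfl fun k hk => ?_
  rw [← shift_exp hn J C hl k (Finset.mem_sdiff.mp hk).1, shift_insert, shift_erase]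
  rfl

end Shift

section Core

theorem cmap_eq {K : Type*} [Field K] {n : ℕ} (hn : 0 < n) (p : K) (hp : p ≠ 0)
    (s t : Fin n → ℤ) : cmap K hn p s t = p ^ (s (lastIdx n hn) *
      ∑ j ∈ Finset.univ.filter (fun j : Fin n => j ≠ lastIdx n hn), t j) := by
  rw [cmap, Finset.mul_sum]
  generalize Finset.univ.filter (fun j : Fin n => j ≠ lastIdx n hn) = S
  induction S using Finset.induction_on with
  | empty => simp
  | insert a S ha ih => rw [Finset.prod_insert ha, Finset.sum_insert ha, ih, zpow_add₀ hp]

/-- `ε(i) - ε(k)`. -/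
def xc {n : ℕ} (k i : Fin n) : Fin n → ℤ := fun l =>
  (if l = i then 1 else 0) - (if l = k then 1 else 0)

/-- The abstract induction. -/
theorem core (K : Type*) [Field K] (q : K) (hq : q ≠ 0)
    (m n : ℕ) (hn : 0 < n) (hm : 0 < m) (hmn : m < n) (p : K) (hp : p ^ m = q ^ 2)
    (B₁ : Type*) [Ring B₁] [Algebra K B₁] (B₂ : Type*) [Ring B₂] [Algebra K B₂]
    (E₁ : ↥(qGrass K q m n) →ₐ[K] B₁) (E₂ : ↥(qGrass K q m n) →ₐ[K] B₂)
    (u : B₁ˣ) (v : B₂ˣ) (M : Finset (Fin n)) (hM : ∀ a, a ∈ M ↔ a.val < m) (hMc : M.card = m)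
    (hu : E₁ (grE K q m M) = u) (hv : E₂ (grE K q m (shiftSet hn M)) = v)
    (𝒜 : (Fin n → ℤ) → Submodule K B₁) [GradedAlgebra 𝒜]
    (Φ : B₁ →ₗ[K] B₂)
    (hΦ : ∀ s t a b, a ∈ 𝒜 s → b ∈ 𝒜 t → Φ a * Φ b = cmap K hn p s t • Φ (a * b))
    (hx : ∀ k i, k ∈ M → i ∉ M → E₁ (grE K q m (insert i (M.erase k))) * ↑u⁻¹ ∈ 𝒜 (xc k i))
    (hΦx : ∀ k i, k ∈ M → i ∉ M → Φ (E₁ (grE K q m (insert i (M.erase k))) * ↑u⁻¹) =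
      E₂ (grE K q m (shiftSet hn (insert i (M.erase k)))) * ↑v⁻¹)
    (hy : (u : B₁) ∈ 𝒜 (yContent m n)) (hΦy : Φ u = v)
    (d : ℕ) (I : Finset (Fin n)) (hI : I.card = m) (hd : (I \ M).card = d) :
    E₁ (grE K q m I) ∈ 𝒜 (contentOf I) ∧
      Φ (E₁ (grE K q m I)) = (if lastIdx n hn ∈ I then q ^ (-2 : ℤ) else 1) •
        E₂ (grE K q m (shiftSet hn I)) := by
  have hp0 : p ≠ 0 := by
    rintro rfl
    rw [zero_pow hm.ne'] at hp
    exact pow_ne_zero 2 hq hp.symm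
  have hlM : lastIdx n hn ∉ M := by
    rw [hM]; show ¬ (n - 1 < m); omega
  have hyM : yContent m n = contentOf M := by
    funext l; simp [yContent, contentOf, hM]
  induction d generalizing I with
  | zero =>
    have hIM : I = M := by
      apply Finset.eq_of_subset_of_card_le
      · rw [← Finset.sdiff_eq_empty_iff_subset, ← Finset.card_eq_zero, hd]
      · rw [hI, hMc]
    subst hIM
    rw [hu, hv, if_neg hlM, one_smul, ← hyM]
    exact ⟨hy, hΦy⟩
  | succ d ih =>
    by_cases hex : ∃ i ∈ I \ M, i ≠ lastIdx n hn
    · obtain ⟨i, hi, hil⟩ := hex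
      obtain ⟨hiI, hiM⟩ := Finset.mem_sdiff.mp hi
      set J := I.erase i with hJ
      set C := insert i M with hC
      have hJc : J.card + 1 = m := by rw [hJ, Finset.card_erase_add_one hiI, hI]
      have hCc : C.card = m + 1 := by rw [hC, Finset.card_insert_of_notMem hiM, hMc]
      have hlC : lastIdx n hn ∉ C := by
        rw [hC, Finset.mem_insert, not_or]; exact ⟨hil.symm, hlM⟩
      have hCJ : C \ J = insert i (M \ I) := by
        ext a
        simp only [hC, hJ, Finset.mem_sdiff, Finset.mem_insert, Finset.mem_erase]
        by_cases ha : a = i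
        · simp [ha]
        · simp [ha]
      have hiMI : i ∉ M \ I := by simp [hiM]
      have hCi : C.erase i = M := Finset.erase_insert hiM
      have hJi : insert i J = I := Finset.insert_erase hiI
      have hCk : ∀ k ∈ M \ I, C.erase k = insert i (M.erase k) := by
        intro k hk
        rw [hC, Finset.erase_insert_of_ne]
        rintro rfl
        exact hiMI hk
      set ex : Fin n → ℕ := fun k => (J.filter (k < ·)).card + (C.filter (· < k)).card with hex
      have H1 := gr_plucker q hq m J C hJc hCc
      have H2 := gr_plucker_shift hn q hq m J C hJc hCc hlC
      rw [hCJ, Finset.sum_insert hiMI, hCi, hJi] at H1 H2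
      have H1' : (-q) ^ ex i • E₁ (grE K q m I) = - ∑ k ∈ M \ I, (-q) ^ ex k •
          (E₁ (grE K q m (insert k J)) *
            (E₁ (grE K q m (insert i (M.erase k))) * ↑u⁻¹)) := by
        have := congrArg (fun z => E₁ z * ↑u⁻¹) (eq_neg_of_add_eq_zero_left H1)
        simp only [map_neg, map_sum, map_smul, map_mul, hu, smul_mul_assoc, neg_mul,
          Finset.sum_mul, mul_assoc, Units.mul_inv, mul_one] at this
        rw [hex, this]
        congr 1
        exact Finset.sum_congr rfl fun k hk => by rw [hCk k hk]
      have H2' : (-q) ^ ex i • E₂ (grE K q m (shiftSet hn I)) = - ∑ k ∈ M \ I, (-q) ^ ex k •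
          (E₂ (grE K q m (shiftSet hn (insert k J))) *
            (E₂ (grE K q m (shiftSet hn (insert i (M.erase k)))) * ↑v⁻¹)) := by
        have := congrArg (fun z => E₂ z * ↑v⁻¹) (eq_neg_of_add_eq_zero_left H2)
        simp only [map_neg, map_sum, map_smul, map_mul, hv, smul_mul_assoc, neg_mul,
          Finset.sum_mul, mul_assoc, Units.mul_inv, mul_one] at this
        rw [hex, this]
        congr 1
        exact Finset.sum_congr rfl fun k hk => by rw [hCk k hk]
      have hne : (-q) ^ ex i ≠ 0 := pow_ne_zero _ (neg_ne_zero.mpr hq)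
      have hkI : ∀ k ∈ M \ I, E₁ (grE K q m (insert k J)) ∈ 𝒜 (contentOf (insert k J)) ∧
          Φ (E₁ (grE K q m (insert k J))) = (if lastIdx n hn ∈ I then q ^ (-2 : ℤ) else 1) •
            E₂ (grE K q m (shiftSet hn (insert k J))) := by
        intro k hk
        obtain ⟨hkM, hkI⟩ := Finset.mem_sdiff.mp hk
        have hkJ : k ∉ J := fun h => hkI (Finset.mem_of_mem_erase h)
        have h1 := ih (insert k J) (by rw [Finset.card_insert_of_notMem hkJ, hJc]) (by
          rw [Finset.insert_sdiff_of_mem _ hkM, hJ, Finset.erase_sdiff_comm,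
            Finset.card_erase_of_mem hi, hd]; rfl)
        have h2 : lastIdx n hn ∈ insert k J ↔ lastIdx n hn ∈ I := by
          rw [Finset.mem_insert, hJ, Finset.mem_erase]
          have : lastIdx n hn ≠ k := by rintro h; exact hlM (h ▸ hkM)
          simp [this, hil.symm]
        simp only [h2] at h1
        exact h1
      have hcont : ∀ k ∈ M \ I, contentOf (insert k J) + xc k i = contentOf I := by
        intro k hk
        obtain ⟨hkM, hkI'⟩ := Finset.mem_sdiff.mp hk
        have hki : k ≠ i := by rintro rfl; exact hkI' hiI
        funext l
        simp only [Pi.add_apply, contentOf, xc, hJ, Finset.mem_insert, Finset.mem_erase]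
        by_cases h1 : l = i
        · subst h1; simp [hki.symm, hiI]
        · by_cases h2 : l = k
          · subst h2; simp [hki, hkI']
          · simp [h1, h2]
      constructor
      · rw [← Submodule.smul_mem_iff (𝒜 (contentOf I)) hne, H1']
        refine Submodule.neg_mem _ (Submodule.sum_mem _ fun k hk => Submodule.smul_mem _ _ ?_)
        rw [← hcont k hk]
        exact SetLike.mul_mem_graded (hkI k hk).1 (hx k i (Finset.mem_sdiff.mp hk).1 hiM)
      · apply smul_right_injective B₂ hne
        simp only
        rw [← map_smul, H1', smul_comm, H2', map_neg, map_sum, smul_neg, Finset.smul_sum]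
        congr 1
        refine Finset.sum_congr rfl fun k hk => ?_
        have hkM := (Finset.mem_sdiff.mp hk).1
        have hc : cmap K hn p (contentOf (insert k J)) (xc k i) = 1 := by
          rw [cmap_eq hn p hp0]
          have : ∑ j ∈ Finset.univ.filter (fun j : Fin n => j ≠ lastIdx n hn), xc k i j = 0 := by
            have hkl : k ≠ lastIdx n hn := by rintro rfl; exact hlM hkM
            simp [xc, Finset.sum_sub_distrib, hil, hkl]
          rw [this, mul_zero, zpow_zero]
        have := hΦ _ _ _ _ (hkI k hk).1 (hx k i hkM hiM)
        rw [hc, one_smul, hΦx k i hkM hiM, (hkI k hk).2] at this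
        rw [map_smul, ← this, smul_mul_assoc, smul_comm]
    · push Not at hex
      have hne : (I \ M).Nonempty := by rw [← Finset.card_pos]; omega
      have hIM : I \ M = {lastIdx n hn} := by
        obtain ⟨i, hi⟩ := hne
        have := hex i hi
        subst this
        ext a
        rw [Finset.mem_singleton]
        exact ⟨hex a, fun h => h ▸ hi⟩
      have hlI : lastIdx n hn ∈ I := by
        have : lastIdx n hn ∈ I \ M := by rw [hIM]; simp
        exact (Finset.mem_sdiff.mp this).1
      have hc : (M \ I).card = 1 := by
        have := Finset.card_sdiff_add_card_inter M I
        have h2 := Finset.card_sdiff_add_card_inter I M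
        rw [hIM, Finset.inter_comm, Finset.card_singleton] at h2
        omega
      obtain ⟨k, hk⟩ := Finset.card_eq_one.mp hc
      have hkM : k ∈ M ∧ k ∉ I := by
        rw [← Finset.mem_sdiff, hk]; simp
      have hIe : I = insert (lastIdx n hn) (M.erase k) := by
        ext a
        have h1 : a ∈ I \ M ↔ a = lastIdx n hn := by rw [hIM, Finset.mem_singleton]
        have h2 : a ∈ M \ I ↔ a = k := by rw [hk, Finset.mem_singleton]
        rw [Finset.mem_sdiff] at h1 h2
        rw [Finset.mem_insert, Finset.mem_erase]
        tauto
      have hx1 := hx k _ hkM.1 hlM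
      have hx2 := hΦx k _ hkM.1 hlM
      rw [← hIe] at hx1 hx2
      have hmul : E₁ (grE K q m I) = E₁ (grE K q m I) * ↑u⁻¹ * u := by
        rw [mul_assoc, Units.inv_mul, mul_one]
      have hkl : k ≠ lastIdx n hn := by rintro rfl; exact hlM hkM.1
      constructor
      · have : contentOf I = xc k (lastIdx n hn) + yContent m n := by
          rw [hyM]
          funext l
          simp only [Pi.add_apply, contentOf, xc]
          conv_lhs => rw [hIe]
          simp only [Finset.mem_insert, Finset.mem_erase]
          by_cases h1 : l = lastIdx n hn
          · subst h1; simp [hkl.symm, hlM]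
          · by_cases h2 : l = k
            · subst h2; simp [hkl, hkM.1]
            · simp [h1, h2]
        rw [hmul, this]
        exact SetLike.mul_mem_graded hx1 hy
      · have h := hΦ _ _ _ _ hx1 hy
        have hcm : cmap K hn p (xc k (lastIdx n hn)) (yContent m n) = q ^ 2 := by
          rw [cmap_eq hn p hp0, hyM]
          have : ∑ j ∈ Finset.univ.filter (fun j : Fin n => j ≠ lastIdx n hn), contentOf M j
              = m := by
            simp only [contentOf, Finset.sum_boole, Finset.filter_filter]
            rw [← hMc]
            congr 2
            ext a
            simp only [Finset.mem_filter, Finset.mem_univ, true_and]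
            exact ⟨fun h => h.2, fun h => ⟨fun h' => hlM (h' ▸ h), h⟩⟩
          rw [this]
          simp [xc, hkl.symm, hp]
        rw [hcm, ← hmul, hx2, hΦy, mul_assoc, Units.inv_mul, mul_one] at h
        rw [if_pos hlI, h, smul_smul]
        have : q ^ (-2 : ℤ) * q ^ 2 = 1 := by
          rw [zpow_neg, show ((2 : ℤ)) = ((2 : ℕ) : ℤ) from rfl, zpow_natCast,
            inv_mul_cancel₀ (pow_ne_zero 2 hq)]
        rw [this, one_smul]

end Core

/-- Let `φ₁` be the dehomogenisation of `O_q(G(m,n))` at `M₁`, `T`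
the twist map of the cocycle twist, `θ` the isomorphism of the twisted algebra with the
dehomogenisation at `M₂` (sending `x'_{ij} ↦ z_{ij}`, `y₁' ↦ y₂`), and `ρ₂` the inverse
of the dehomogenisation at `M₂` (realised here inside the localisation at `M₂`).  Then
for every generating quantum minor `[I] = [i_1,…,i_m]`,
`ρ₂∘θ∘T∘φ₁([i_1,…,i_m]) = [i_1+1,…,i_m+1]` if `i_m ≠ n`, while
`ρ₂∘θ∘T∘φ₁([i_1,…,i_{m-1},n]) = q⁻²[1,i_1+1,…,i_{m-1}+1]`. -/
theorem composite_map_cycles_minors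
    (K : Type*) [Field K] (q : K) (hq : q ≠ 0) (hroot : ∀ k : ℕ, 0 < k → q ^ k ≠ 1)
    (m n : ℕ) (hm : 0 < m) (hmn : m < n)
    (p : K) (hp : p ^ m = q ^ 2)
    (B₁ : Type*) [Ring B₁] [Algebra K B₁]
    (L₁ : NormalLoc K (↥(qGrass K q m n)) B₁
      (grE K q m (consecSet (show 0 < n by omega) m 0)))
    (B₂ : Type*) [Ring B₂] [Algebra K B₂]
    (L₂ : NormalLoc K (↥(qGrass K q m n)) B₂
      (grE K q m (consecSet (show 0 < n by omega) m 1)))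
    (𝒜 : (Fin n → ℤ) → Submodule K B₁) [GradedAlgebra 𝒜]
    (hx : ∀ (i : Fin m) (j : Fin (n - m)),
      xElt K q m n (show 0 < n by omega) 0 L₁ i j ∈ 𝒜 (xContent m n i j))
    (hy : L₁.emb (grE K q m (consecSet (show 0 < n by omega) m 0)) ∈ 𝒜 (yContent m n))
    (T : Type*) [Ring T] [Algebra K T]
    (tw : CocycleTwist K B₁ 𝒜 (cmap K (show 0 < n by omega) p) T)
    (θ : T ≃ₐ[K] B₂)
    (hθx : ∀ (i : Fin m) (j : Fin (n - m)),
      θ (tw.τ (xElt K q m n (show 0 < n by omega) 0 L₁ i j)) =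
        xElt K q m n (show 0 < n by omega) 1 L₂ i j)
    (hθy : θ (tw.τ (L₁.emb (grE K q m (consecSet (show 0 < n by omega) m 0)))) =
      L₂.emb (grE K q m (consecSet (show 0 < n by omega) m 1)))
    (I : Finset (Fin n)) (hI : I.card = m) :
    (lastIdx n (show 0 < n by omega) ∉ I →
      θ (tw.τ (L₁.emb (grE K q m I))) =
        L₂.emb (grE K q m (shiftSet (show 0 < n by omega) I))) ∧
    (lastIdx n (show 0 < n by omega) ∈ I →
      θ (tw.τ (L₁.emb (grE K q m I))) =
        q ^ (-2 : ℤ) • L₂.emb (grE K q m (shiftSet (show 0 < n by omega) I))) := by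
  have hn : 0 < n := by omega
  have hMc : (consecSet hn m 0).card = m := by
    have : consecSet hn m 0 = Finset.univ.filter (fun a : Fin n => a.val < m) := by
      ext a; simp [mem_consec0 hn hmn]
    rw [this, Fin.card_filter_val_lt, min_eq_right hmn.le]
  have hJ : ∀ k i, k ∈ consecSet hn m 0 → i ∉ consecSet hn m 0 →
      ∃ (a : Fin m) (b : Fin (n - m)), JxSet hn m 0 a b = insert i ((consecSet hn m 0).erase k) ∧
        xContent m n a b = xc k i := by
    intro k i hk hi
    rw [mem_consec0 hn hmn] at hk hi
    refine ⟨⟨m - 1 - k, by omega⟩, ⟨i - m, by omega⟩, ?_, ?_⟩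
    · rw [Jx0 hn hmn]
      congr 2
      · show m + (i.val - m) = i; omega
      · apply Fin.ext; show m - 1 - (m - 1 - k.val) = k; omega
    · funext l
      have e1 : l = i ↔ l.val = m + (i.val - m) := by
        rw [Fin.ext_iff, show m + (i.val - m) = i.val by omega]
      have e2 : l = k ↔ l.val = m - 1 - (m - 1 - k.val) := by
        rw [Fin.ext_iff, show m - 1 - (m - 1 - k.val) = k.val by omega]
      simp only [xContent, xc, e1, e2]
  have hgr : ∀ (S : Finset (Fin n)), S = consecSet hn m 1 →
      L₂.emb (grE K q m S) = ↑L₂.isUnit.unit := by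
    rintro S rfl; rfl
  have key := core K q hq m n hn hm hmn p hp B₁ B₂ L₁.emb L₂.emb L₁.isUnit.unit L₂.isUnit.unit
    (consecSet hn m 0) (mem_consec0 hn hmn) hMc rfl (hgr _ (consec1 hn hmn).symm) 𝒜
    (θ.toLinearMap ∘ₗ tw.τ.toLinearMap)
    (by
      intro s t a b ha hb
      have := congrArg θ (tw.mul_tw s t a b ha hb)
      rw [map_mul, map_smul] at this
      exact this)
    (by
      intro k i hk hi
      obtain ⟨a, b, h1, h2⟩ := hJ k i hk hi
      have := hx a b
      rw [xElt, h1, h2] at this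
      exact this)
    (by
      intro k i hk hi
      obtain ⟨a, b, h1, h2⟩ := hJ k i hk hi
      have := hθx a b
      rw [xElt, xElt, Jx1 hn hmn, h1] at this
      exact this)
    hy hθy _ I hI rfl
  constructor
  · intro h
    have := key.2
    rw [if_neg h, one_smul] at this
    exact this
  · intro h
    have := key.2
    rw [if_pos h] at this
    exact this

end QG
end

section
/- (Main theorem.) The twist T(O_q(G(m,n))) of the quantum grassmannian by the 2-cocycle c is isomorphic as a K-algebra to O_q(G(m,n)), via an isomorphism θ that sends the twisted quantum minor [i_1,…,i_m]' to [i_1+1,…,i_m+1] when i_m < n, and sends [i_1,…,i_{m−1},n]' to q^{−2}[1, i_1+1,…,i_{m−1}+1]. In particular, up to nonzero scalars, the twist map realises the cycling of indices of generating quantum minors by the Coxeter element (12…n). -/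
open scoped BigOperators

namespace QG
set_option linter.unusedVariables false

section Basics
variable {K : Type*} [Field K] {q : K} {m n : ℕ}

/-- A matrix of elements satisfying the quantum matrix relations. -/
structure IsQM_s17 (q : K) {B : Type*} [Ring B] [Algebra K B] (x : Fin m → Fin n → B) : Prop where
  row : ∀ i j l, j < l → x i j * x i l = q • (x i l * x i j)
  col : ∀ i k j, i < k → x i j * x k j = q • (x k j * x i j)
  comm : ∀ i k j l, k < i → j < l → x i j * x k l = x k l * x i j
  qrel : ∀ i k j l, i < k → j < l →
    x i j * x k l - x k l * x i j = (q - q⁻¹) • (x i l * x k j)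

theorem isQM_X : IsQM_s17 q (fun i j => X K q (m := m) (n := n) i j) where
  row i j l h := by
    have := RingQuot.mkAlgHom_rel K (QMatRel.row (K := K) (q := q) (m := m) i j l h)
    simp only [map_mul, map_smul] at this
    exact this
  col i k j h := by
    have := RingQuot.mkAlgHom_rel K (QMatRel.col (K := K) (q := q) (n := n) i k j h)
    simp only [map_mul, map_smul] at this
    exact this
  comm i k j l h h' := by
    have := RingQuot.mkAlgHom_rel K (QMatRel.comm (K := K) (q := q) i k j l h h')
    simp only [map_mul, map_smul] at this
    exact this
  qrel i k j l h h' := by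
    have := RingQuot.mkAlgHom_rel K (QMatRel.qrel (K := K) (q := q) i k j l h h')
    simp only [map_mul, map_smul, map_sub] at this
    exact this

/-- The universal property of the quantum matrix algebra. -/
noncomputable def qlift {B : Type*} [Ring B] [Algebra K B] (x : Fin m → Fin n → B)
    (h : IsQM_s17 q x) : QMat K q m n →ₐ[K] B :=
  RingQuot.liftAlgHom K ⟨FreeAlgebra.lift K (fun ij => x ij.1 ij.2), by
    intro a b hab
    induction hab with
    | row i j l hl => simpa using h.row i j l hl
    | col i k j hl => simpa using h.col i k j hl
    | comm i k j l h1 h2 => simpa using h.comm i k j l h1 h2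
    | qrel i k j l h1 h2 => simpa using h.qrel i k j l h1 h2⟩

@[simp] theorem qlift_X {B : Type*} [Ring B] [Algebra K B] (x : Fin m → Fin n → B)
    (h : IsQM_s17 q x) (i : Fin m) (j : Fin n) : qlift x h (X K q i j) = x i j := by
  unfold qlift X
  rw [RingQuot.liftAlgHom_mkAlgHom_apply]
  simp

theorem mem_of_gens (S : Subalgebra K (QMat K q m n)) (h : ∀ i j, X K q i j ∈ S)
    (a : QMat K q m n) : a ∈ S := by
  obtain ⟨b, rfl⟩ := RingQuot.mkAlgHom_surjective K (QMatRel K q m n) a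
  induction b using FreeAlgebra.induction with
  | grade0 r => rw [AlgHom.commutes]; exact S.algebraMap_mem r
  | grade1 x => exact h x.1 x.2
  | mul a b ha hb => rw [map_mul]; exact S.mul_mem ha hb
  | add a b ha hb => rw [map_add]; exact S.add_mem ha hb

theorem qalgHom_ext {B : Type*} [Ring B] [Algebra K B] {f g : QMat K q m n →ₐ[K] B}
    (h : ∀ i j, f (X K q i j) = g (X K q i j)) : f = g := by
  refine AlgHom.ext fun a => ?_
  exact mem_of_gens (AlgHom.equalizer f g) h a

/-- Induction by left multiplication by generators. -/
theorem left_induction (W : Submodule K (QMat K q m n)) (h1 : (1 : QMat K q m n) ∈ W)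
    (hX : ∀ i j, ∀ a ∈ W, X K q i j * a ∈ W) (a : QMat K q m n) : a ∈ W := by
  let S : Subalgebra K (QMat K q m n) :=
    { carrier := {a | ∀ b ∈ W, a * b ∈ W}
      mul_mem' := by
        intro a b ha hb c hc
        rw [mul_assoc]; exact ha _ (hb _ hc)
      add_mem' := by
        intro a b ha hb c hc
        rw [add_mul]; exact W.add_mem (ha _ hc) (hb _ hc)
      algebraMap_mem' := by
        intro r b hb
        rw [← Algebra.smul_def]; exact W.smul_mem _ hb }
  have := mem_of_gens S (fun i j => hX i j) a 1 h1
  simpa using this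

/-- Column maps. -/
noncomputable def colMap (q : K) (m : ℕ) {n n' : ℕ} (f : Fin n → Fin n') (hf : StrictMono f) :
    QMat K q m n →ₐ[K] QMat K q m n' :=
  qlift (fun i j => X K q i (f j))
    { row := fun i j l h => isQM_X.row i _ _ (hf h)
      col := fun i k j h => isQM_X.col i k _ h
      comm := fun i k j l h h' => isQM_X.comm i k _ _ h (hf h')
      qrel := fun i k j l h h' => isQM_X.qrel i k _ _ h (hf h') }

@[simp] theorem colMap_X {n' : ℕ} (f : Fin n → Fin n') (hf : StrictMono f) (i : Fin m)
    (j : Fin n) : colMap q m f hf (X K q i j) = X K q i (f j) := by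
  simp [colMap]

theorem IsQM_s17.scale {B : Type*} [Ring B] [Algebra K B] {x : Fin m → Fin n → B} (hx : IsQM_s17 q x)
    (r : Fin m → K) (c : Fin n → K) : IsQM_s17 q (fun i j => (r i * c j) • x i j) where
  row i j l h := by
    simp only [smul_mul_smul_comm]
    rw [hx.row i j l h, smul_comm q]; congr 1; ring
  col i k j h := by
    simp only [smul_mul_smul_comm]
    rw [hx.col i k j h, smul_comm q]; congr 1; ring
  comm i k j l h h' := by
    simp only [smul_mul_smul_comm]
    rw [hx.comm i k j l h h']; congr 1; ring
  qrel i k j l h h' := by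
    simp only [smul_mul_smul_comm]
    rw [mul_comm (r k * c l), ← smul_sub, hx.qrel i k j l h h', smul_comm (q - q⁻¹)]
    congr 1; ring

/-- Row and column scalings. -/
noncomputable def scaleMap (q : K) (r : Fin m → K) (c : Fin n → K) :
    QMat K q m n →ₐ[K] QMat K q m n :=
  qlift (fun i j => (r i * c j) • X K q i j) (isQM_X.scale r c)

@[simp] theorem scaleMap_X (r : Fin m → K) (c : Fin n → K) (i : Fin m)
    (j : Fin n) : scaleMap q r c (X K q i j) = (r i * c j) • X K q i j := by
  simp [scaleMap]

open MulOpposite in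
/-- The anti-automorphism reversing rows and columns. -/
noncomputable def revOp (K : Type*) [Field K] (q : K) (m n : ℕ) :
    QMat K q m n →ₐ[K] (QMat K q m n)ᵐᵒᵖ :=
  qlift (fun i j => op (X K q i.rev j.rev))
    { row := fun i j l h => by
        rw [← op_mul, ← op_mul, ← op_smul, isQM_X.row _ _ _ (Fin.rev_lt_rev.2 h)]
      col := fun i k j h => by
        rw [← op_mul, ← op_mul, ← op_smul, isQM_X.col _ _ _ (Fin.rev_lt_rev.2 h)]
      comm := fun i k j l h h' => by
        rw [← op_mul, ← op_mul, isQM_X.comm _ _ _ _ (Fin.rev_lt_rev.2 h) (Fin.rev_lt_rev.2 h')]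
      qrel := fun i k j l h h' => by
        rw [← op_mul, ← op_mul, ← op_mul, ← op_sub, ← op_smul,
          isQM_X.qrel _ _ _ _ (Fin.rev_lt_rev.2 h) (Fin.rev_lt_rev.2 h')] }

/-- The anti-automorphism reversing rows and columns, as a linear map. -/
noncomputable def rho (K : Type*) [Field K] (q : K) (m n : ℕ) :
    QMat K q m n →ₗ[K] QMat K q m n :=
  (MulOpposite.opLinearEquiv K).symm.toLinearMap ∘ₗ (revOp K q m n).toLinearMap

@[simp] theorem rho_X (i : Fin m) (j : Fin n) :
    rho K q m n (X K q i j) = X K q i.rev j.rev := by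
  simp [rho, revOp]

@[simp] theorem rho_one : rho K q m n 1 = 1 := by simp [rho]

@[simp] theorem rho_mul (a b : QMat K q m n) :
    rho K q m n (a * b) = rho K q m n b * rho K q m n a := by simp [rho]

theorem rho_rho (a : QMat K q m n) : rho K q m n (rho K q m n a) = a := by
  refine left_induction (LinearMap.eqLocus (rho K q m n ∘ₗ rho K q m n) LinearMap.id) ?_ ?_ a
  · simp [LinearMap.mem_eqLocus]
  · intro i j a ha
    simp only [LinearMap.mem_eqLocus, LinearMap.comp_apply, LinearMap.id_apply] at ha ⊢
    simp [ha]

end Basics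
end QG


namespace QG

section LMap
variable {K : Type*} [Field K] {q : K} {m n : ℕ}

/-- Diagonal coefficient of the R-matrix. -/
def Dc (q : K) (i r : Fin m) : K := if i = r then q⁻¹ else 1

/-- Off-diagonal coefficient of the R-matrix. -/
def Tc (q : K) (r i : Fin m) : K := if r < i then q - q⁻¹ else 0

/-- Kronecker delta. -/
def dl (K : Type*) [Field K] (i t : Fin m) : K := if i = t then 1 else 0

theorem IsQM_s17.swap (hq : q ≠ 0) {B : Type*} [Ring B] [Algebra K B] {x : Fin m → Fin n → B}
    (hx : IsQM_s17 q x) (i k : Fin m) (j l : Fin n) (h : j < l) :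
    x k l * x i j = Dc q k i • (x i j * x k l) - Tc q i k • (x k j * x i l) := by
  rcases lt_trichotomy i k with hik | rfl | hik
  · have h1 := hx.qrel i k j l hik h
    have h2 := hx.comm k i j l hik h
    simp only [Dc, Tc, hik, hik.ne', if_true, if_false, one_smul]
    rw [h2, ← h1]; abel
  · have h1 := hx.row i j l h
    simp [Dc, Tc, h1, smul_smul, inv_mul_cancel₀ hq]
  · have h1 := hx.comm i k j l hik h
    simp [Dc, Tc, hik.ne, hik.not_gt, h1]

theorem IsQM_s17.of_swap (hq : q ≠ 0) {B : Type*} [Ring B] [Algebra K B] {x : Fin m → Fin n → B}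
    (hs : ∀ (i k : Fin m) (j l : Fin n), j < l →
      x k l * x i j = Dc q k i • (x i j * x k l) - Tc q i k • (x k j * x i l))
    (hc : ∀ i k j, i < k → x i j * x k j = q • (x k j * x i j)) : IsQM_s17 q x where
  row i j l h := by
    have := hs i i j l h
    simp [Dc, Tc] at this
    rw [this, smul_smul, mul_inv_cancel₀ hq, one_smul]
  col := hc
  comm i k j l h h' := by
    have := hs i k j l h'
    simp [Dc, Tc, h.ne, h.not_gt] at this
    exact this.symm
  qrel i k j l h h' := by
    have h1 := hs i k j l h'
    have h2 := hs k i j l h'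
    simp only [Dc, Tc, h, h.ne, h.ne', h.not_gt, if_true, if_false, one_smul, zero_smul,
      sub_zero] at h1 h2
    rw [h1, h2]; abel

/-- The image of a generator under the L-map. -/
noncomputable def Lx (q : K) {B : Type*} [Ring B] [Algebra K B] (x : Fin m → Fin n → B)
    (r : Fin m) (j : Fin n) : Matrix (Fin m) (Fin m) B :=
  Matrix.of fun i t => (Dc q i r * dl K i t) • x r j - (Tc q r i * dl K r t) • x i j

theorem Lx_apply {B : Type*} [Ring B] [Algebra K B] (x : Fin m → Fin n → B)
    (r : Fin m) (j : Fin n) (i t : Fin m) : Lx q x r j i t =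
    (Dc q i r * dl K i t) • x r j - (Tc q r i * dl K r t) • x i j := rfl

theorem Lx_mul_apply {B : Type*} [Ring B] [Algebra K B] (x : Fin m → Fin n → B)
    (r : Fin m) (j : Fin n) (M : Matrix (Fin m) (Fin m) B) (i t : Fin m) :
    (Lx q x r j * M) i t = Dc q i r • (x r j * M i t) - Tc q r i • (x i j * M r t) := by
  rw [Matrix.mul_apply]
  simp only [Lx_apply, sub_mul, Finset.sum_sub_distrib, smul_mul_assoc, mul_smul]
  simp [dl]

theorem isQM_Lx (hq : q ≠ 0) {B : Type*} [Ring B] [Algebra K B] {x : Fin m → Fin n → B}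
    (hx : IsQM_s17 q x) : IsQM_s17 q (Lx q x) := by
  apply IsQM_s17.of_swap hq
  · intro r s j l hjl
    ext i t
    have hA := fun p u => hx.swap hq p u j l hjl
    rw [Matrix.sub_apply, Matrix.smul_apply, Matrix.smul_apply]
    simp only [Lx_mul_apply]
    simp only [Lx_apply]
    simp only [mul_sub, mul_smul_comm, hA]
    rcases lt_trichotomy i r with h1 | h1 | h1 <;> rcases lt_trichotomy i s with h2 | h2 | h2 <;>
    rcases lt_trichotomy r s with h3 | h3 | h3 <;> (try (exfalso; omega)) <;>
    (try subst h1) <;> (try subst h2) <;> (try subst h3) <;>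
    simp only [Dc, Tc, *, if_true, if_false, lt_irrefl, lt_asymm, ne_of_lt, ne_of_gt] <;>
    match_scalars <;> field_simp <;> ring
  · intro r s j hrs
    ext i t
    have hA := fun p u h => hx.col p u j h
    rw [Matrix.smul_apply]
    simp only [Lx_mul_apply]
    simp only [Lx_apply]
    simp only [mul_sub, mul_smul_comm]
    rcases lt_trichotomy i r with h1 | h1 | h1 <;> rcases lt_trichotomy i s with h2 | h2 | h2 <;>
    (try (exfalso; omega)) <;>
    (try subst h1) <;> (try subst h2)  <;>
    simp only [Dc, Tc, *, if_true, if_false, lt_irrefl, lt_asymm, ne_of_lt, ne_of_gt] <;>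
    match_scalars <;> field_simp <;> ring

end LMap
end QG


namespace QG
open scoped TensorProduct

section Normal
variable {K : Type*} [Field K] {q : K} {m N : ℕ}
variable {A S : Type*} [Ring A] [Algebra K A] [Ring S] [Algebra K S]

/-- The operator by which an element of the last column acts. -/
noncomputable def zeta (Lm : Fin m → Fin m → A →ₗ[K] A) (z : Fin m → S) (i : Fin m) :
    Module.End K (A ⊗[K] S) :=
  ∑ k, TensorProduct.map (Lm i k) (LinearMap.mulLeft K (z k))

/-- The operator by which an element of the other columns acts. -/
noncomputable def xop (S : Type*) [Ring S] [Algebra K S] (a : A) : Module.End K (A ⊗[K] S) :=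
  TensorProduct.map (LinearMap.mulLeft K a) LinearMap.id

theorem zeta_tmul (Lm : Fin m → Fin m → A →ₗ[K] A) (z : Fin m → S) (i : Fin m) (a : A) (s : S) :
    zeta Lm z i (a ⊗ₜ s) = ∑ k, Lm i k a ⊗ₜ[K] (z k * s) := by
  simp [zeta, LinearMap.sum_apply]

theorem xop_tmul (a b : A) (s : S) : xop (K := K) S a (b ⊗ₜ s) = (a * b) ⊗ₜ s := by
  simp [xop]

theorem xop_mul (a b : A) : xop (K := K) S (a * b) = xop S a * xop S b := by
  apply TensorProduct.ext'
  intro c s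
  simp [xop_tmul, Module.End.mul_apply, mul_assoc]

theorem xop_smul (c : K) (a : A) : xop (K := K) S (c • a) = c • xop S a := by
  apply TensorProduct.ext'
  intro b s
  simp [xop_tmul, TensorProduct.smul_tmul']

theorem xop_sub (a b : A) : xop (K := K) S (a - b) = xop S a - xop S b := by
  apply TensorProduct.ext'
  intro c s
  simp [xop_tmul, sub_mul, TensorProduct.sub_tmul]

variable {Lm : Fin m → Fin m → A →ₗ[K] A} {z : Fin m → S} {x : Fin m → Fin N → A}

theorem zeta_xop
    (hL : ∀ i k r j b, Lm i k (x r j * b) =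
      Dc q i r • (x r j * Lm i k b) - Tc q r i • (x i j * Lm r k b)) (i r : Fin m) (j : Fin N) :
    zeta Lm z i * xop S (x r j) =
      Dc q i r • (xop S (x r j) * zeta Lm z i) - Tc q r i • (xop S (x i j) * zeta Lm z r) := by
  apply TensorProduct.ext'
  intro b s
  simp only [Module.End.mul_apply, LinearMap.sub_apply, LinearMap.smul_apply, xop_tmul, zeta_tmul,
    hL, map_sum, TensorProduct.sub_tmul, Finset.sum_sub_distrib, Finset.smul_sum,
    TensorProduct.smul_tmul']

theorem zeta_zeta (hq : q ≠ 0)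
    (hL : ∀ i k r j b, Lm i k (x r j * b) =
      Dc q i r • (x r j * Lm i k b) - Tc q r i • (x i j * Lm r k b))
    (hL1 : ∀ i k, Lm i k 1 = if i = k then 1 else 0)
    (hind : ∀ W : Submodule K A, (1 : A) ∈ W → (∀ i j, ∀ a ∈ W, x i j * a ∈ W) → ∀ a, a ∈ W)
    (hz : ∀ i k, i < k → z i * z k = q • (z k * z i)) (i k : Fin m) (hik : i < k) :
    zeta Lm z i * zeta Lm z k = q • (zeta Lm z k * zeta Lm z i) := by
  have hone : ∀ (i : Fin m) (s : S), zeta Lm z i ((1 : A) ⊗ₜ s) = 1 ⊗ₜ (z i * s) := by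
    intro i s
    rw [zeta_tmul]
    simp [hL1, TensorProduct.ite_tmul]
  let W : Submodule K A :=
    { carrier := {a | ∀ i k, i < k → ∀ s : S, zeta Lm z i (zeta Lm z k (a ⊗ₜ s)) =
        q • zeta Lm z k (zeta Lm z i (a ⊗ₜ s))}
      zero_mem' := by intro i k _ s; simp
      add_mem' := by
        intro a b ha hb i k h s
        simp only [TensorProduct.add_tmul, map_add, ha i k h s, hb i k h s, smul_add]
      smul_mem' := by
        intro c a ha i k h s
        simp only [← TensorProduct.smul_tmul', map_smul, ha i k h s]
        rw [smul_comm] }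
  have key : ∀ a, a ∈ W := by
    apply hind
    · intro i k h s
      simp only [hone, ← mul_assoc]
      rw [hz i k h]; simp
    · intro r j a ha i k h s
      have hzx : ∀ (i r : Fin m) (v : A ⊗[K] S), zeta Lm z i (xop S (x r j) v) =
          Dc q i r • (xop S (x r j) (zeta Lm z i v)) - Tc q r i • (xop S (x i j) (zeta Lm z r v)) := by
        intro i r v
        have := congrArg (fun f => f v) (zeta_xop (z := z) hL i r j)
        simpa only [Module.End.mul_apply, LinearMap.sub_apply, LinearMap.smul_apply] using this
      have ha' := fun i k (h : i < k) => ha i k h s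
      rw [← xop_tmul]
      generalize a ⊗ₜ[K] s = v at ha'
      simp only [hzx, map_sub, map_smul]
      rcases lt_trichotomy i r with h1 | h1 | h1 <;>
      rcases lt_trichotomy k r with h2 | h2 | h2 <;>
      (try (exfalso; omega)) <;>
      (try subst h1) <;> (try subst h2)  <;>
      simp only [Dc, Tc, if_true, if_false, lt_irrefl, *, lt_asymm, ne_of_lt, ne_of_gt, map_smul,
        smul_smul] <;>
      match_scalars <;> field_simp <;> ring
  apply TensorProduct.ext'
  intro a s
  simpa only [Module.End.mul_apply, LinearMap.smul_apply] using key a i k hik s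

/-- The matrix of operators giving the normal-ordering representation. -/
noncomputable def nop (Lm : Fin m → Fin m → A →ₗ[K] A) (z : Fin m → S) (x : Fin m → Fin N → A)
    (i : Fin m) (j : Fin (N + 1)) : Module.End K (A ⊗[K] S) :=
  Fin.lastCases (motive := fun _ => Module.End K (A ⊗[K] S)) (zeta Lm z i)
    (fun j => xop S (x i j)) j

@[simp] theorem nop_last (i : Fin m) : nop Lm z x i (Fin.last N) = zeta Lm z i := by
  simp [nop]

@[simp] theorem nop_castSucc (i : Fin m) (j : Fin N) :
    nop Lm z x i j.castSucc = xop S (x i j) := by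
  simp [nop]

theorem isQM_nop (hq : q ≠ 0) (hx : IsQM_s17 q x)
    (hL : ∀ i k r j b, Lm i k (x r j * b) =
      Dc q i r • (x r j * Lm i k b) - Tc q r i • (x i j * Lm r k b))
    (hL1 : ∀ i k, Lm i k 1 = if i = k then 1 else 0)
    (hind : ∀ W : Submodule K A, (1 : A) ∈ W → (∀ i j, ∀ a ∈ W, x i j * a ∈ W) → ∀ a, a ∈ W)
    (hz : ∀ i k, i < k → z i * z k = q • (z k * z i)) : IsQM_s17 q (nop Lm z x) := by
  apply IsQM_s17.of_swap hq
  · intro i k j l hjl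
    induction j using Fin.lastCases with
    | last => exact absurd hjl (by simp [Fin.not_lt, Fin.le_last])
    | cast j =>
      induction l using Fin.lastCases with
      | last => simpa using zeta_xop hL k i j
      | cast l =>
        simp only [nop_castSucc, ← xop_mul, ← xop_smul, ← xop_sub]
        rw [hx.swap hq i k j l (by simpa using hjl)]
  · intro i k j hik
    induction j using Fin.lastCases with
    | last => simpa using zeta_zeta hq hL hL1 hind hz i k hik
    | cast j =>
      simp only [nop_castSucc, ← xop_mul, ← xop_smul]
      rw [hx.col i k j hik]

end Normal
end QG


namespace QG
open scoped TensorProduct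

section Psi
variable {K : Type*} [Field K] {q : K} {m n N : ℕ}

/-- The L-map. -/
noncomputable def Lhom (hq : q ≠ 0) (m n : ℕ) :
    QMat K q m n →ₐ[K] Matrix (Fin m) (Fin m) (QMat K q m n) :=
  qlift (Lx q (fun i j => X K q i j)) (isQM_Lx hq isQM_X)

/-- Entries of the L-map, as linear maps. -/
noncomputable def Lent (hq : q ≠ 0) (m n : ℕ) (i k : Fin m) :
    QMat K q m n →ₗ[K] QMat K q m n :=
  Matrix.entryLinearMap K (QMat K q m n) i k ∘ₗ (Lhom hq m n).toLinearMap

theorem Lent_apply (hq : q ≠ 0) (i k : Fin m) (a : QMat K q m n) :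
    Lent hq m n i k a = Lhom hq m n a i k := rfl

theorem Lent_rec (hq : q ≠ 0) (i k r : Fin m) (j : Fin n) (b : QMat K q m n) :
    Lent hq m n i k (X K q r j * b) =
      Dc q i r • (X K q r j * Lent hq m n i k b) - Tc q r i • (X K q i j * Lent hq m n r k b) := by
  simp only [Lent_apply, map_mul]
  have : Lhom hq m n (X K q r j) = Lx q (fun i j => X K q i j) r j := by simp [Lhom]
  rw [this, Lx_mul_apply]

theorem Lent_one (hq : q ≠ 0) (i k : Fin m) :
    Lent hq m n i k (1 : QMat K q m n) = if i = k then 1 else 0 := by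
  simp [Lent_apply, Matrix.one_apply]

/-- Inclusion of the first `N` columns. -/
noncomputable def iA (K : Type*) [Field K] (q : K) (m N : ℕ) :
    QMat K q m N →ₐ[K] QMat K q m (N + 1) := colMap q m Fin.castSucc Fin.strictMono_castSucc

/-- Inclusion of the last `N` columns. -/
noncomputable def sA (K : Type*) [Field K] (q : K) (m N : ℕ) :
    QMat K q m N →ₐ[K] QMat K q m (N + 1) := colMap q m Fin.succ Fin.strictMono_succ

/-- Inclusion of the last column. -/
noncomputable def zA (K : Type*) [Field K] (q : K) (m N : ℕ) :
    QMat K q m 1 →ₐ[K] QMat K q m (N + 1) :=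
  colMap q m (fun _ => Fin.last N) (Subsingleton.strictMono _)

/-- Inclusion of the first column. -/
noncomputable def wA (K : Type*) [Field K] (q : K) (m N : ℕ) :
    QMat K q m 1 →ₐ[K] QMat K q m (N + 1) :=
  colMap q m (fun _ => 0) (Subsingleton.strictMono _)

@[simp] theorem iA_X (i : Fin m) (j : Fin N) : iA K q m N (X K q i j) = X K q i j.castSucc := by
  simp [iA]
@[simp] theorem sA_X (i : Fin m) (j : Fin N) : sA K q m N (X K q i j) = X K q i j.succ := by
  simp [sA]
@[simp] theorem zA_X (i : Fin m) (j : Fin 1) : zA K q m N (X K q i j) = X K q i (Fin.last N) := by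
  simp [zA]
@[simp] theorem wA_X (i : Fin m) (j : Fin 1) : wA K q m N (X K q i j) = X K q i 0 := by
  simp [wA]

theorem X_one_col (i : Fin m) (j : Fin 1) : X K q i j = X K q i 0 := by
  rw [Subsingleton.elim j 0]

/-- The rescaling of the column algebra. -/
noncomputable def kap (K : Type*) [Field K] (q : K) (m : ℕ) : QMat K q m 1 →ₐ[K] QMat K q m 1 :=
  scaleMap q (fun k => q ^ (2 * (k : ℕ))) (fun _ => 1)

/-- The normal ordering representation. -/
noncomputable def Phi (hq : q ≠ 0) (m N : ℕ) :
    QMat K q m (N + 1) →ₐ[K] Module.End K (QMat K q m N ⊗[K] QMat K q m 1) :=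
  qlift (nop (Lent hq m N) (fun i => X K q i 0) (fun i j => X K q i j))
    (isQM_nop hq isQM_X (Lent_rec hq) (Lent_one hq)
      (fun W h1 h2 a => left_induction W h1 h2 a) (fun i k h => isQM_X.col i k 0 h))

theorem Phi_castSucc (hq : q ≠ 0) (i : Fin m) (j : Fin N) :
    Phi hq m N (X K q i j.castSucc) = xop _ (X K q i j) := by
  unfold Phi; rw [qlift_X, nop_castSucc]

theorem Phi_last (hq : q ≠ 0) (i : Fin m) :
    Phi hq m N (X K q i (Fin.last N)) = zeta (Lent hq m N) (fun i => X K q i 0) i := by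
  unfold Phi; rw [qlift_X, nop_last]

theorem Phi_iA (hq : q ≠ 0) (b : QMat K q m N) (s : QMat K q m 1) :
    Phi hq m N (iA K q m N b) (1 ⊗ₜ s) = b ⊗ₜ s := by
  refine left_induction (LinearMap.eqLocus
    ((LinearMap.applyₗ ((1 : QMat K q m N) ⊗ₜ[K] s)) ∘ₗ (Phi hq m N).toLinearMap ∘ₗ
      (iA K q m N).toLinearMap) ((TensorProduct.mk K _ _).flip s)) ?_ ?_ b
  · simp [LinearMap.mem_eqLocus]
  · intro i j a ha
    simp only [LinearMap.mem_eqLocus, LinearMap.comp_apply, AlgHom.toLinearMap_apply,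
      LinearMap.applyₗ_apply_apply, LinearMap.flip_apply, TensorProduct.mk_apply] at ha ⊢
    rw [map_mul, map_mul, Module.End.mul_apply, ha, iA_X, Phi_castSucc, xop_tmul]

theorem Phi_zA (hq : q ≠ 0) (s : QMat K q m 1) :
    Phi hq m N (zA K q m N s) (1 ⊗ₜ 1) = 1 ⊗ₜ s := by
  refine left_induction (LinearMap.eqLocus
    ((LinearMap.applyₗ ((1 : QMat K q m N) ⊗ₜ[K] (1 : QMat K q m 1))) ∘ₗ
      (Phi hq m N).toLinearMap ∘ₗ
      (zA K q m N).toLinearMap) ((TensorProduct.mk K (QMat K q m N) (QMat K q m 1) 1))) ?_ ?_ s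
  · simp [LinearMap.mem_eqLocus]
  · intro i j a ha
    simp only [LinearMap.mem_eqLocus, LinearMap.comp_apply, AlgHom.toLinearMap_apply,
      LinearMap.applyₗ_apply_apply, TensorProduct.mk_apply] at ha ⊢
    rw [map_mul, map_mul, Module.End.mul_apply, ha, zA_X, Phi_last, zeta_tmul, X_one_col i j]
    simp only [Lent_one, TensorProduct.ite_tmul, TensorProduct.zero_tmul]
    rw [Finset.sum_ite_eq]; simp

/-- The linear map moving the last column to the front. -/
noncomputable def Psi (hq : q ≠ 0) (m N : ℕ) :
    QMat K q m (N + 1) →ₗ[K] QMat K q m (N + 1) :=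
  TensorProduct.lift
    ((LinearMap.mul K (QMat K q m (N + 1))).flip.compl₁₂ (sA K q m N).toLinearMap
      ((wA K q m N).toLinearMap ∘ₗ (kap K q m).toLinearMap)) ∘ₗ
    LinearMap.applyₗ ((1 : QMat K q m N) ⊗ₜ[K] (1 : QMat K q m 1)) ∘ₗ (Phi hq m N).toLinearMap

theorem Psi_apply (hq : q ≠ 0) (b : QMat K q m N) (s : QMat K q m 1) :
    Psi hq m N (iA K q m N b * zA K q m N s) = wA K q m N (kap K q m s) * sA K q m N b := by
  simp only [Psi, LinearMap.comp_apply, AlgHom.toLinearMap_apply, LinearMap.applyₗ_apply_apply,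
    map_mul, Module.End.mul_apply, Phi_zA, Phi_iA, TensorProduct.lift.tmul,
    LinearMap.compl₁₂_apply, LinearMap.flip_apply, LinearMap.mul_apply']

theorem smul_mul_right_aux {B : Type*} [Ring B] [Algebra K B] (c d : K) (a b e a' b' e' z : B)
    (h : z * a = c • (a * b) - d • (a' * b')) (x : B) (hb : b * x = e) (hb' : b' * x = e') :
    z * (a * x) = c • (a * e) - d • (a' * e') := by
  rw [← mul_assoc, h, sub_mul, smul_mul_assoc, smul_mul_assoc, mul_assoc, mul_assoc, hb, hb']

theorem sum_aux {B : Type*} [Ring B] [Algebra K B] {C : Type*} [Ring C] [Algebra K C]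
    (f : C →ₐ[K] B) (c d : K) (a a' : C) (u v : Fin m → C) (z : Fin m → B) :
    c • (f a * ∑ k, f (u k) * z k) - d • (f a' * ∑ k, f (v k) * z k) =
      ∑ k, f (c • (a * u k) - d • (a' * v k)) * z k := by
  simp only [map_sub, map_smul, map_mul, sub_mul, smul_mul_assoc, Finset.sum_sub_distrib,
    Finset.mul_sum, Finset.smul_sum, mul_assoc]

theorem z_iA (hq : q ≠ 0) (b : QMat K q m N) : ∀ i : Fin m,
    X K q i (Fin.last N) * iA K q m N b =
      ∑ k, iA K q m N (Lent hq m N i k b) * X K q k (Fin.last N) := by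
  let W : Submodule K (QMat K q m N) :=
    { carrier := {b | ∀ i : Fin m, X K q i (Fin.last N) * iA K q m N b =
        ∑ k, iA K q m N (Lent hq m N i k b) * X K q k (Fin.last N)}
      zero_mem' := by intro i; simp
      add_mem' := by
        intro a b ha hb i
        simp only [map_add, mul_add, ha i, hb i, add_mul, Finset.sum_add_distrib]
      smul_mem' := by
        intro c a ha i
        simp only [map_smul, Algebra.mul_smul_comm, ha i, Algebra.smul_mul_assoc,
          Finset.smul_sum] }
  refine left_induction W ?_ ?_ b
  · intro i
    simp [Lent_one, apply_ite (iA K q m N)]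
  · intro r j a ha i
    rw [map_mul, iA_X]
    rw [smul_mul_right_aux _ _ _ _ _ _ _ _ _ (isQM_X.swap hq r i _ _ (Fin.castSucc_lt_last j)) _
      (ha i) (ha r)]
    simp only [Lent_rec]
    rw [← sum_aux, iA_X, iA_X]

theorem normal_mem (hq : q ≠ 0) (a : QMat K q m (N + 1)) :
    a ∈ Submodule.span K
      (Set.range fun p : QMat K q m N × QMat K q m 1 => iA K q m N p.1 * zA K q m N p.2) := by
  refine left_induction _ ?_ ?_ a
  · exact Submodule.subset_span ⟨(1, 1), by simp⟩
  · intro i j a ha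
    induction ha using Submodule.span_induction with
    | mem a ha =>
      obtain ⟨⟨b, s⟩, rfl⟩ := ha
      simp only
      induction j using Fin.lastCases with
      | last =>
        rw [← mul_assoc, z_iA hq, Finset.sum_mul]
        refine Submodule.sum_mem _ fun k _ => Submodule.subset_span
          ⟨(Lent hq m N i k b, X K q k 0 * s), ?_⟩
        simp [mul_assoc]
      | cast j => exact Submodule.subset_span ⟨(X K q i j * b, s), by simp [mul_assoc]⟩
    | zero => simp
    | add a b _ _ ha hb => rw [mul_add]; exact Submodule.add_mem _ ha hb
    | smul c a _ ha => rw [Algebra.mul_smul_comm]; exact Submodule.smul_mem _ _ ha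

theorem normal_ext (hq : q ≠ 0) {B : Type*} [AddCommMonoid B] [Module K B]
    (f g : QMat K q m (N + 1) →ₗ[K] B)
    (h : ∀ b s, f (iA K q m N b * zA K q m N s) = g (iA K q m N b * zA K q m N s)) : f = g := by
  ext a
  refine LinearMap.eqOn_span (s := Set.range fun p : QMat K q m N × QMat K q m 1 =>
    iA K q m N p.1 * zA K q m N p.2) ?_ (normal_mem hq a)
  rintro _ ⟨⟨b, s⟩, rfl⟩
  exact h b s

theorem Psi_one (hq : q ≠ 0) : Psi hq m N (1 : QMat K q m (N + 1)) = 1 := by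
  have := Psi_apply hq (1 : QMat K q m N) (1 : QMat K q m 1)
  simpa using this

/-! Injectivity of `Psi`. -/

theorem rho_iA (b : QMat K q m N) :
    rho K q m (N + 1) (iA K q m N b) = sA K q m N (rho K q m N b) := by
  refine left_induction (LinearMap.eqLocus (rho K q m (N + 1) ∘ₗ (iA K q m N).toLinearMap)
    ((sA K q m N).toLinearMap ∘ₗ rho K q m N)) ?_ ?_ b
  · simp [LinearMap.mem_eqLocus]
  · intro i j a ha
    simp only [LinearMap.mem_eqLocus, LinearMap.comp_apply, AlgHom.toLinearMap_apply] at ha ⊢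
    simp [ha, Fin.rev_castSucc]

theorem rho_sA (b : QMat K q m N) :
    rho K q m (N + 1) (sA K q m N b) = iA K q m N (rho K q m N b) := by
  rw [← rho_rho b, ← rho_iA, rho_rho, rho_rho]

theorem rho_zA (b : QMat K q m 1) :
    rho K q m (N + 1) (zA K q m N b) = wA K q m N (rho K q m 1 b) := by
  refine left_induction (LinearMap.eqLocus (rho K q m (N + 1) ∘ₗ (zA K q m N).toLinearMap)
    ((wA K q m N).toLinearMap ∘ₗ rho K q m 1)) ?_ ?_ b
  · simp [LinearMap.mem_eqLocus]
  · intro i j a ha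
    simp only [LinearMap.mem_eqLocus, LinearMap.comp_apply, AlgHom.toLinearMap_apply] at ha ⊢
    simp [ha]

theorem rho_wA (b : QMat K q m 1) :
    rho K q m (N + 1) (wA K q m N b) = zA K q m N (rho K q m 1 b) := by
  rw [← rho_rho b, ← rho_zA, rho_rho, rho_rho]

theorem kap_inj (hq : q ≠ 0) : Function.Injective (kap K q m) := by
  have : (scaleMap q (fun k : Fin m => (q ^ (2 * (k : ℕ)))⁻¹) (fun _ : Fin 1 => 1)).comp
      (kap K q m) = AlgHom.id K _ := by
    apply qalgHom_ext
    intro i j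
    simp [kap, smul_smul, hq]
  intro a b h
  have h1 := congrArg (fun f => f a) this
  have h2 := congrArg (fun f => f b) this
  simp only [AlgHom.comp_apply, AlgHom.id_apply] at h1 h2
  rw [← h1, ← h2, h]

theorem Psi_inj (hq : q ≠ 0) : Function.Injective (Psi hq m N) := by
  let c : K := (q ^ (2 * (m - 1)))⁻¹
  let G : QMat K q m (N + 1) →ₐ[K] QMat K q m (N + 1) :=
    scaleMap q (fun _ => 1) (fun j => if j = Fin.last N then c else 1)
  have hGi : ∀ b, G (iA K q m N b) = iA K q m N b := by
    have : G.comp (iA K q m N) = iA K q m N := by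
      apply qalgHom_ext
      intro i j
      simp [G, Fin.castSucc_ne_last]
    exact fun b => congrArg (fun f => f b) this
  -- the composite on the column algebra
  have hcol : ∀ s, G (zA K q m N (rho K q m 1 (kap K q m (rho K q m 1 (kap K q m s))))) =
      zA K q m N s := by
    intro s
    refine left_induction (LinearMap.eqLocus (G.toLinearMap ∘ₗ (zA K q m N).toLinearMap ∘ₗ
      rho K q m 1 ∘ₗ (kap K q m).toLinearMap ∘ₗ rho K q m 1 ∘ₗ (kap K q m).toLinearMap)
      (zA K q m N).toLinearMap) ?_ ?_ s
    · simp [LinearMap.mem_eqLocus]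
    · intro i j a ha
      simp only [LinearMap.mem_eqLocus, LinearMap.comp_apply, AlgHom.toLinearMap_apply] at ha ⊢
      simp only [map_mul, rho_mul, ha]
      congr 1
      simp only [kap, scaleMap_X, map_smul, rho_X, zA_X, G, smul_smul, Fin.rev_rev]
      simp only [if_true, mul_one, one_mul, c]
      have : 2 * (m - 1) = 2 * (i.rev : ℕ) + 2 * (i : ℕ) := by
        have := i.isLt
        rw [Fin.val_rev]; omega
      rw [this, pow_add]
      convert one_smul K _
      have := pow_ne_zero (2 * (i.rev : ℕ)) hq
      have := pow_ne_zero (2 * (i : ℕ)) hq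
      field_simp
  have : G.toLinearMap ∘ₗ rho K q m (N + 1) ∘ₗ Psi hq m N ∘ₗ rho K q m (N + 1) ∘ₗ Psi hq m N =
      LinearMap.id := by
    apply normal_ext hq
    intro b s
    simp only [LinearMap.comp_apply, AlgHom.toLinearMap_apply, Psi_apply, rho_mul, rho_sA, rho_wA,
      LinearMap.id_apply, rho_rho, map_mul, hcol, hGi]
  exact Function.LeftInverse.injective (g := fun x =>
    G.toLinearMap (rho K q m (N + 1) (Psi hq m N (rho K q m (N + 1) x))))
    (fun x => congrArg (fun f => f x) this)

end Psi
end QG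


namespace QG

section Mu
variable {K : Type*} [Field K] {m n : ℕ}

/-- number of elements of `R` below `k` -/
def nlt (R : Finset (Fin m)) (k : Fin m) : ℕ := (R.filter (· < k)).card
/-- number of elements of `R` above `k` -/
def ngt (R : Finset (Fin m)) (k : Fin m) : ℕ := (R.filter (k < ·)).card

theorem nlt_erase (R : Finset (Fin m)) (k r : Fin m) (hr : r ∈ R) :
    nlt (R.erase r) k + (if r < k then 1 else 0) = nlt R k := by
  unfold nlt
  rw [Finset.filter_erase]
  split_ifs with h
  · exact Finset.card_erase_add_one (by simp [hr, h])
  · rw [Finset.erase_eq_of_notMem (by simp [h])]; rfl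

theorem ngt_erase (R : Finset (Fin m)) (k r : Fin m) (hr : r ∈ R) :
    ngt (R.erase r) k + (if k < r then 1 else 0) = ngt R k := by
  unfold ngt
  rw [Finset.filter_erase]
  split_ifs with h
  · exact Finset.card_erase_add_one (by simp [hr, h])
  · rw [Finset.erase_eq_of_notMem (by simp [h])]; rfl

/-- Quantum minors by expansion along the first column. -/
noncomputable def mu {B : Type*} [Ring B] [Algebra K B] (q : K) (x : Fin m → Fin n → B) :
    List (Fin n) → Finset (Fin m) → B
  | [], R => if R = ∅ then 1 else 0
  | (j :: js), R => ∑ k ∈ R, (-q) ^ nlt R k • (x k j * mu q x js (R.erase k))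

variable {B : Type*} [Ring B] [Algebra K B] {q : K} {x : Fin m → Fin n → B}

theorem mu_nil (R : Finset (Fin m)) : mu q x [] R = if R = ∅ then 1 else 0 := rfl
theorem mu_cons (j : Fin n) (js) (R : Finset (Fin m)) :
    mu q x (j :: js) R = ∑ k ∈ R, (-q) ^ nlt R k • (x k j * mu q x js (R.erase k)) := rfl

theorem mu_map {n' : ℕ} (y : Fin m → Fin n' → B) (f : Fin n → Fin n')
    (js : List (Fin n)) (R : Finset (Fin m)) :
    mu q y (js.map f) R = mu q (fun i j => y i (f j)) js R := by
  induction js generalizing R with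
  | nil => rfl
  | cons j js ih => simp only [List.map_cons, mu_cons, ih]

theorem mu_hom {C : Type*} [Ring C] [Algebra K C] (f : B →ₐ[K] C)
    (js : List (Fin n)) (R : Finset (Fin m)) :
    f (mu q x js R) = mu q (fun i j => f (x i j)) js R := by
  induction js generalizing R with
  | nil => simp [mu_nil, apply_ite f]
  | cons j js ih => simp only [mu_cons, map_sum, map_smul, map_mul, ih]

theorem mu_concat (js : List (Fin n)) (l : Fin n) (R : Finset (Fin m)) :
    mu q x (js ++ [l]) R = ∑ k ∈ R, (-q) ^ ngt R k • (mu q x js (R.erase k) * x k l) := by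
  induction js generalizing R with
  | nil =>
    simp only [List.nil_append, mu_cons]
    refine Finset.sum_congr rfl fun k hk => ?_
    rw [mu_nil]
    split_ifs with h
    · have : R = {k} := by
        rw [Finset.erase_eq_empty_iff] at h
        rcases h with h | h
        · simp [h] at hk
        · exact h
      subst this
      simp [nlt, ngt, Finset.filter_singleton]
    · simp
  | cons j js ih =>
    simp only [List.cons_append, mu_cons, ih]
    simp only [Finset.mul_sum, Finset.sum_mul, Finset.smul_sum, mul_smul_comm, smul_mul_assoc,
      smul_smul]
    rw [Finset.sum_sigma', Finset.sum_sigma']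
    refine Finset.sum_bij' (fun a _ => ⟨a.2, a.1⟩) (fun a _ => ⟨a.2, a.1⟩) ?_ ?_ ?_ ?_ ?_
    · rintro ⟨a, b⟩ h; simp at h ⊢; tauto
    · rintro ⟨a, b⟩ h; simp at h ⊢; tauto
    · simp
    · simp
    · rintro ⟨a, b⟩ h
      simp only [Finset.mem_sigma, Finset.mem_erase] at h
      simp only [Finset.erase_right_comm (a := a) (b := b), mul_assoc, ← pow_add]
      congr 2
      have h1 := ngt_erase R b a h.1
      have h2 := nlt_erase R a b h.2.2
      omega

end Mu
end QG


namespace QG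

section M0
variable {K : Type*} [Field K] {m n : ℕ}

/-- inversions of a function -/
def finv {t : ℕ} (f : Fin t → Fin m) : ℕ :=
  ((Finset.univ : Finset (Fin t × Fin t)).filter fun p => p.1 < p.2 ∧ f p.2 < f p.1).card

theorem finv_cons {t : ℕ} (k : Fin m) (f : Fin t → Fin m) :
    finv (Fin.cons k f : Fin (t + 1) → Fin m) =
      (Finset.univ.filter fun i => f i < k).card + finv f := by
  unfold finv
  simp only [Finset.card_filter, Fintype.sum_prod_type, Fin.sum_univ_succ, Fin.cons_zero,
    Fin.cons_succ]
  simp [Fin.succ_pos]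

theorem cons_inj_image {t : ℕ} (k : Fin m) (f : Fin t → Fin m) (R : Finset (Fin m)) :
    (Function.Injective (Fin.cons k f : Fin (t + 1) → Fin m) ∧
      Finset.univ.image (Fin.cons k f : Fin (t + 1) → Fin m) = R) ↔
    (k ∈ R ∧ Function.Injective f ∧ Finset.univ.image f = R.erase k) := by
  rw [Fin.cons_injective_iff]
  have hi : Finset.univ.image (Fin.cons k f : Fin (t + 1) → Fin m) =
      insert k (Finset.univ.image f) := by
    ext a; simp [Fin.exists_fin_succ, eq_comm]
  rw [hi]
  constructor
  · rintro ⟨⟨h1, h2⟩, rfl⟩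
    refine ⟨by simp, h2, ?_⟩
    rw [Finset.erase_insert]; simpa using h1
  · rintro ⟨h1, h2, h3⟩
    refine ⟨⟨?_, h2⟩, ?_⟩
    · intro h
      have : k ∈ Finset.univ.image f := by simpa using h
      rw [h3] at this; simp at this
    · rw [h3, Finset.insert_erase h1]

variable {B : Type*} [Ring B] [Algebra K B] {q : K} {x : Fin m → Fin n → B}

theorem mu_ofFn {t : ℕ} (c : Fin t → Fin n) (R : Finset (Fin m)) :
    mu q x (List.ofFn c) R = ∑ f : Fin t → Fin m,
      if Function.Injective f ∧ Finset.univ.image f = R then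
        (-q) ^ finv f • (List.ofFn fun k => x (f k) (c k)).prod else 0 := by
  classical
  induction t generalizing R with
  | zero =>
    rw [List.ofFn_zero, mu_nil, Fintype.sum_unique]
    have : finv (default : Fin 0 → Fin m) = 0 := by simp [finv]
    simp [this, Function.injective_of_subsingleton, eq_comm]
  | succ t ih =>
    rw [List.ofFn_succ, mu_cons, ← Fintype.sum_equiv (Fin.consEquiv (fun _ => Fin m)) 
      (fun p => if p.1 ∈ R ∧ Function.Injective p.2 ∧ Finset.univ.image p.2 = R.erase p.1 then
        (-q) ^ finv (Fin.cons p.1 p.2 : Fin (t + 1) → Fin m) •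
          (x p.1 (c 0) * (List.ofFn fun k : Fin t => x (p.2 k) (c k.succ)).prod) else 0) _ ?_]
    · rw [Fintype.sum_prod_type, ← Finset.sum_filter_add_sum_filter_not Finset.univ (· ∈ R)]
      rw [Finset.sum_eq_zero (s := Finset.univ.filter (¬ · ∈ R)), add_zero]
      · rw [Finset.filter_univ_mem]
        refine Finset.sum_congr rfl fun k hk => ?_
        rw [ih, Finset.mul_sum, Finset.smul_sum]
        refine Finset.sum_congr rfl fun f _ => ?_
        simp only [hk, true_and]
        split_ifs with h
        · rw [mul_smul_comm, smul_smul, ← pow_add, finv_cons]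
          congr 3
          have h1 : nlt (R.erase k) k = (Finset.univ.filter fun i => f i < k).card := by
            rw [← h.2, nlt, Finset.filter_image, Finset.card_image_of_injective _ h.1]
          have h2 := nlt_erase R k k hk
          simp at h2
          omega
        · simp
      · intro k hk
        simp at hk
        simp [hk]
    · rintro ⟨k, f⟩
      have := cons_inj_image k f R
      simp only [Fin.consEquiv_apply, Fin.consEquiv, Equiv.coe_fn_mk, this, List.ofFn_succ, Fin.cons_zero, Fin.cons_succ,
        List.prod_cons]

theorem qMinor_eq_mu (c : Fin m → Fin n) :
    qMinor K q m (fun i k => x i (c k)) = mu q x (List.ofFn c) Finset.univ := by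
  classical
  rw [mu_ofFn, qMinor, ← Finset.sum_filter]
  refine Finset.sum_bij (fun σ _ => (σ : Fin m → Fin m)) ?_ ?_ ?_ ?_
  · intro σ _
    simp [σ.injective, Finset.image_univ_of_surjective σ.surjective]
  · intro a _ b _ h; exact Equiv.coe_fn_injective h
  · intro f hf
    simp at hf
    exact ⟨Equiv.ofBijective f (Finite.injective_iff_bijective.1 hf.1), by simp, rfl⟩
  · intro σ _; rfl

theorem grMinor_eq_mu (js : List (Fin n)) (hs : js.Pairwise (· < ·)) (hl : js.length = m) :
    grMinor K q m js.toFinset = mu q (fun i j => X K q i j) js Finset.univ := by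
  have hnd : js.Nodup := hs.imp (fun h => ne_of_lt h)
  have hc : js.toFinset.card = m := by rw [List.toFinset_card_of_nodup hnd, hl]
  rw [grMinor, dif_pos hc, qMinor_eq_mu (x := fun i j => X K q i j)]
  congr 1
  subst hl
  have : js.get = js.toFinset.orderEmbOfFin hc := by
    apply Finset.orderEmbOfFin_unique
    · intro i; simp
    · intro i j hij
      exact List.pairwise_iff_get.1 hs i j hij
  rw [← this, List.ofFn_get]

end M0
end QG


namespace QG

section LMu
variable {K : Type*} [Field K] {q : K} {m n N : ℕ}

/-- Quantum minors of the generic matrix. -/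
noncomputable abbrev muX (K : Type*) [Field K] (q : K) (m n : ℕ) (js : List (Fin n))
    (R : Finset (Fin m)) : QMat K q m n := mu q (fun i j => X K q i j) js R

theorem Lent_tri (hq : q ≠ 0) (a : QMat K q m n) : ∀ i k : Fin m, i < k →
    Lent hq m n i k a = 0 := by
  let W : Submodule K (QMat K q m n) :=
    { carrier := {b | ∀ i k : Fin m, i < k → Lent hq m n i k b = 0}
      zero_mem' := by intro i k _; simp
      add_mem' := by
        intro a b ha hb i k h
        rw [map_add, ha i k h, hb i k h, add_zero]
      smul_mem' := by
        intro c a ha i k h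
        rw [map_smul, ha i k h, smul_zero] }
  refine left_induction W ?_ ?_ a
  · intro i k h
    rw [Lent_one, if_neg h.ne]
  · intro r j a ha i k h
    rw [Lent_rec, ha i k h]
    by_cases hr : r < i
    · rw [ha r k (hr.trans h)]; simp
    · simp [Tc, hr]

theorem Lent_mul (hq : q ≠ 0) (i k : Fin m) (a b : QMat K q m n) :
    Lent hq m n i k (a * b) = ∑ s, Lent hq m n i s a * Lent hq m n s k b := by
  simp only [Lent_apply, map_mul, Matrix.mul_apply]

theorem Lent_diag_X (hq : q ≠ 0) (i r : Fin m) (j : Fin n) (b : QMat K q m n) :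
    Lent hq m n i i (X K q r j * b) = Dc q i r • (X K q r j * Lent hq m n i i b) := by
  rw [Lent_rec]
  by_cases hr : r < i
  · rw [Lent_tri hq b r i hr]; simp
  · simp [Tc, hr]

theorem Lent_diag_mu (hq : q ≠ 0) (i : Fin m) (js : List (Fin n)) (R : Finset (Fin m)) :
    Lent hq m n i i (muX K q m n js R) = (if i ∈ R then q⁻¹ else 1) • muX K q m n js R := by
  induction js generalizing R with
  | nil =>
    simp only [muX, mu_nil]
    split_ifs with h1 h2 <;> simp_all [Lent_one]
  | cons j js ih =>
    simp only [muX] at ih ⊢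
    simp only [mu_cons, map_sum, map_smul, Lent_diag_X, ih, Finset.smul_sum]
    refine Finset.sum_congr rfl fun k hk => ?_
    rw [Algebra.mul_smul_comm, smul_smul, smul_smul, smul_smul]
    congr 1
    rw [Dc]
    by_cases h : i = k
    · subst h; simp [hk, mul_comm]
    · simp [h, mul_comm]

/-- adjacent lowering -/
theorem Lent_adj_X (hq : q ≠ 0) (i i' : Fin m) (hi : (i' : ℕ) = i + 1) (r : Fin m) (j : Fin n)
    (b : QMat K q m n) :
    Lent hq m n i' i (X K q r j * b) = Dc q i' r • (X K q r j * Lent hq m n i' i b) -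
      (if r = i then (q - q⁻¹) else 0) • (X K q i' j * Lent hq m n i i b) := by
  rw [Lent_rec]
  by_cases hr : r = i
  · subst hr
    have : r < i' := by rw [Fin.lt_def]; omega
    simp [Tc, this]
  · by_cases hr2 : r < i'
    · have : r < i := by
        rw [Fin.lt_def] at *; have := Fin.val_ne_of_ne hr; omega
      rw [Lent_tri hq b r i this]; simp [hr]
    · simp [Tc, hr, hr2]

theorem nlt_insert (R : Finset (Fin m)) (k r : Fin m) (hr : r ∉ R) :
    nlt (insert r R) k = nlt R k + (if r < k then 1 else 0) := by
  have := nlt_erase (insert r R) k r (by simp)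
  rw [Finset.erase_insert hr] at this
  exact this.symm

theorem adj_aux1 {B : Type*} [Ring B] [Algebra K B] (hq : q ≠ 0) (t : ℕ) (l : K) (a b c : B) :
    ((-q) ^ t • (c - l • (a * ((1 : K) • b))) +
      (-q) ^ (t + 1) • (q⁻¹ • (a * ((-l) • b)) - (0 : K) • a) = (-q) ^ t • c) := by
  simp only [smul_sub, smul_smul, mul_smul_comm, one_smul, zero_smul, sub_zero]
  have : (-q) ^ (t + 1) * (q⁻¹ * -l) = (-q) ^ t * l := by
    rw [pow_succ]; field_simp
  rw [this]; abel

theorem adj_aux2 {B : Type*} [Ring B] [Algebra K B] (t : ℕ) (l : K) (a b c : B) :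
    (-q) ^ t • ((0 : B) - l • (a * ((1 : K) • b))) = (-l) • ((-q) ^ t • (a * b)) := by
  rw [zero_sub, ← neg_smul, one_smul, smul_comm]

theorem adj_aux3 {B : Type*} [Ring B] [Algebra K B] (t : ℕ) (l : K) (a b c : B) :
    (-q) ^ t • ((1 : K) • (a * ((-l) • b)) - (0 : K) • c) = (-l) • ((-q) ^ t • (a * b)) := by
  rw [zero_smul, sub_zero, one_smul, mul_smul_comm, smul_comm]

theorem Lent_adj_mu (hq : q ≠ 0) (i i' : Fin m) (hi : (i' : ℕ) = i + 1)
    (js : List (Fin n)) (R : Finset (Fin m)) :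
    Lent hq m n i' i (muX K q m n js R) = (if i ∈ R ∧ i' ∉ R then -(q - q⁻¹) else 0) •
      muX K q m n js (insert i' (R.erase i)) := by
  have hne : i' ≠ i := by intro h; rw [h] at hi; omega
  induction js generalizing R with
  | nil =>
    simp only [muX, mu_nil]
    rw [if_neg (Finset.insert_ne_empty _ _), smul_zero]
    split_ifs with h1
    · rw [Lent_one, if_neg hne]
    · simp
  | cons j js ih =>
    simp only [muX] at ih ⊢
    have hdiag := fun R => Lent_diag_mu (K := K) hq i js R
    simp only [muX] at hdiag
    simp only [mu_cons, map_sum, map_smul, Lent_adj_X hq i i' hi, ih, hdiag]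
    by_cases h1 : i ∈ R
    swap
    · rw [if_neg (by tauto), zero_smul]
      refine Finset.sum_eq_zero fun k hk => ?_
      have : k ≠ i := by rintro rfl; exact h1 hk
      simp [h1, this]
    by_cases h2 : i' ∈ R
    · rw [if_neg (by tauto), zero_smul]
      rw [← Finset.add_sum_erase _ _ h1, ← Finset.add_sum_erase _ _
        (show i' ∈ R.erase i from Finset.mem_erase.2 ⟨hne, h2⟩), Finset.sum_eq_zero, add_zero]
      · have e1 : nlt R i' = nlt R i + 1 := by
          have hs : R.filter (· < i') = insert i (R.filter (· < i)) := by
            ext a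
            simp only [Finset.mem_filter, Finset.mem_insert, Fin.lt_def, Fin.ext_iff]
            constructor
            · rintro ⟨h, h'⟩
              by_cases h3 : (a : ℕ) = i
              · exact Or.inl h3
              · exact Or.inr ⟨h, by omega⟩
            · rintro (h | h)
              · rw [← Fin.ext_iff] at h; subst h; exact ⟨h1, by omega⟩
              · exact ⟨h.1, by omega⟩
          unfold nlt
          rw [hs, Finset.card_insert_of_notMem (by simp)]
        have e2 : insert i' ((R.erase i').erase i) = R.erase i := by
          ext a; simp only [Finset.mem_insert, Finset.mem_erase]
          by_cases h : a = i'
          · subst h; simp [hne, h2]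
          · simp [h]
        rw [e1, e2, if_neg (by simp), if_pos rfl, if_neg (by simp), if_neg hne,
          if_pos (by simp [h1, hne.symm]), Dc, Dc, if_neg hne, if_pos rfl, zero_smul, mul_zero,
          smul_zero, zero_smul]
        have := adj_aux1 hq (nlt R i) (q - q⁻¹) (X K q i' j)
          (mu q (fun i j => X K q i j) js (R.erase i)) 0
        rw [zero_smul, smul_zero] at this
        exact this
      · intro k hk
        simp only [Finset.mem_erase] at hk
        simp [hk, h2, hk.1.symm]
    · rw [if_pos ⟨h1, h2⟩, Finset.sum_insert (by simp [h2]), ← Finset.add_sum_erase _ _ h1,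
        smul_add, Finset.smul_sum]
      have hni : i' ∉ R.erase i := by simp [h2]
      congr 1
      · have e1 : nlt (insert i' (R.erase i)) i' = nlt R i := by
          rw [nlt_insert _ _ _ hni]
          have hs : (R.erase i).filter (· < i') = (R.filter (· < i)) := by
            ext a
            simp only [Finset.mem_filter, Finset.mem_erase, Fin.lt_def, Fin.ext_iff, ne_eq]
            constructor
            · rintro ⟨h, h'⟩
              exact ⟨h.2, by omega⟩
            · rintro h
              exact ⟨⟨by omega, h.1⟩, by omega⟩
          unfold nlt
          rw [hs]; simp
        rw [e1, Finset.erase_insert hni, if_neg (by simp), if_pos rfl, if_neg (by simp), zero_smul,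
          mul_zero, smul_zero]
        exact adj_aux2 _ _ _ _ 0
      · refine Finset.sum_congr rfl fun k hk => ?_
        rw [Finset.mem_erase] at hk
        have hki' : i' ≠ k := by rintro rfl; exact h2 hk.2
        have e1 : nlt (insert i' (R.erase i)) k = nlt R k := by
          rw [nlt_insert _ _ _ hni, ← nlt_erase R k i h1]
          congr 1
          have h3 := Fin.val_ne_of_ne hk.1
          have h4 := Fin.val_ne_of_ne hki'
          simp only [Fin.lt_def]
          split_ifs <;> omega
        have e2 : (insert i' (R.erase i)).erase k = insert i' ((R.erase k).erase i) := by
          rw [Finset.erase_insert_of_ne hki', Finset.erase_right_comm]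
        rw [e1, e2, if_neg hk.1, if_pos (by simp [h1, h2, hk.1.symm]), Dc, if_neg hki']
        exact adj_aux3 _ _ _ _ _

theorem ngt_rev (R : Finset (Fin m)) (k : Fin m) : ngt (R.image Fin.rev) k.rev = nlt R k := by
  unfold ngt nlt
  rw [Finset.filter_image, Finset.card_image_of_injective _ Fin.rev_injective]
  simp [Fin.rev_lt_rev]

theorem rho_mu (js : List (Fin n)) (R : Finset (Fin m)) :
    rho K q m n (muX K q m n js R) =
      muX K q m n (js.reverse.map Fin.rev) (R.image Fin.rev) := by
  induction js generalizing R with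
  | nil => simp [muX, mu_nil, apply_ite (rho K q m n)]
  | cons j js ih =>
    simp only [muX] at ih ⊢
    rw [mu_cons, List.reverse_cons, List.map_append, List.map_singleton, mu_concat,
      Finset.sum_image Fin.rev_injective.injOn, map_sum]
    refine Finset.sum_congr rfl fun k hk => ?_
    rw [map_smul, rho_mul, rho_X, ih, ngt_rev, Finset.image_erase Fin.rev_injective]

theorem zX0 (hq : q ≠ 0) (i k : Fin m) (hi : (i : ℕ) = 0) (j : Fin (N + 1)) :
    X K q i (Fin.last N) * X K q k j = ((if j = Fin.last N then q else 1) *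
      (if i = k then q⁻¹ else 1)) • (X K q k j * X K q i (Fin.last N)) := by
  by_cases hj : j = Fin.last N
  · subst hj
    rw [if_pos rfl]
    by_cases hk : i = k
    · subst hk; rw [if_pos rfl, mul_inv_cancel₀ hq, one_smul]
    · rw [if_neg hk, mul_one]
      exact isQM_X.col i k _ (by rw [Fin.lt_def]; have := Fin.val_ne_of_ne hk; omega)
  · rw [if_neg hj, one_mul]
    have := isQM_X.swap (K := K) hq k i j (Fin.last N) (Fin.lt_last_iff_ne_last.2 hj)
    rw [this, Tc, if_neg (by rw [Fin.lt_def]; omega), zero_smul, sub_zero, Dc]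

theorem z_aux {B : Type*} [Ring B] [Algebra K B] (c d e f : K) (z x y : B)
    (h1 : z * x = c • (x * z)) (h2 : z * y = d • (y * z)) (h : c * d = e) :
    z * (f • (x * y)) = e • (f • (x * y) * z) := by
  rw [mul_smul_comm, ← mul_assoc, h1, smul_mul_assoc, mul_assoc, h2, mul_smul_comm,
    smul_smul c d, h, smul_mul_assoc, smul_comm, mul_assoc]

theorem z0_mu (hq : q ≠ 0) (i : Fin m) (hi : (i : ℕ) = 0) (js : List (Fin (N + 1)))
    (R : Finset (Fin m)) :
    X K q i (Fin.last N) * muX K q m (N + 1) js R =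
      (q ^ js.count (Fin.last N) * (if i ∈ R then q⁻¹ else 1)) •
        (muX K q m (N + 1) js R * X K q i (Fin.last N)) := by
  induction js generalizing R with
  | nil =>
    simp only [muX, mu_nil]
    by_cases h : R = ∅
    · subst h; simp
    · simp [h]
  | cons j js ih =>
    simp only [muX] at ih ⊢
    simp only [mu_cons]
    rw [Finset.mul_sum, Finset.sum_mul, Finset.smul_sum]
    refine Finset.sum_congr rfl fun k hk => ?_
    refine z_aux _ _ _ _ _ _ _ (zX0 hq i k hi j) (ih (R.erase k)) ?_
    rw [List.count_cons]
    by_cases hj : j = Fin.last N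
    · subst hj
      by_cases hki : i = k
      · subst hki; simp [hk, pow_succ]; field_simp
      · simp [hki, pow_succ]; field_simp
    · by_cases hki : i = k
      · subst hki; simp [hk, hj, mul_comm]
      · simp [hki, hj]

theorem Lent_adj_self (hq : q ≠ 0) (i i' : Fin m) (hi : (i' : ℕ) = i + 1) (j : Fin n) :
    Lent hq m n i' i (X K q i j) = (-(q - q⁻¹)) • X K q i' j := by
  have := Lent_adj_X hq i i' hi i j 1
  have hne : i' ≠ i := by intro h; rw [h] at hi; omega
  rw [Lent_one, Lent_one, if_neg hne, if_pos rfl, if_pos rfl, mul_one, mul_one, mul_zero,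
    smul_zero, zero_sub] at this
  rw [this]
  exact (neg_smul (q - q⁻¹) (X K q i' j)).symm

theorem Lent_adj_mul (hq : q ≠ 0) (i i' : Fin m) (hi : (i' : ℕ) = i + 1)
    (a b : QMat K q m n) :
    Lent hq m n i' i (a * b) = Lent hq m n i' i a * Lent hq m n i i b +
      Lent hq m n i' i' a * Lent hq m n i' i b := by
  have hne : i ≠ i' := by intro h; rw [h] at hi; omega
  rw [Lent_mul]
  refine Finset.sum_eq_add i i' hne ?_ (by simp) (by simp)
  rintro c - ⟨h1, h2⟩
  have h1 := Fin.val_ne_of_ne h1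
  have h2 := Fin.val_ne_of_ne h2
  by_cases h : c < i
  · rw [Lent_tri hq b c i h, mul_zero]
  · rw [Lent_tri hq a i' c (by rw [Fin.lt_def] at *; omega), zero_mul]

theorem step_aux {B : Type*} [Ring B] [Algebra K B] (l r c : K) (hl : l ≠ 0) (hr : r ≠ 0)
    (z D : B) (h : (l • z) * (r • D) = c • ((r • D) * (l • z))) : z * D = c • (D * z) := by
  rw [smul_mul_smul_comm, smul_mul_smul_comm, smul_comm, mul_comm r l] at h
  exact smul_right_injective B (mul_ne_zero hl hr) h

theorem z_mu (hq : q ≠ 0) (hq2 : q ^ 2 ≠ 1) (js : List (Fin (N + 1))) (t : ℕ) :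
    ∀ i : Fin m, (i : ℕ) = t →
    X K q i (Fin.last N) * muX K q m (N + 1) js Finset.univ =
      (q ^ js.count (Fin.last N) * q⁻¹) •
        (muX K q m (N + 1) js Finset.univ * X K q i (Fin.last N)) := by
  induction t with
  | zero => intro i hi; simpa using z0_mu hq i hi js Finset.univ
  | succ t ih =>
    intro i' hi'
    have hlt : t < m := by have := i'.isLt; omega
    have h := congrArg (Lent hq m (N + 1) i' ⟨t, hlt⟩) (ih ⟨t, hlt⟩ rfl)
    have hE : Lent hq m (N + 1) i' ⟨t, hlt⟩ (muX K q m (N + 1) js Finset.univ) = 0 := by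
      rw [Lent_adj_mu hq ⟨t, hlt⟩ i' hi', if_neg (by simp), zero_smul]
    rw [map_smul, Lent_adj_mul hq ⟨t, hlt⟩ i' hi', Lent_adj_mul hq ⟨t, hlt⟩ i' hi', hE,
      Lent_adj_self hq ⟨t, hlt⟩ i' hi', Lent_diag_mu, Lent_diag_mu, mul_zero, zero_mul, add_zero,
      zero_add, if_pos (Finset.mem_univ _), if_pos (Finset.mem_univ _)] at h
    refine step_aux _ _ _ ?_ (inv_ne_zero hq) _ _ h
    rw [neg_ne_zero, sub_ne_zero]
    intro h; apply hq2; rw [pow_two]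
    nth_rewrite 1 [h]; exact inv_mul_cancel₀ hq

theorem w_mu (hq : q ≠ 0) (hq2 : q ^ 2 ≠ 1) (js : List (Fin (N + 1))) (i : Fin m) :
    muX K q m (N + 1) js Finset.univ * X K q i 0 =
      (q ^ js.count 0 * q⁻¹) • (X K q i 0 * muX K q m (N + 1) js Finset.univ) := by
  have h := congrArg (rho K q m (N + 1))
    (z_mu hq hq2 (js.reverse.map Fin.rev) _ i.rev rfl)
  rw [map_smul, rho_mul, rho_mul, rho_mu, rho_X, ← List.map_reverse, List.reverse_reverse,
    List.map_map, Fin.rev_last, Fin.rev_rev, Finset.image_univ_of_surjective Fin.rev_surjective]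
    at h
  have e1 : (Fin.rev ∘ Fin.rev : Fin (N + 1) → Fin (N + 1)) = id := by ext; simp
  have e2 : (js.reverse.map Fin.rev).count (Fin.last N) = js.count 0 := by
    rw [← Fin.rev_zero, List.count_map_of_injective _ _ Fin.rev_injective, List.count_reverse]
  rw [e1, List.map_id, e2] at h
  exact h

end LMu
end QG


namespace QG

section PsiMu
variable {K : Type*} [Field K] {q : K} {m n N : ℕ}

/-- scaling of the column algebra -/
noncomputable def gam (K : Type*) [Field K] (q : K) (m : ℕ) : QMat K q m 1 →ₐ[K] QMat K q m 1 :=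
  scaleMap q (fun _ => 1) (fun _ => q⁻¹)

/-- scaling of column zero -/
noncomputable def Gam (K : Type*) [Field K] (q : K) (m N : ℕ) :
    QMat K q m (N + 1) →ₐ[K] QMat K q m (N + 1) :=
  scaleMap q (fun _ => 1) (fun j => if j = 0 then q⁻¹ else 1)

theorem Gam_sA (b : QMat K q m N) : Gam K q m N (sA K q m N b) = sA K q m N b := by
  have : (Gam K q m N).comp (sA K q m N) = sA K q m N := by
    apply qalgHom_ext
    intro i j
    simp [Gam, Fin.succ_ne_zero]
  exact congrArg (fun f => f b) this

theorem Gam_wA (s : QMat K q m 1) : Gam K q m N (wA K q m N (kap K q m s)) =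
    wA K q m N (kap K q m (gam K q m s)) := by
  have : (Gam K q m N).comp ((wA K q m N).comp (kap K q m)) =
      (wA K q m N).comp ((kap K q m).comp (gam K q m)) := by
    apply qalgHom_ext
    intro i j
    simp [Gam, kap, gam, smul_smul, mul_comm]
  exact congrArg (fun f => f s) this

theorem zA_comm (c : QMat K q m 1 →ₐ[K] QMat K q m 1) (r : K)
    (hc : ∀ i, c (X K q i 0) = r • X K q i 0) (D : QMat K q m (N + 1))
    (h : ∀ i, X K q i (Fin.last N) * D = r • (D * X K q i (Fin.last N))) (s : QMat K q m 1) :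
    zA K q m N s * D = D * zA K q m N (c s) := by
  refine left_induction (LinearMap.eqLocus
    (LinearMap.mulRight K D ∘ₗ (zA K q m N).toLinearMap)
    (LinearMap.mulLeft K D ∘ₗ (zA K q m N).toLinearMap ∘ₗ c.toLinearMap)) ?_ ?_ s
  · simp [LinearMap.mem_eqLocus]
  · intro i j a ha
    simp only [LinearMap.mem_eqLocus, LinearMap.comp_apply, AlgHom.toLinearMap_apply,
      LinearMap.mulRight_apply, LinearMap.mulLeft_apply] at ha ⊢
    rw [map_mul, mul_assoc, ha, ← mul_assoc, zA_X, h, X_one_col, map_mul, hc, map_mul, map_smul,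
      zA_X, Algebra.smul_mul_assoc, Algebra.smul_mul_assoc, Algebra.mul_smul_comm, mul_assoc]

theorem Psi_mul_A (hq : q ≠ 0) (be : QMat K q m N)
    (h : ∀ i, X K q i (Fin.last N) * iA K q m N be =
      q⁻¹ • (iA K q m N be * X K q i (Fin.last N))) (f : QMat K q m (N + 1)) :
    Psi hq m N (f * iA K q m N be) = Gam K q m N (Psi hq m N f) * sA K q m N be := by
  have : Psi hq m N ∘ₗ LinearMap.mulRight K (iA K q m N be) =
      LinearMap.mulRight K (sA K q m N be) ∘ₗ (Gam K q m N).toLinearMap ∘ₗ Psi hq m N := by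
    apply normal_ext hq
    intro b s
    simp only [LinearMap.comp_apply, LinearMap.mulRight_apply, AlgHom.toLinearMap_apply]
    rw [Psi_apply, map_mul (Gam K q m N), Gam_sA, Gam_wA, mul_assoc,
      zA_comm (gam K q m) q⁻¹ (by intro i; simp [gam]) _ h, ← mul_assoc, ← map_mul,
      Psi_apply, map_mul, mul_assoc]
  exact congrArg (fun g => g f) this

theorem Psi_mul_B (hq : q ≠ 0) (c : Fin m → K) (g : Fin m → QMat K q m N)
    (D : QMat K q m (N + 1))
    (hD : D = ∑ k, c k • (iA K q m N (g k) * X K q k (Fin.last N)))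
    (h : ∀ i, X K q i (Fin.last N) * D = D * X K q i (Fin.last N)) (f : QMat K q m (N + 1)) :
    Psi hq m N (f * D) = ∑ k : Fin m, (c k * q ^ (2 * (k : ℕ))) •
      (X K q k 0 * Psi hq m N f * sA K q m N (g k)) := by
  have : Psi hq m N ∘ₗ LinearMap.mulRight K D =
      ∑ k : Fin m, (c k * q ^ (2 * (k : ℕ))) • 
        (LinearMap.mulRight K (sA K q m N (g k)) ∘ₗ LinearMap.mulLeft K (X K q k 0) ∘ₗ 
          Psi hq m N) := by
    apply normal_ext hq
    intro b s
    simp only [LinearMap.comp_apply, LinearMap.mulRight_apply, LinearMap.sum_apply,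
      LinearMap.smul_apply, LinearMap.mulLeft_apply]
    rw [mul_assoc, zA_comm (AlgHom.id K _) 1 (by intro i; simp) _ (by simpa using h), 
      AlgHom.id_apply, hD, Finset.sum_mul, Finset.mul_sum, map_sum]
    refine Finset.sum_congr rfl fun k _ => ?_
    rw [Algebra.smul_mul_assoc, Algebra.mul_smul_comm, map_smul]
    have e : iA K q m N b * (iA K q m N (g k) * X K q k (Fin.last N) * zA K q m N s) =
        iA K q m N (b * g k) * zA K q m N (X K q k 0 * s) := by
      simp [mul_assoc]
    rw [e, Psi_apply, Psi_apply, map_mul, map_mul, map_mul]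
    have e2 : kap K q m (X K q k 0) = q ^ (2 * (k : ℕ)) • X K q k 0 := by simp [kap]
    rw [e2, map_smul, wA_X, Algebra.smul_mul_assoc, Algebra.smul_mul_assoc, smul_smul]
    simp only [mul_assoc]
  have := congrArg (fun g => g f) this
  simpa [LinearMap.sum_apply] using this

theorem nlt_univ (k : Fin m) : nlt Finset.univ k = k := by
  simp [nlt, Finset.filter_gt_eq_Iio]

theorem ngt_univ (k : Fin m) : ngt Finset.univ k = m - 1 - k := by
  simp [ngt, Finset.filter_lt_eq_Ioi]

theorem iA_mu (I : List (Fin N)) (R) :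
    iA K q m N (muX K q m N I R) = muX K q m (N + 1) (I.map Fin.castSucc) R := by
  simp only [muX, mu_hom, mu_map, iA_X]

theorem sA_mu (I : List (Fin N)) (R) :
    sA K q m N (muX K q m N I R) = muX K q m (N + 1) (I.map Fin.succ) R := by
  simp only [muX, mu_hom, mu_map, sA_X]

theorem count_cs (I : List (Fin N)) : (I.map Fin.castSucc).count (Fin.last N) = 0 := by
  rw [List.count_eq_zero]; simp [Fin.castSucc_ne_last]

theorem Psi_mu_A (hq : q ≠ 0) (hq2 : q ^ 2 ≠ 1) (I : List (Fin N)) (f : QMat K q m (N + 1)) :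
    Psi hq m N (f * muX K q m (N + 1) (I.map Fin.castSucc) Finset.univ) =
      Gam K q m N (Psi hq m N f) * muX K q m (N + 1) (I.map Fin.succ) Finset.univ := by
  rw [← iA_mu, ← sA_mu]
  refine Psi_mul_A hq _ (fun i => ?_) f
  rw [iA_mu, z_mu hq hq2 _ _ i rfl, count_cs, pow_zero, one_mul]

theorem fin_aux {B : Type*} [Ring B] [Algebra K B] (c d y e : K) (w P g : B)
    (h : w * P = y • (P * w)) (hc : c = e * d) :
    c • (w * P * g) = (y * e) • (P * (d • (w * g))) := by
  rw [h, hc, smul_mul_assoc, mul_smul_comm, smul_smul, smul_smul, mul_assoc P w g]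
  congr 1; ring

theorem Psi_mu_B (hq : q ≠ 0) (hq2 : q ^ 2 ≠ 1) (I : List (Fin N)) (f : QMat K q m (N + 1))
    (y : K) (hy : ∀ i, X K q i 0 * Psi hq m N f = y • (Psi hq m N f * X K q i 0)) :
    Psi hq m N (f * muX K q m (N + 1) (I.map Fin.castSucc ++ [Fin.last N]) Finset.univ) =
      (y * (-q) ^ (m - 1)) •
        (Psi hq m N f * muX K q m (N + 1) (0 :: I.map Fin.succ) Finset.univ) := by
  rw [Psi_mul_B hq (fun k => (-q) ^ ngt Finset.univ k)
    (fun k => muX K q m N I (Finset.univ.erase k)) _ ?_ ?_ f]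
  · simp only [muX]
    rw [mu_cons, Finset.mul_sum, Finset.smul_sum]
    refine Finset.sum_congr rfl fun k _ => ?_
    have := sA_mu (K := K) (q := q) I (Finset.univ.erase k)
    simp only [muX] at this
    rw [this]
    refine fin_aux _ _ _ _ _ _ _ (hy k) ?_
    rw [nlt_univ, ngt_univ, pow_mul, ← neg_sq q, ← pow_mul, ← pow_add, ← pow_add]
    congr 1
    have := k.isLt
    omega
  · simp only [muX]
    rw [mu_concat]
    refine Finset.sum_congr rfl fun k _ => ?_
    have := iA_mu (K := K) (q := q) I (Finset.univ.erase k)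
    simp only [muX] at this
    rw [this]
  · intro i
    rw [z_mu hq hq2 _ _ i rfl, List.count_append, count_cs]
    simp [hq]

end PsiMu
end QG


namespace QG

section Fins
variable {K : Type*} [Field K] {q : K} {m n N : ℕ}

theorem fmod_castSucc (h : 0 < N + 1) (j : Fin N) :
    fmod (N + 1) h (j.castSucc.val + 1) = j.succ := by
  ext
  simp only [fmod, Fin.val_castSucc, Fin.val_succ]
  exact Nat.mod_eq_of_lt (by omega)

theorem fmod_last (h : 0 < N + 1) : fmod (N + 1) h ((Fin.last N).val + 1) = 0 := by
  ext; simp [fmod]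

/-- cyclic shift -/
abbrev sh (J : Finset (Fin (N + 1))) : Finset (Fin (N + 1)) := shiftSet (Nat.succ_pos N) J

theorem succ_mem_sh (J : Finset (Fin (N + 1))) (j : Fin N) : j.succ ∈ sh J ↔ j.castSucc ∈ J := by
  simp only [sh, shiftSet, Finset.mem_image]
  constructor
  · rintro ⟨a, ha, h⟩
    induction a using Fin.lastCases with
    | last => rw [fmod_last] at h; exact absurd h.symm (Fin.succ_ne_zero j)
    | cast a => rw [fmod_castSucc] at h; rw [← Fin.succ_injective _ h]; exact ha
  · intro h; exact ⟨_, h, fmod_castSucc _ _⟩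

theorem zero_mem_sh (J : Finset (Fin (N + 1))) : 0 ∈ sh J ↔ Fin.last N ∈ J := by
  simp only [sh, shiftSet, Finset.mem_image]
  constructor
  · rintro ⟨a, ha, h⟩
    induction a using Fin.lastCases with
    | last => exact ha
    | cast a => rw [fmod_castSucc] at h; exact absurd h (Fin.succ_ne_zero a)
  · intro h; exact ⟨_, h, fmod_last _⟩

theorem shift_inj : Function.Injective
    (fun a : Fin (N + 1) => fmod (N + 1) (Nat.succ_pos N) (a.val + 1)) := by
  intro a b h
  simp only at h
  induction a using Fin.lastCases with
  | last =>
    induction b using Fin.lastCases with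
    | last => rfl
    | cast b =>
      rw [fmod_last, fmod_castSucc] at h; exact absurd h.symm (Fin.succ_ne_zero b)
  | cast a =>
    induction b using Fin.lastCases with
    | last => rw [fmod_last, fmod_castSucc] at h; exact absurd h (Fin.succ_ne_zero a)
    | cast b => rw [fmod_castSucc, fmod_castSucc] at h; rw [Fin.succ_injective _ h]

theorem card_sh (J : Finset (Fin (N + 1))) : (sh J).card = J.card :=
  Finset.card_image_of_injective _ shift_inj

theorem sh_surj (J : Finset (Fin (N + 1))) : ∃ J', sh J' = J := by
  have hs := Finite.surjective_of_injective (shift_inj (N := N))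
  refine ⟨Finset.univ.filter fun a => fmod (N + 1) (Nat.succ_pos N) (a.val + 1) ∈ J, ?_⟩
  ext b
  obtain ⟨a, rfl⟩ := hs b
  simp only [sh, shiftSet, Finset.mem_image, Finset.mem_filter, Finset.mem_univ, true_and]
  constructor
  · rintro ⟨c, h1, h2⟩; rwa [h2] at h1
  · intro h; exact ⟨a, h, rfl⟩

/-- the list of elements of `J` other than the last -/
def lst (J : Finset (Fin (N + 1))) : List (Fin N) :=
  (Finset.univ.filter fun j : Fin N => j.castSucc ∈ J).sort

theorem mem_lst (J : Finset (Fin (N + 1))) (j : Fin N) : j ∈ lst J ↔ j.castSucc ∈ J := by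
  simp [lst]

theorem lst_lt (J : Finset (Fin (N + 1))) : (lst J).Pairwise (· < ·) :=
  (Finset.sortedLT_sort _).pairwise

theorem grA (J : Finset (Fin (N + 1))) (hJ : J.card = m) (hl : Fin.last N ∉ J) :
    grMinor K q m J = muX K q m (N + 1) ((lst J).map Fin.castSucc) Finset.univ ∧
    grMinor K q m (sh J) = muX K q m (N + 1) ((lst J).map Fin.succ) Finset.univ := by
  have e1 : ((lst J).map Fin.castSucc).toFinset = J := by
    ext a
    induction a using Fin.lastCases with
    | last => simp [hl, Fin.castSucc_ne_last]
    | cast a => simp [mem_lst]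
  have e2 : ((lst J).map Fin.succ).toFinset = sh J := by
    ext a
    induction a using Fin.cases with
    | zero => simp [zero_mem_sh, hl, Fin.succ_ne_zero]
    | succ a => simp [mem_lst, succ_mem_sh]
  have p1 : ((lst J).map Fin.castSucc).Pairwise (· < ·) :=
    List.pairwise_map.2 ((lst_lt J).imp fun h => Fin.castSucc_lt_castSucc_iff.2 h)
  have p2 : ((lst J).map Fin.succ).Pairwise (· < ·) :=
    List.pairwise_map.2 ((lst_lt J).imp fun h => Fin.succ_lt_succ_iff.2 h)
  have l1 : ((lst J).map Fin.castSucc).length = m := by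
    rw [← List.toFinset_card_of_nodup (p1.imp fun h => ne_of_lt h), e1, hJ]
  constructor
  · have := grMinor_eq_mu (K := K) (q := q) _ p1 l1; rwa [e1] at this
  · have := grMinor_eq_mu (K := K) (q := q) _ p2 (by simpa using l1); rwa [e2] at this

theorem grB (J : Finset (Fin (N + 1))) (hJ : J.card = m) (hl : Fin.last N ∈ J) :
    grMinor K q m J =
      muX K q m (N + 1) ((lst J).map Fin.castSucc ++ [Fin.last N]) Finset.univ ∧
    grMinor K q m (sh J) = muX K q m (N + 1) (0 :: (lst J).map Fin.succ) Finset.univ := by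
  have e1 : ((lst J).map Fin.castSucc ++ [Fin.last N]).toFinset = J := by
    ext a
    induction a using Fin.lastCases with
    | last => simp [hl]
    | cast a => simp [mem_lst, Fin.castSucc_ne_last]
  have e2 : (0 :: (lst J).map Fin.succ).toFinset = sh J := by
    ext a
    induction a using Fin.cases with
    | zero => simp [zero_mem_sh, hl]
    | succ a => simp [mem_lst, succ_mem_sh, Fin.succ_ne_zero]
  have p1 : ((lst J).map Fin.castSucc ++ [Fin.last N]).Pairwise (· < ·) := by
    rw [List.pairwise_append]
    refine ⟨List.pairwise_map.2 ((lst_lt J).imp fun h => Fin.castSucc_lt_castSucc_iff.2 h),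
      List.pairwise_singleton _ _, ?_⟩
    intro a ha b hb
    rw [List.mem_singleton] at hb; subst hb
    obtain ⟨c, -, rfl⟩ := List.mem_map.1 ha
    exact Fin.castSucc_lt_last c
  have p2 : (0 :: (lst J).map Fin.succ).Pairwise (· < ·) := by
    rw [List.pairwise_cons]
    refine ⟨?_, List.pairwise_map.2 ((lst_lt J).imp fun h => Fin.succ_lt_succ_iff.2 h)⟩
    intro a ha
    obtain ⟨c, -, rfl⟩ := List.mem_map.1 ha
    exact Fin.succ_pos c
  have l1 : ((lst J).map Fin.castSucc ++ [Fin.last N]).length = m := by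
    rw [← List.toFinset_card_of_nodup (p1.imp fun h => ne_of_lt h), e1, hJ]
  constructor
  · have := grMinor_eq_mu (K := K) (q := q) _ p1 l1; rwa [e1] at this
  · have := grMinor_eq_mu (K := K) (q := q) _ p2 (by simpa using l1); rwa [e2] at this

theorem Gam_mu (js : List (Fin (N + 1))) (R) :
    Gam K q m N (muX K q m (N + 1) js R) = (q⁻¹) ^ js.count 0 • muX K q m (N + 1) js R := by
  induction js generalizing R with
  | nil => simp [muX, mu_nil, apply_ite (Gam K q m N)]
  | cons j js ih =>
    simp only [muX] at ih ⊢
    simp only [mu_cons, map_sum, map_smul, map_mul, ih, Finset.smul_sum]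
    refine Finset.sum_congr rfl fun k _ => ?_
    rw [show Gam K q m N (X K q k j) = (if j = 0 then q⁻¹ else 1) • X K q k j by simp [Gam],
      Algebra.smul_mul_assoc, Algebra.mul_smul_comm, smul_smul, smul_smul, smul_smul,
      List.count_cons]
    congr 1
    by_cases hj : j = 0
    · subst hj; simp [pow_succ]; ring
    · simp [hj, mul_comm]

theorem gr_list (J : Finset (Fin n)) (hJ : J.card = m) :
    grMinor K q m J = muX K q m n J.sort Finset.univ := by
  have := grMinor_eq_mu (K := K) (q := q) _ (Finset.sortedLT_sort J).pairwise (by simpa using hJ)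
  rwa [Finset.sort_toFinset] at this

theorem count_sort (J : Finset (Fin n)) (a : Fin n) : J.sort.count a = if a ∈ J then 1 else 0 := by
  rw [List.Nodup.count (Finset.sort_nodup J _)]; simp

theorem Gam_gr (J : Finset (Fin (N + 1))) (hJ : J.card = m) :
    Gam K q m N (grMinor K q m J) = (if 0 ∈ J then q⁻¹ else 1) • grMinor K q m J := by
  rw [gr_list J hJ, Gam_mu, count_sort]
  split_ifs <;> simp

theorem w_aux {B : Type*} [Ring B] [Algebra K B] (c d : K) (z x : B)
    (h1 : x * z = c • (z * x)) (h : d * c = 1) : z * x = d • (x * z) := by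
  rw [h1, smul_smul, h, one_smul]

theorem w_gr (hq : q ≠ 0) (hq2 : q ^ 2 ≠ 1) (J : Finset (Fin (N + 1))) (hJ : J.card = m)
    (i : Fin m) :
    X K q i 0 * grMinor K q m J = (if 0 ∈ J then 1 else q) • (grMinor K q m J * X K q i 0) := by
  rw [gr_list J hJ]
  refine w_aux _ _ _ _ (w_mu hq hq2 _ i) ?_
  rw [count_sort]
  split_ifs <;> simp [hq]

/-- monomials in the quantum minors -/
noncomputable def mon (K : Type*) [Field K] (q : K) (m : ℕ) {n : ℕ} (Js : List (Finset (Fin n))) :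
    QMat K q m n := (Js.map (grMinor K q m)).prod

/-- number of factors containing the last index -/
def nl (Js : List (Finset (Fin (N + 1)))) : ℕ := Js.countP (fun J => decide (Fin.last N ∈ J))

theorem nl_append (Js : List (Finset (Fin (N + 1)))) (J) :
    nl (Js ++ [J]) = nl Js + if Fin.last N ∈ J then 1 else 0 := by
  simp [nl, List.countP_append, List.countP_singleton]

theorem nl_cons (Js : List (Finset (Fin (N + 1)))) (J) :
    nl (J :: Js) = nl Js + if Fin.last N ∈ J then 1 else 0 := by
  simp [nl, List.countP_cons]

theorem Gam_mon (Js : List (Finset (Fin (N + 1)))) (h : ∀ J ∈ Js, J.card = m) :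
    Gam K q m N (mon K q m (Js.map sh)) = q⁻¹ ^ nl Js • mon K q m (Js.map sh) := by
  induction Js with
  | nil => simp [mon, nl]
  | cons J Js ih =>
    have ih := ih fun J hJ => h J (List.mem_cons_of_mem _ hJ)
    have e : mon K q m ((J :: Js).map sh) = grMinor K q m (sh J) * mon K q m (Js.map sh) := by
      simp [mon]
    rw [e, map_mul, ih, Gam_gr _ ((card_sh J).trans (h J (by simp))), smul_mul_smul_comm,
      nl_cons]
    congr 1
    simp only [zero_mem_sh]
    split_ifs <;> simp [pow_succ, mul_comm]

theorem w_mon_aux {B : Type*} [Ring B] [Algebra K B] (c d : K) (z x y : B)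
    (h1 : z * x = c • (x * z)) (h2 : z * y = d • (y * z)) :
    z * (x * y) = (c * d) • (x * y * z) := by
  have := z_aux c d (c * d) (1 : K) z x y h1 h2 rfl
  simpa using this

theorem w_mon (hq : q ≠ 0) (hq2 : q ^ 2 ≠ 1) (Js : List (Finset (Fin (N + 1))))
    (h : ∀ J ∈ Js, J.card = m) (i : Fin m) :
    X K q i 0 * mon K q m (Js.map sh) =
      q ^ ((Js.length : ℤ) - nl Js) • (mon K q m (Js.map sh) * X K q i 0) := by
  induction Js with
  | nil => simp [mon, nl]
  | cons J Js ih =>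
    have ih := ih fun J hJ => h J (List.mem_cons_of_mem _ hJ)
    have e : mon K q m ((J :: Js).map sh) = grMinor K q m (sh J) * mon K q m (Js.map sh) := by
      simp [mon]
    rw [e, w_mon_aux _ _ _ _ _ (w_gr hq hq2 _ ((card_sh J).trans (h J (by simp))) i) ih, nl_cons]
    congr 1
    simp only [zero_mem_sh, List.length_cons]
    split_ifs
    · rw [one_mul]; congr 1; push_cast; ring
    · rw [← zpow_one_add₀ hq]; congr 1; push_cast; ring

theorem Psi_step (hq : q ≠ 0) (hq2 : q ^ 2 ≠ 1) (Js : List (Finset (Fin (N + 1))))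
    (h : ∀ J ∈ Js, J.card = m) (J : Finset (Fin (N + 1))) (hJ : J.card = m) (cf : K)
    (hcf : Psi hq m N (mon K q m Js) = cf • mon K q m (Js.map sh)) :
    Psi hq m N (mon K q m (Js ++ [J])) =
      (cf * (if Fin.last N ∈ J then q ^ ((Js.length : ℤ) - nl Js) * (-q) ^ (m - 1)
        else q⁻¹ ^ nl Js)) • mon K q m ((Js ++ [J]).map sh) := by
  have e1 : mon K q m (Js ++ [J]) = mon K q m Js * grMinor K q m J := by simp [mon]
  have e2 : mon K q m ((Js ++ [J]).map sh) = mon K q m (Js.map sh) * grMinor K q m (sh J) := by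
    simp [mon]
  rw [e1, e2]
  by_cases hl : Fin.last N ∈ J
  · obtain ⟨h1, h2⟩ := grB (K := K) (q := q) J hJ hl
    rw [h1, h2, Psi_mu_B hq hq2 _ _ (q ^ ((Js.length : ℤ) - nl Js)), hcf, if_pos hl,
      Algebra.smul_mul_assoc, smul_smul, mul_comm cf]
    intro i
    rw [hcf, Algebra.mul_smul_comm, Algebra.smul_mul_assoc, w_mon hq hq2 Js h i, smul_comm]
  · obtain ⟨h1, h2⟩ := grA (K := K) (q := q) J hJ hl
    rw [h1, h2, Psi_mu_A hq hq2, hcf, if_neg hl, map_smul, Gam_mon Js h,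
      smul_smul, Algebra.smul_mul_assoc]

end Fins
end QG


namespace QG

section Scalars
variable {K : Type*} [Field K] {q p : K} {m N : ℕ}

/-- total content -/
def cont {n : ℕ} (Js : List (Finset (Fin n))) : Fin n → ℤ := (Js.map contentOf).sum

/-- the diagonal weight in terms of number of factors -/
noncomputable def lamN (q p : K) (m : ℕ) (s d : ℤ) : K :=
  q ^ (-(s * d)) * (q⁻¹ * ((-q) ^ (m - 1))⁻¹) ^ s * p ^ (s * (s - 1) / 2)

/-- the diagonal weight -/
noncomputable def lam (q p : K) (m : ℕ) (t : Fin (N + 1) → ℤ) : K :=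
  lamN q p m (t (Fin.last N)) ((∑ j, t j) / m)

/-- the scalars of the isomorphism -/
noncomputable def nuJ (q : K) (J : Finset (Fin (N + 1))) : K :=
  if Fin.last N ∈ J then q ^ (-2 : ℤ) else 1

theorem lamN_ne (hq : q ≠ 0) (hp : p ≠ 0) (s d : ℤ) : lamN q p m s d ≠ 0 := by
  unfold lamN
  have : (-q) ^ (m - 1) ≠ 0 := pow_ne_zero _ (neg_ne_zero.2 hq)
  exact mul_ne_zero (mul_ne_zero (zpow_ne_zero _ hq)
    (zpow_ne_zero _ (mul_ne_zero (inv_ne_zero hq) (inv_ne_zero this)))) (zpow_ne_zero _ hp)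

theorem cont_append {n : ℕ} (Js : List (Finset (Fin n))) (J) :
    cont (Js ++ [J]) = cont Js + contentOf J := by
  simp [cont]

theorem cont_last (Js : List (Finset (Fin (N + 1)))) : cont Js (Fin.last N) = nl Js := by
  induction Js using List.reverseRecOn with
  | nil => simp [cont, nl]
  | append_singleton Js J ih =>
    rw [cont_append, Pi.add_apply, ih, nl_append, contentOf]; push_cast; rfl

theorem sum_contentOf {n : ℕ} (J : Finset (Fin n)) : ∑ j, contentOf J j = J.card := by
  simp [contentOf]

theorem cont_sum {n : ℕ} (Js : List (Finset (Fin n))) (h : ∀ J ∈ Js, J.card = m) :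
    ∑ j, cont Js j = m * Js.length := by
  induction Js using List.reverseRecOn with
  | nil => simp [cont]
  | append_singleton Js J ih =>
    simp only [cont_append, Pi.add_apply, Finset.sum_add_distrib]
    rw [ih fun J hJ => h J (List.mem_append_left _ hJ), sum_contentOf, h J (by simp)]
    simp only [List.length_append, List.length_singleton]; push_cast; ring

theorem lam_cont (hm : 0 < m) (Js : List (Finset (Fin (N + 1)))) (h : ∀ J ∈ Js, J.card = m) :
    lam q p m (cont Js) = lamN q p m (nl Js) Js.length := by
  rw [lam, cont_last, cont_sum Js h, Int.mul_ediv_cancel_left _ (by exact_mod_cast hm.ne')]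

theorem cmap_eq_s17 (hp : p ≠ 0) (h0 : 0 < N + 1) (s t : Fin (N + 1) → ℤ) :
    cmap K h0 p s t = p ^ (s (Fin.last N) * (∑ j, t j - t (Fin.last N))) := by
  have hl : lastIdx (N + 1) h0 = Fin.last N := rfl
  have key : ∀ (S : Finset (Fin (N + 1))) (a : ℤ),
      ∏ j ∈ S, p ^ (a * t j) = p ^ (a * ∑ j ∈ S, t j) := by
    intro S a
    induction S using Finset.induction_on with
    | empty => simp
    | insert x S hx ih => rw [Finset.prod_insert hx, Finset.sum_insert hx, ih, mul_add,
        zpow_add₀ hp]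
  rw [cmap, hl, key]
  congr 2
  rw [Finset.filter_ne', ← Finset.add_sum_erase _ _ (Finset.mem_univ (Fin.last N))]
  ring

theorem lamN_step0 (hq : q ≠ 0) (s d : ℤ) :
    lamN q p m s (d + 1) = lamN q p m s d * q ^ (-s) := by
  unfold lamN
  rw [show -(s * (d + 1)) = -(s * d) + -s by ring, zpow_add₀ hq]; ring

theorem lamN_step1 (hq : q ≠ 0) (hp : p ≠ 0) (s d : ℤ) :
    lamN q p m (s + 1) (d + 1) = lamN q p m s d * (q ^ (-s - d - 1) *
      (q⁻¹ * ((-q) ^ (m - 1))⁻¹) * p ^ s) := by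
  unfold lamN
  have h3 : (-q) ^ (m - 1) ≠ 0 := pow_ne_zero _ (neg_ne_zero.2 hq)
  have h1 : (s + 1) * (s + 1 - 1) / 2 = s * (s - 1) / 2 + s := by
    rw [show (s + 1) * (s + 1 - 1) = s * (s - 1) + s * 2 by ring,
      Int.add_mul_ediv_right _ _ (by norm_num)]
  rw [show -((s + 1) * (d + 1)) = -(s * d) + (-s - d - 1) by ring, zpow_add₀ hq, h1,
    zpow_add₀ hp, zpow_add_one₀ (mul_ne_zero (inv_ne_zero hq) (inv_ne_zero h3))]
  ring

theorem scal0 (hq : q ≠ 0) (hpm : p ^ m = q ^ 2) (s : ℕ) (d : ℤ) (C cf nu : K)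
    (h : C * lamN q p m s d * cf = nu) :
    (C * p ^ ((s : ℤ) * m)) * lamN q p m s (d + 1) * (cf * q⁻¹ ^ s) = nu := by
  rw [lamN_step0 hq, ← h, mul_comm (s : ℤ), zpow_mul, zpow_natCast, zpow_natCast, hpm]
  rw [zpow_neg, zpow_natCast, inv_pow, ← pow_mul, mul_comm 2, pow_mul]
  have := pow_ne_zero s hq
  field_simp

theorem scal1 (hq : q ≠ 0) (hp : p ≠ 0) (hpm : p ^ m = q ^ 2) (s : ℕ) (d : ℤ) (C cf nu : K)
    (h : C * lamN q p m s d * cf = nu) :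
    (C * p ^ ((s : ℤ) * (m - 1))) * lamN q p m (s + 1) (d + 1) *
      (cf * (q ^ (d - s) * (-q) ^ (m - 1))) = nu * q ^ (-2 : ℤ) := by
  rw [lamN_step1 hq hp, ← h, show (s : ℤ) * (m - 1) = m * s + -s by ring, zpow_add₀ hp, zpow_mul,
    zpow_natCast, zpow_natCast, hpm, ← pow_mul, show -(s : ℤ) - d - 1 = - s - (d + 1) by ring,
    zpow_sub₀ hq, zpow_sub₀ hq, zpow_add₀ hq, zpow_neg, zpow_neg, zpow_neg, zpow_natCast,
    zpow_natCast, mul_comm 2, pow_mul]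
  have h3 : (-q) ^ (m - 1) ≠ 0 := pow_ne_zero _ (neg_ne_zero.2 hq)
  generalize (-q) ^ (m - 1) = y at *
  have h1 := pow_ne_zero s hq
  have h2 := pow_ne_zero s hp
  have h4 := zpow_ne_zero d hq
  generalize q ^ d = u at *
  rw [zpow_one, show (q : K) ^ (2 : ℤ) = q ^ 2 from zpow_natCast q 2]
  field_simp

end Scalars
end QG


namespace QG

section Lam
variable {K : Type*} [Field K] {G : Type*} [Semiring G] [Algebra K G] {ι : Type*} [DecidableEq ι]
  [AddMonoid ι] (𝒜 : ι → Submodule K G) [GradedAlgebra 𝒜]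

/-- diagonal operators on graded algebras -/
noncomputable def Lam (l : ι → K) : G →ₗ[K] G :=
  DirectSum.toModule K ι G (fun t => l t • (𝒜 t).subtype) ∘ₗ
    (DirectSum.decomposeLinearEquiv 𝒜).toLinearMap

theorem Lam_of_mem (l : ι → K) {t : ι} {a : G} (ha : a ∈ 𝒜 t) : Lam 𝒜 l a = l t • a := by
  simp only [Lam, LinearMap.comp_apply, LinearEquiv.coe_coe,
    DirectSum.decomposeLinearEquiv_apply]
  rw [DirectSum.decompose_of_mem 𝒜 ha]
  erw [DirectSum.toModule_lof]
  simp

theorem Lam_inj (l : ι → K) (hl : ∀ t, l t ≠ 0) : Function.Injective (Lam 𝒜 l) := by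
  apply Function.LeftInverse.injective (g := Lam 𝒜 fun t => (l t)⁻¹)
  intro a
  induction a using DirectSum.Decomposition.inductionOn 𝒜 with
  | zero => simp
  | homogeneous a => 
    rw [Lam_of_mem 𝒜 l a.2, map_smul, Lam_of_mem 𝒜 _ a.2, smul_smul, mul_inv_cancel₀ (hl _),
      one_smul]
  | add a b ha hb => rw [map_add, map_add, ha, hb]

end Lam

section Final
variable {K : Type*} [Field K] {q p : K} {m n N : ℕ}

/-- monomials in the quantum grassmannian -/
noncomputable def monE (K : Type*) [Field K] (q : K) (m : ℕ) {n : ℕ}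
    (Js : List (Finset (Fin n))) : ↥(qGrass K q m n) := (Js.map (grE K q m)).prod

theorem monE_coe (Js : List (Finset (Fin n))) :
    ((monE K q m Js : ↥(qGrass K q m n)) : QMat K q m n) = mon K q m Js := by
  rw [monE, mon]
  have := map_list_prod (qGrass K q m n).val (Js.map (grE K q m))
  rw [List.map_map] at this
  exact this

theorem monE_span (a : ↥(qGrass K q m n)) : a ∈ Submodule.span K
    {b | ∃ Js : List (Finset (Fin n)), (∀ J ∈ Js, J.card = m) ∧ b = monE K q m Js} := by
  have h1 : (a : QMat K q m n) ∈ Submodule.span K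
      {b | ∃ Js : List (Finset (Fin n)), (∀ J ∈ Js, J.card = m) ∧ b = mon K q m Js} := by
    have ha : (a : QMat K q m n) ∈ Subalgebra.toSubmodule (Algebra.adjoin K (grGenSet K q m n)) :=
      a.2
    rw [Algebra.adjoin_eq_span] at ha
    refine (Submodule.span_le.2 ?_) ha
    intro b hb
    obtain ⟨l, hl, rfl⟩ := Submonoid.exists_list_of_mem_closure hb
    have : ∃ Js : List (Finset (Fin n)), l = Js.map (grMinor K q m) := by
      clear hb
      induction l with
      | nil => exact ⟨[], rfl⟩
      | cons x l ih =>
        obtain ⟨Js, rfl⟩ := ih fun y hy => hl y (List.mem_cons_of_mem _ hy)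
        obtain ⟨J, rfl⟩ := hl x (by simp)
        exact ⟨J :: Js, rfl⟩
    obtain ⟨Js, rfl⟩ := this
    by_cases h : ∀ J ∈ Js, J.card = m
    · exact Submodule.subset_span ⟨Js, h, rfl⟩
    · push Not at h
      obtain ⟨J, hJ, hc⟩ := h
      have : (Js.map (grMinor K q m)).prod = 0 := by
        apply List.prod_eq_zero
        rw [List.mem_map]
        exact ⟨J, hJ, by rw [grMinor, dif_neg hc]⟩
      rw [this]; exact Submodule.zero_mem _
  have h2 : Submodule.span K
      {b | ∃ Js : List (Finset (Fin n)), (∀ J ∈ Js, J.card = m) ∧ b = mon K q m Js} =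
      (Submodule.span K {b | ∃ Js : List (Finset (Fin n)), (∀ J ∈ Js, J.card = m) ∧
        b = monE K q m Js}).map (qGrass K q m n).val.toLinearMap := by
    rw [Submodule.map_span]
    congr 1
    ext b
    constructor
    · rintro ⟨Js, h, rfl⟩; exact ⟨_, ⟨Js, h, rfl⟩, monE_coe Js⟩
    · rintro ⟨_, ⟨Js, h, rfl⟩, rfl⟩; exact ⟨Js, h, monE_coe Js⟩
  rw [h2] at h1
  obtain ⟨b, hb, hba⟩ := h1
  have : b = a := Subtype.ext hba
  rwa [← this]

theorem tau_one {G : Type*} [Ring G] [Algebra K G]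
    (𝒜 : (Fin n → ℤ) → Submodule K G) [GradedAlgebra 𝒜]
    (c : (Fin n → ℤ) → (Fin n → ℤ) → K) (hc : ∀ t, c 0 t = 1)
    {T : Type*} [Ring T] [Algebra K T]
    (tw : CocycleTwist K G 𝒜 c T) : tw.τ 1 = 1 := by
  have h : ∀ a, tw.τ 1 * tw.τ a = tw.τ a := by
    intro a
    induction a using DirectSum.Decomposition.inductionOn 𝒜 with
    | zero => simp
    | homogeneous a =>
      rw [tw.mul_tw 0 _ 1 a SetLike.GradedOne.one_mem a.2, hc, one_mul, one_smul]
    | add a b ha hb => rw [map_add, mul_add, ha, hb]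
  obtain ⟨a, ha⟩ := tw.τ.surjective 1
  have := h a
  rwa [ha, mul_one] at this

set_option maxHeartbeats 1000000 in
theorem key (hq : q ≠ 0) (hq2 : q ^ 2 ≠ 1) (hp : p ≠ 0) (hm : 0 < m) (hpm : p ^ m = q ^ 2)
    (h0 : 0 < N + 1)
    (𝒜 : (Fin (N + 1) → ℤ) → Submodule K ↥(qGrass K q m (N + 1))) [GradedAlgebra 𝒜]
    (hhom : ∀ J : Finset (Fin (N + 1)), J.card = m → grE K q m J ∈ 𝒜 (contentOf J))
    {T : Type*} [Ring T] [Algebra K T]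
    (tw : CocycleTwist K (↥(qGrass K q m (N + 1))) 𝒜 (cmap K h0 p) T)
    (Js : List (Finset (Fin (N + 1)))) (h : ∀ J ∈ Js, J.card = m) :
    monE K q m Js ∈ 𝒜 (cont Js) ∧ ∃ C cf : K, C ≠ 0 ∧
      (Js.map fun J => tw.τ (grE K q m J)).prod = C • tw.τ (monE K q m Js) ∧
      Psi hq m N (mon K q m Js) = cf • mon K q m (Js.map sh) ∧
      C * lamN q p m (nl Js) Js.length * cf = (Js.map (nuJ q)).prod := by
  induction Js using List.reverseRecOn with
  | nil =>
    refine ⟨?_, 1, 1, one_ne_zero, ?_, ?_, ?_⟩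
    · simp only [monE, cont, List.map_nil, List.prod_nil, List.sum_nil]
      exact SetLike.GradedOne.one_mem
    · have hc0 : ∀ t, cmap K h0 p 0 t = 1 := fun t => by rw [cmap_eq_s17 hp]; simp
      have := tau_one (K := K) (n := N + 1) (G := ↥(qGrass K q m (N + 1))) 𝒜 (cmap K h0 p) hc0 tw
      simp only [monE, List.map_nil, List.prod_nil, one_smul]
      exact this.symm
    · simp [mon, Psi_one]
    · simp [nl, lamN]
  | append_singleton Js J ih =>
    have hJ : J.card = m := h J (by simp)
    have hJs : ∀ J ∈ Js, J.card = m := fun J hJ => h J (List.mem_append_left _ hJ)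
    obtain ⟨hmem, C, cf, hC, h1, h2, h3⟩ := ih hJs
    have e1 : monE K q m (Js ++ [J]) = monE K q m Js * grE K q m J := by simp [monE]
    have hc : cmap K h0 p (cont Js) (contentOf J) =
        p ^ ((nl Js : ℤ) * (m - if Fin.last N ∈ J then 1 else 0)) := by
      rw [cmap_eq_s17 hp, cont_last, sum_contentOf, hJ]; rfl
    refine ⟨?_, C * cmap K h0 p (cont Js) (contentOf J), _, ?_, ?_, Psi_step hq hq2 Js hJs J hJ cf h2, ?_⟩
    · rw [e1, cont_append]
      exact SetLike.GradedMul.mul_mem hmem (hhom J hJ)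
    · rw [hc]; exact mul_ne_zero hC (zpow_ne_zero _ hp)
    · rw [List.map_append, List.prod_append, h1, List.map_singleton, List.prod_singleton,
        smul_mul_assoc, tw.mul_tw _ _ _ _ hmem (hhom J hJ), smul_smul, e1]
    · rw [hc, nl_append, List.map_append, List.prod_append, List.map_singleton,
        List.prod_singleton, List.length_append, List.length_singleton]
      by_cases hl : Fin.last N ∈ J
      · simp only [hl, if_true, nuJ]
        have := scal1 hq hp hpm (nl Js) Js.length C cf _ h3
        push_cast
        exact this
      · simp only [hl, if_false, nuJ]
        have := scal0 hq hpm (nl Js) Js.length C cf _ h3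
        push_cast
        rw [sub_zero, add_zero, mul_one]
        exact this

theorem list_smul_prod {B : Type*} [Semiring B] [Algebra K B] {α : Type*} (c : α → K) (f : α → B)
    (l : List α) : (l.map fun x => c x • f x).prod = (l.map c).prod • (l.map f).prod := by
  induction l with
  | nil => simp
  | cons x l ih => simp [ih, smul_smul, mul_comm]

theorem final_abs {A : Type*} [Semiring A] [Algebra K A] {T : Type*} [Semiring T] [Algebra K T]
    {α : Type*} (S : Subalgebra K A) (P : α → Prop) (tg : α → T) (ag : α → A) (t0 : T →ₗ[K] A)
    (t0_inj : Function.Injective t0)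
    (t0_mon : ∀ Js : List α, (∀ J ∈ Js, P J) → t0 (Js.map tg).prod = (Js.map ag).prod)
    (tspan : ∀ t : T, t ∈ Submodule.span K
      {b | ∃ Js : List α, (∀ J ∈ Js, P J) ∧ b = (Js.map tg).prod})
    (hS : ∀ J, P J → ag J ∈ S) (hS' : S ≤ Algebra.adjoin K {b | ∃ J, P J ∧ b = ag J}) :
    ∃ θ : T ≃ₐ[K] S, ∀ J, P J → (θ (tg J) : A) = ag J := by
  have t0_one : t0 1 = 1 := by simpa using t0_mon [] (by simp)
  have t0_mul : ∀ a b, t0 (a * b) = t0 a * t0 b := by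
    intro a b
    refine Submodule.span_induction₂ (p := fun a b _ _ => t0 (a * b) = t0 a * t0 b)
      ?_ ?_ ?_ ?_ ?_ ?_ ?_ (tspan a) (tspan b)
    · rintro _ _ ⟨Js, h, rfl⟩ ⟨Js', h', rfl⟩
      rw [t0_mon _ h, t0_mon _ h', ← List.prod_append, ← List.prod_append, ← List.map_append,
        ← List.map_append, t0_mon]
      intro J hJ
      rcases List.mem_append.1 hJ with hJ | hJ
      · exact h J hJ
      · exact h' J hJ
    · intro b _; simp
    · intro b _; simp
    · intro a b c _ _ _ h1 h2; rw [add_mul, map_add, map_add, add_mul, h1, h2]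
    · intro a b c _ _ _ h1 h2; rw [mul_add, map_add, map_add, mul_add, h1, h2]
    · intro c a b _ _ h1; rw [smul_mul_assoc, map_smul, map_smul, h1, smul_mul_assoc]
    · intro c a b _ _ h1; rw [mul_smul_comm, map_smul, map_smul, h1, mul_smul_comm]
  let t1 : T →ₐ[K] A := AlgHom.ofLinearMap t0 t0_one t0_mul
  have t1_gr : ∀ J, P J → t1 (tg J) = ag J := by
    intro J hJ
    have := t0_mon [J] (by simpa using hJ)
    change t0 (tg J) = ag J
    simpa using this
  have hrange : t1.range = S := by
    apply le_antisymm
    · rintro _ ⟨t, rfl⟩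
      have ht := tspan t
      change t0 t ∈ _
      induction ht using Submodule.span_induction with
      | mem a ha =>
        obtain ⟨Js, h, rfl⟩ := ha
        rw [t0_mon Js h]
        apply Subalgebra.list_prod_mem
        intro x hx
        obtain ⟨J, hJ, rfl⟩ := List.mem_map.1 hx
        exact hS J (h J hJ)
      | zero => rw [map_zero]; exact Subalgebra.zero_mem _
      | add a b _ _ ha hb => rw [map_add]; exact Subalgebra.add_mem _ ha hb
      | smul c a _ ha => rw [map_smul]; exact Subalgebra.smul_mem _ ha _
    · refine hS'.trans ?_
      rw [Algebra.adjoin_le_iff]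
      rintro _ ⟨J, hJ, rfl⟩
      exact ⟨tg J, t1_gr J hJ⟩
  let e1 : T ≃ₐ[K] t1.range := AlgEquiv.ofInjective t1 t0_inj
  let e2 : t1.range ≃ₐ[K] S := Subalgebra.equivOfEq _ _ hrange
  exact ⟨e1.trans e2, fun J hJ => t1_gr J hJ⟩

/-- the twisted shift map -/
noncomputable def thetaL {A T : Type*} [Semiring A] [Algebra K A] {S : Subalgebra K A}
    [Semiring T] [Algebra K T] (𝒜 : (Fin n → ℤ) → Submodule K S) [GradedAlgebra 𝒜]
    (l : (Fin n → ℤ) → K) (v : S →ₗ[K] A) (t : S ≃ₗ[K] T) : T →ₗ[K] A :=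
  v ∘ₗ Lam 𝒜 l ∘ₗ t.symm.toLinearMap

theorem thetaL_inj {A T : Type*} [Semiring A] [Algebra K A] {S : Subalgebra K A}
    [Semiring T] [Algebra K T] (𝒜 : (Fin n → ℤ) → Submodule K S) [GradedAlgebra 𝒜]
    (l : (Fin n → ℤ) → K) (v : S →ₗ[K] A) (t : S ≃ₗ[K] T) (hl : ∀ t, l t ≠ 0)
    (hv : Function.Injective v) : Function.Injective (thetaL 𝒜 l v t) :=
  hv.comp ((Lam_inj 𝒜 l hl).comp t.symm.injective)

theorem thetaL_mem {A T : Type*} [Semiring A] [Algebra K A] {S : Subalgebra K A}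
    [Semiring T] [Algebra K T] (𝒜 : (Fin n → ℤ) → Submodule K S) [GradedAlgebra 𝒜]
    (l : (Fin n → ℤ) → K) (v : S →ₗ[K] A) (t : S ≃ₗ[K] T) {s : Fin n → ℤ} {a : S}
    (ha : a ∈ 𝒜 s) : thetaL 𝒜 l v t (t a) = l s • v a := by
  simp only [thetaL, LinearMap.comp_apply, LinearEquiv.coe_coe, LinearEquiv.symm_apply_apply]
  rw [Lam_of_mem 𝒜 _ ha, map_smul]

theorem span_aux {A T : Type*} [Semiring A] [Algebra K A] {S : Subalgebra K A}
    [Semiring T] [Algebra K T] (t : S ≃ₗ[K] T) (s : Set S) (hs : ∀ a, a ∈ Submodule.span K s) (W : Submodule K T)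
    (h : ∀ a ∈ s, t a ∈ W) (x : T) : x ∈ W := by
  obtain ⟨a, rfl⟩ := t.surjective x
  have : Submodule.span K s ≤ W.comap t.toLinearMap := Submodule.span_le.2 h
  exact this (hs a)

end Final
end QG


namespace QG
section Final
variable {K : Type*} [Field K] {q p : K} {m n N : ℕ}

theorem nuJ_ne (hq : q ≠ 0) (J : Finset (Fin (N + 1))) : nuJ q J ≠ 0 := by
  unfold nuJ; split_ifs
  · exact zpow_ne_zero _ hq
  · exact one_ne_zero

/-- restriction of the shift map to the quantum grassmannian -/
noncomputable def PsiG (hq : q ≠ 0) (m N : ℕ) :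
    ↥(qGrass K q m (N + 1)) →ₗ[K] QMat K q m (N + 1) :=
  Psi hq m N ∘ₗ (qGrass K q m (N + 1)).val.toLinearMap

theorem PsiG_inj (hq : q ≠ 0) : Function.Injective (PsiG hq m N) := by
  intro a b hab
  exact Subtype.ext (Psi_inj hq hab)

theorem PsiG_monE (hq : q ≠ 0) (Js : List (Finset (Fin (N + 1)))) :
    PsiG hq m N (monE K q m Js) = Psi hq m N (mon K q m Js) := by
  rw [← monE_coe]; rfl

theorem grE_range (hq : q ≠ 0) : qGrass K q m (N + 1) ≤
    Algebra.adjoin K {b | ∃ J : Finset (Fin (N + 1)), J.card = m ∧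
      b = nuJ q J • grMinor K q m (sh J)} := by
  rw [qGrass, Algebra.adjoin_le_iff]
  rintro _ ⟨J, rfl⟩
  by_cases hJ : J.card = m
  · obtain ⟨J', rfl⟩ := sh_surj J
    rw [card_sh] at hJ
    have : grMinor K q m (sh J') = (nuJ q J')⁻¹ • nuJ q J' • grMinor K q m (sh J') := by
      rw [smul_smul, inv_mul_cancel₀ (nuJ_ne hq J'), one_smul]
    rw [this]
    refine Subalgebra.smul_mem _ ?_ _
    apply Algebra.subset_adjoin
    exact ⟨J', hJ, rfl⟩
  · rw [grMinor, dif_neg hJ]; exact Subalgebra.zero_mem _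

theorem gr_mem (J : Finset (Fin (N + 1))) :
    nuJ q J • grMinor K q m (sh J) ∈ qGrass K q m (N + 1) :=
  Subalgebra.smul_mem _ (grE K q m (sh J)).2 _

theorem tw_span (hq : q ≠ 0) (hq2 : q ^ 2 ≠ 1) (hp : p ≠ 0) (hm : 0 < m) (hpm : p ^ m = q ^ 2)
    (h0 : 0 < N + 1)
    (𝒜 : (Fin (N + 1) → ℤ) → Submodule K ↥(qGrass K q m (N + 1))) [GradedAlgebra 𝒜]
    (hhom : ∀ J : Finset (Fin (N + 1)), J.card = m → grE K q m J ∈ 𝒜 (contentOf J))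
    {T : Type*} [Ring T] [Algebra K T]
    (tw : CocycleTwist K (↥(qGrass K q m (N + 1))) 𝒜 (cmap K h0 p) T) (x : T) :
    x ∈ Submodule.span K {b | ∃ Js : List (Finset (Fin (N + 1))), (∀ J ∈ Js, J.card = m) ∧
      b = (Js.map fun J => tw.τ (grE K q m J)).prod} := by
  refine span_aux tw.τ _ monE_span _ ?_ x
  rintro _ ⟨Js, h, rfl⟩
  obtain ⟨hmem, C, cf, hC, h1, h2, h3⟩ := key hq hq2 hp hm hpm h0 𝒜 hhom tw Js h
  have : tw.τ (monE K q m Js) = C⁻¹ • (Js.map fun J => tw.τ (grE K q m J)).prod := by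
    rw [h1, smul_smul, inv_mul_cancel₀ hC, one_smul]
  rw [this]
  exact Submodule.smul_mem _ _ (Submodule.subset_span ⟨Js, h, rfl⟩)

/-- the twisted shift map on the quantum grassmannian -/
noncomputable def thetaG (hq : q ≠ 0) (p : K)
    (𝒜 : (Fin (N + 1) → ℤ) → Submodule K ↥(qGrass K q m (N + 1))) [GradedAlgebra 𝒜]
    {T : Type*} [Ring T] [Algebra K T] (t : ↥(qGrass K q m (N + 1)) ≃ₗ[K] T) :
    T →ₗ[K] QMat K q m (N + 1) :=
  thetaL 𝒜 (lam q p m) (PsiG hq m N) t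

theorem thetaG_inj (hq : q ≠ 0) (hp : p ≠ 0)
    (𝒜 : (Fin (N + 1) → ℤ) → Submodule K ↥(qGrass K q m (N + 1))) [GradedAlgebra 𝒜]
    {T : Type*} [Ring T] [Algebra K T] (t : ↥(qGrass K q m (N + 1)) ≃ₗ[K] T) :
    Function.Injective (thetaG hq p 𝒜 t) :=
  thetaL_inj 𝒜 _ _ _ (fun t => lamN_ne hq hp _ _) (PsiG_inj hq)

theorem thetaG_mem (hq : q ≠ 0)
    (𝒜 : (Fin (N + 1) → ℤ) → Submodule K ↥(qGrass K q m (N + 1))) [GradedAlgebra 𝒜]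
    {T : Type*} [Ring T] [Algebra K T] (t : ↥(qGrass K q m (N + 1)) ≃ₗ[K] T)
    {s : Fin (N + 1) → ℤ} {a : ↥(qGrass K q m (N + 1))} (ha : a ∈ 𝒜 s) :
    thetaG hq p 𝒜 t (t a) = lam q p m s • PsiG hq m N a :=
  thetaL_mem 𝒜 _ _ _ ha

theorem smul_abs {A T : Type*} [Semiring A] [Algebra K A] [Semiring T] [Algebra K T]
    (f : T →ₗ[K] A) {x y : T} {u v w : A} {C l cf ν : K} (h1 : x = C • y)
    (h2 : f y = l • u) (h3 : u = cf • v) (h4 : w = ν • v) (h : C * l * cf = ν) : f x = w := by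
  rw [h1, map_smul, h2, h3, h4, smul_smul, smul_smul, h]

theorem thetaG_prod (hq : q ≠ 0) (hq2 : q ^ 2 ≠ 1) (hp : p ≠ 0) (hm : 0 < m) (hpm : p ^ m = q ^ 2)
    (h0 : 0 < N + 1)
    (𝒜 : (Fin (N + 1) → ℤ) → Submodule K ↥(qGrass K q m (N + 1))) [GradedAlgebra 𝒜]
    (hhom : ∀ J : Finset (Fin (N + 1)), J.card = m → grE K q m J ∈ 𝒜 (contentOf J))
    {T : Type*} [Ring T] [Algebra K T]
    (tw : CocycleTwist K (↥(qGrass K q m (N + 1))) 𝒜 (cmap K h0 p) T)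
    (Js : List (Finset (Fin (N + 1)))) (h : ∀ J ∈ Js, J.card = m) :
    thetaG hq p 𝒜 tw.τ (Js.map fun J => tw.τ (grE K q m J)).prod =
      (Js.map fun J => nuJ q J • grMinor K q m (sh J)).prod := by
  obtain ⟨hmem, C, cf, hC, h1, h2, h3⟩ := key hq hq2 hp hm hpm h0 𝒜 hhom tw Js h
  have e := thetaG_mem (p := p) hq 𝒜 tw.τ hmem
  rw [lam_cont hm Js h] at e
  have e2 := (PsiG_monE hq Js).trans h2
  have e3 : (Js.map fun J => nuJ q J • grMinor K q m (sh J)).prod =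
      (Js.map (nuJ q)).prod • mon K q m (Js.map sh) := by
    rw [list_smul_prod, mon, List.map_map]; rfl
  exact smul_abs _ h1 e e2 e3 h3

theorem final (hq : q ≠ 0) (hq2 : q ^ 2 ≠ 1) (hp : p ≠ 0) (hm : 0 < m) (hpm : p ^ m = q ^ 2)
    (h0 : 0 < N + 1)
    (𝒜 : (Fin (N + 1) → ℤ) → Submodule K ↥(qGrass K q m (N + 1))) [GradedAlgebra 𝒜]
    (hhom : ∀ J : Finset (Fin (N + 1)), J.card = m → grE K q m J ∈ 𝒜 (contentOf J))
    {T : Type*} [Ring T] [Algebra K T]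
    (tw : CocycleTwist K (↥(qGrass K q m (N + 1))) 𝒜 (cmap K h0 p) T) :
    ∃ θ : T ≃ₐ[K] ↥(qGrass K q m (N + 1)),
      ∀ J : Finset (Fin (N + 1)), J.card = m →
        (θ (tw.τ (grE K q m J)) : QMat K q m (N + 1)) = nuJ q J • grMinor K q m (sh J) :=
  final_abs (qGrass K q m (N + 1)) (fun J : Finset (Fin (N + 1)) => J.card = m)
    (fun J => tw.τ (grE K q m J)) (fun J => nuJ q J • grMinor K q m (sh J))
    (thetaG hq p 𝒜 tw.τ) (thetaG_inj hq hp 𝒜 tw.τ)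
    (thetaG_prod hq hq2 hp hm hpm h0 𝒜 hhom tw)
    (tw_span hq hq2 hp hm hpm h0 𝒜 hhom tw) (fun J _ => gr_mem J) (grE_range hq)

end Final

/-- **Main theorem.** The twist `T(O_q(G(m,n)))` of the quantum
grassmannian (graded by content, twisted by the cocycle `c` with `p^m = q²`) is
isomorphic to `O_q(G(m,n))` via a `K`-algebra isomorphism `θ` sending
`[i_1,…,i_m]'` to `[i_1+1,…,i_m+1]` when `i_m < n`, and sending `[i_1,…,i_{m-1},n]'`
to `q⁻²[1,i_1+1,…,i_{m-1}+1]`;  i.e. up to nonzero scalars, `θ ∘ T` cycles the indices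
of generating quantum minors by the Coxeter element `(1 2 … n)`. -/
theorem twisted_grassmannian_iso_grassmannian
    (K : Type*) [Field K] (q : K) (hq : q ≠ 0) (hroot : ∀ k : ℕ, 0 < k → q ^ k ≠ 1)
    (m n : ℕ) (hm : 0 < m) (hmn : m < n)
    (p : K) (hp : p ^ m = q ^ 2)
    (𝒜 : (Fin n → ℤ) → Submodule K ↥(qGrass K q m n)) [GradedAlgebra 𝒜]
    (hhom : ∀ J : Finset (Fin n), J.card = m → grE K q m J ∈ 𝒜 (contentOf J))
    (T : Type*) [Ring T] [Algebra K T]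
    (tw : CocycleTwist K (↥(qGrass K q m n)) 𝒜 (cmap K (show 0 < n by omega) p) T) :
    ∃ θ : T ≃ₐ[K] ↥(qGrass K q m n),
      ∀ J : Finset (Fin n), J.card = m →
        (lastIdx n (show 0 < n by omega) ∉ J →
          θ (tw.τ (grE K q m J)) = grE K q m (shiftSet (show 0 < n by omega) J)) ∧
        (lastIdx n (show 0 < n by omega) ∈ J →
          θ (tw.τ (grE K q m J)) =
            q ^ (-2 : ℤ) • grE K q m (shiftSet (show 0 < n by omega) J)) := by
  obtain ⟨N, rfl⟩ : ∃ N, n = N + 1 := ⟨n - 1, by omega⟩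
  have hp0 : p ≠ 0 := by
    rintro rfl
    rw [zero_pow hm.ne'] at hp
    exact pow_ne_zero 2 hq hp.symm
  obtain ⟨θ, hθ⟩ := final hq (hroot 2 (by norm_num)) hp0 hm hp (by omega) 𝒜 hhom tw
  refine ⟨θ, fun J hJ => ⟨fun hl => ?_, fun hl => ?_⟩⟩
  · have hl' : Fin.last N ∉ J := hl
    apply Subtype.ext
    rw [hθ J hJ, nuJ, if_neg hl', one_smul]
    rfl
  · have hl' : Fin.last N ∈ J := hl
    apply Subtype.ext
    rw [hθ J hJ, nuJ, if_pos hl']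
    rfl

end QG
end
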